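/- arXiv:2605.22006 — 2 statements merged into one kernel-verified Lean document; each statement's English description precedes it below -/
import Mathlib

section
/- Assume 0 < α < 1/2. There exists a constant C depending only on α and d (independent of ν and a) such that for every a > 0 and all t₁, t₂ ∈ [a M₁^{−2/(1+α)} ν^{(1−α)/(1+α)}, T): |x′(t₁) − x′(t₂)| ≤ C (a^{−1} + 1) M₁^{1/(1−α)} |t₁ − t₂|^{α/(1−α)}. -/
open MeasureTheory Set

noncomputable def heatKernel (d : ℕ) (s : ℝ) (y : EuclideanSpace ℝ (Fin d)) : ℝ :=
  (4 * Real.pi * s) ^ (-(d : ℝ) / 2) * Real.exp (-(‖y‖ ^ 2) / (4 * s))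

open scoped ContDiff

abbrev Vec (d : ℕ) := EuclideanSpace ℝ (Fin d)

/-- The `i`-th partial derivative. -/
noncomputable def pd {d : ℕ} (i : Fin d) (g : Vec d → ℝ) (x : Vec d) : ℝ :=
  fderiv ℝ g x (EuclideanSpace.single i 1)

noncomputable def lap {d : ℕ} (g : Vec d → ℝ) (x : Vec d) : ℝ :=
  ∑ j, pd j (pd j g) x

/-- The unnormalized Gaussian, stationary under the heat flow in self-similar variables. -/
noncomputable def gauss {d : ℕ} (z : Vec d) : ℝ := Real.exp (-(‖z‖ ^ 2) / 4)

/-- Polynomial multiples of the Gaussian. -/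
inductive GaussPoly {d : ℕ} : (Vec d → ℝ) → Prop
  | base : GaussPoly gauss
  | coord (i : Fin d) (κ : Vec d → ℝ) : GaussPoly κ → GaussPoly (fun z => z i * κ z)
  | smul (c : ℝ) (κ : Vec d → ℝ) : GaussPoly κ → GaussPoly (fun z => c * κ z)
  | add (κ κ' : Vec d → ℝ) : GaussPoly κ → GaussPoly κ' → GaussPoly (fun z => κ z + κ' z)

section Kernels

variable {d : ℕ}

lemma pd_add {g h : Vec d → ℝ} (hg : Differentiable ℝ g) (hh : Differentiable ℝ h) (i : Fin d) :
    pd i (fun x => g x + h x) = fun x => pd i g x + pd i h x := by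
  funext x
  unfold pd
  rw [fderiv_fun_add (hg x) (hh x)]
  rfl

lemma pd_sub {g h : Vec d → ℝ} (hg : Differentiable ℝ g) (hh : Differentiable ℝ h) (i : Fin d) :
    pd i (fun x => g x - h x) = fun x => pd i g x - pd i h x := by
  funext x
  unfold pd
  rw [fderiv_fun_sub (hg x) (hh x)]
  rfl

lemma pd_mul {g h : Vec d → ℝ} (hg : Differentiable ℝ g) (hh : Differentiable ℝ h) (i : Fin d) :
    pd i (fun x => g x * h x) = fun x => g x * pd i h x + h x * pd i g x := by
  funext x
  unfold pd
  rw [fderiv_fun_mul (hg x) (hh x)]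
  simp

lemma pd_const (c : ℝ) (i : Fin d) : pd i (fun _ => c) = fun _ => 0 := by
  funext x
  simp [pd]

lemma pd_const_mul (c : ℝ) {g : Vec d → ℝ} (hg : Differentiable ℝ g) (i : Fin d) :
    pd i (fun x => c * g x) = fun x => c * pd i g x := by
  rw [pd_mul (differentiable_const c) hg, pd_const]
  simp

lemma pd_sub_const (c : ℝ) (g : Vec d → ℝ) (i : Fin d) :
    pd i (fun x => g x - c) = pd i g := by
  funext x
  unfold pd
  rw [fderiv_sub_const]

lemma pd_sum {ι : Type*} (s : Finset ι) {g : ι → Vec d → ℝ} (hg : ∀ a ∈ s, Differentiable ℝ (g a))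
    (i : Fin d) : pd i (fun x => ∑ a ∈ s, g a x) = fun x => ∑ a ∈ s, pd i (g a) x := by
  funext x
  unfold pd
  rw [fderiv_fun_sum (fun a ha => hg a ha x)]
  simp

lemma hasFDerivAt_coord (i : Fin d) (z : Vec d) :
    HasFDerivAt (fun z : Vec d => z i) (EuclideanSpace.proj i : Vec d →L[ℝ] ℝ) z :=
  (EuclideanSpace.proj i : Vec d →L[ℝ] ℝ).hasFDerivAt

lemma contDiff_coord (i : Fin d) : ContDiff ℝ ∞ (fun z : Vec d => z i) :=
  (EuclideanSpace.proj i : Vec d →L[ℝ] ℝ).contDiff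

lemma contDiff_gauss : ContDiff ℝ ∞ (gauss (d := d)) := by
  unfold gauss
  exact Real.contDiff_exp.comp (((contDiff_norm_sq ℝ).neg).div_const 4)

lemma pd_gauss (i : Fin d) : pd i gauss = fun z : Vec d => (-1 / 2) * (z i * gauss z) := by
  funext z
  have h1 : HasFDerivAt (fun z : Vec d => -(‖z‖ ^ 2) / 4) ((-(1 / 2 : ℝ)) • innerSL ℝ z) z := by
    have := ((hasStrictFDerivAt_norm_sq z).hasFDerivAt.const_mul (-(1 / 4 : ℝ)))
    refine (this.congr_of_eventuallyEq (Filter.Eventually.of_forall fun y => ?_)).congr_fderiv ?_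
    · ring
    · ext y
      simp
      ring
  have h2 := h1.exp
  unfold pd
  have h3 : HasFDerivAt (gauss (d := d)) _ z := h2
  rw [h3.fderiv]
  simp [gauss, EuclideanSpace.inner_single_right]
  ring

lemma GaussPoly.contDiff {κ : Vec d → ℝ} (h : GaussPoly κ) : ContDiff ℝ ∞ κ := by
  induction h with
  | base => exact contDiff_gauss
  | coord i κ _ ih => exact (contDiff_coord i).mul ih
  | smul c κ _ ih => exact contDiff_const.mul ih
  | add κ κ' _ _ ih ih' => exact ih.add ih'

lemma GaussPoly.differentiable {κ : Vec d → ℝ} (h : GaussPoly κ) : Differentiable ℝ κ :=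
  h.contDiff.differentiable (by simp)

lemma GaussPoly.pd {κ : Vec d → ℝ} (h : GaussPoly κ) (i : Fin d) : GaussPoly (pd i κ) := by
  induction h with
  | base => rw [pd_gauss]; exact .smul _ _ (.coord i _ .base)
  | coord j κ h ih =>
    rw [pd_mul (fun z => (hasFDerivAt_coord j z).differentiableAt) h.differentiable]
    have : _root_.pd i (fun z : Vec d => z j)
        = fun _ => (EuclideanSpace.single i (1 : ℝ) : Vec d) j := by
      funext z
      unfold _root_.pd
      rw [(hasFDerivAt_coord j z).fderiv]
      simp
    rw [this]
    refine .add _ _ (.coord j _ ih) ?_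
    simp_rw [mul_comm (κ _)]
    exact .smul _ _ h
  | smul c κ h ih =>
    rw [pd_const_mul c h.differentiable]
    exact .smul _ _ ih
  | add κ κ' h h' ih ih' =>
    rw [pd_add h.differentiable h'.differentiable]
    exact .add _ _ ih ih'

lemma GaussPoly.decay {κ : Vec d → ℝ} (h : GaussPoly κ) :
    ∀ n : ℕ, ∃ C : ℝ, ∀ z, (1 + ‖z‖) ^ n * |κ z| ≤ C := by
  induction h with
  | base =>
    intro n
    refine ⟨n.factorial * Real.exp 2, fun z => ?_⟩
    have h0 : (0 : ℝ) ≤ 1 + ‖z‖ := by positivity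
    have h1 := Real.pow_div_factorial_le_exp (1 + ‖z‖) h0 n
    have hn : (0 : ℝ) < n.factorial := by positivity
    rw [div_le_iff₀ hn] at h1
    unfold gauss
    rw [abs_of_pos (Real.exp_pos _)]
    calc (1 + ‖z‖) ^ n * Real.exp (-‖z‖ ^ 2 / 4)
        ≤ (Real.exp (1 + ‖z‖) * n.factorial) * Real.exp (-‖z‖ ^ 2 / 4) := by gcongr
      _ = n.factorial * Real.exp (1 + ‖z‖ + -‖z‖ ^ 2 / 4) := by rw [Real.exp_add (1 + ‖z‖)]; ring
      _ ≤ _ := by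
        gcongr
        nlinarith [sq_nonneg (‖z‖ - 2)]
  | coord i κ _ ih =>
    intro n
    obtain ⟨C, hC⟩ := ih (n + 1)
    refine ⟨C, fun z => le_trans ?_ (hC z)⟩
    rw [abs_mul, pow_succ, mul_assoc]
    have : |z i| ≤ 1 + ‖z‖ := by
      have := PiLp.norm_apply_le z i
      rw [Real.norm_eq_abs] at this
      linarith
    gcongr
  | smul c κ _ ih =>
    intro n
    obtain ⟨C, hC⟩ := ih n
    refine ⟨|c| * C, fun z => ?_⟩
    rw [abs_mul, mul_left_comm]
    exact mul_le_mul_of_nonneg_left (hC z) (abs_nonneg c)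
  | add κ κ' _ _ ih ih' =>
    intro n
    obtain ⟨C, hC⟩ := ih n
    obtain ⟨C', hC'⟩ := ih' n
    refine ⟨C + C', fun z => ?_⟩
    calc _ ≤ (1 + ‖z‖) ^ n * (|κ z| + |κ' z|) := by gcongr; exact abs_add_le _ _
      _ ≤ _ := by rw [mul_add]; exact add_le_add (hC z) (hC' z)

lemma GaussPoly.continuous {κ : Vec d → ℝ} (h : GaussPoly κ) : Continuous κ :=
  h.contDiff.continuous

lemma GaussPoly.integrable_mul {κ : Vec d → ℝ} (h : GaussPoly κ) {g : Vec d → ℝ}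
    (hg : AEStronglyMeasurable g) {M : ℝ} (n : ℕ) (hM : ∀ z, |g z| ≤ M * (1 + ‖z‖) ^ n) :
    Integrable (fun z => κ z * g z) := by
  obtain ⟨C, hC⟩ := h.decay (n + (d + 1))
  have hM0 : 0 ≤ M := by
    have := (abs_nonneg _).trans (hM 0)
    simpa using this
  have hI : Integrable (fun z : Vec d => C * M * (1 + ‖z‖) ^ (-((d + 1 : ℕ) : ℝ))) := by
    refine (integrable_one_add_norm ?_).const_mul _
    simp
  refine hI.mono' (h.continuous.aestronglyMeasurable.mul hg) (Filter.Eventually.of_forall fun z => ?_)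
  have hpos : (0 : ℝ) < 1 + ‖z‖ := by positivity
  rw [Real.rpow_neg hpos.le, Real.rpow_natCast, ← div_eq_mul_inv, le_div_iff₀ (by positivity),
    Real.norm_eq_abs, abs_mul]
  calc |κ z| * |g z| * (1 + ‖z‖) ^ (d + 1)
      ≤ |κ z| * (M * (1 + ‖z‖) ^ n) * (1 + ‖z‖) ^ (d + 1) := by gcongr; exact hM z
    _ = ((1 + ‖z‖) ^ (n + (d + 1)) * |κ z|) * M := by ring
    _ ≤ C * M := by gcongr; exact hC z

lemma GaussPoly.integrable_mul_bdd {κ : Vec d → ℝ} (h : GaussPoly κ) {g : Vec d → ℝ}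
    (hg : Continuous g) {M : ℝ} (hM : ∀ z, |g z| ≤ M) :
    Integrable (fun z => κ z * g z) :=
  h.integrable_mul hg.aestronglyMeasurable 0 (M := M) (by simpa using hM)

lemma GaussPoly.integrable_moment {κ : Vec d → ℝ} (h : GaussPoly κ) {β : ℝ} (hβ : 0 ≤ β)
    (hβ1 : β ≤ 1) : Integrable (fun z => |κ z| * ‖z‖ ^ β) := by
  have hc : Continuous (fun z : Vec d => ‖z‖ ^ β) := by
    exact continuous_norm.rpow_const (fun _ => Or.inr hβ)
  have : Integrable (fun z => κ z * ‖z‖ ^ β) := by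
    refine h.integrable_mul hc.aestronglyMeasurable 1 (M := 1) (fun z => ?_)
    rw [abs_of_nonneg (by positivity), pow_one, one_mul]
    calc ‖z‖ ^ β ≤ (1 + ‖z‖) ^ β := by gcongr; linarith
      _ ≤ (1 + ‖z‖) ^ (1 : ℝ) := by
        apply Real.rpow_le_rpow_of_exponent_le _ hβ1
        linarith [norm_nonneg z]
      _ = _ := Real.rpow_one _
  refine this.norm.congr (Filter.Eventually.of_forall fun z => ?_)
  simp only [norm_mul, Real.norm_eq_abs]
  rw [abs_of_nonneg (a := ‖z‖ ^ β) (by positivity)]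

lemma integral_gauss_pos : 0 < ∫ z : Vec d, gauss z := by
  have hi : Integrable (fun z : Vec d => gauss z) := by
    simpa using GaussPoly.base.integrable_mul_bdd (d := d) (g := fun _ => 1) continuous_const (M := 1)
      (by simp)
  rw [integral_pos_iff_support_of_nonneg (f := fun z : Vec d => gauss z)
    (fun z => (Real.exp_pos _).le) hi]
  have : Function.support (fun z : Vec d => gauss z) = univ := by
    ext z
    simp [gauss, (Real.exp_pos _).ne']
  rw [this]
  exact isOpen_univ.measure_pos _ univ_nonempty

end Kernels

noncomputable def lat {d : ℕ} (n : Fin d → ℤ) : Vec d :=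
  (EuclideanSpace.equiv (Fin d) ℝ).symm (fun i => (n i : ℝ))

/-- Smooth `ℤ^d`-periodic functions. -/
structure PerSmooth {d : ℕ} (g : Vec d → ℝ) : Prop where
  smooth : ContDiff ℝ ∞ g
  periodic : ∀ x n, g (x + lat n) = g x

section Periodic

variable {d : ℕ}

lemma exists_lat_add_mem (x : Vec d) : ∃ n, x + lat n ∈ Metric.closedBall (0 : Vec d) (Real.sqrt d) := by
  refine ⟨fun i => -⌊x i⌋, ?_⟩
  rw [mem_closedBall_zero_iff, EuclideanSpace.norm_eq]
  apply Real.sqrt_le_sqrt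
  calc _ ≤ ∑ _i : Fin d, (1 : ℝ) := by
        refine Finset.sum_le_sum fun i _ => ?_
        have h1 := Int.floor_le (x i)
        have h2 := Int.lt_floor_add_one (x i)
        have : (x + lat fun i => -⌊x i⌋ : Vec d) i = x i - ⌊x i⌋ := by
          simp [lat, sub_eq_add_neg]
        rw [this, Real.norm_eq_abs, abs_of_nonneg (by linarith)]
        nlinarith
    _ = _ := by simp

lemma exists_bound_of_periodic {F : Type*} [NormedAddCommGroup F] {G : ℝ × Vec d → F} {a b : ℝ}
    (hG : ContinuousOn G (Icc a b ×ˢ univ))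
    (hper : ∀ s ∈ Icc a b, ∀ x n, G (s, x + lat n) = G (s, x)) :
    ∃ M, ∀ s ∈ Icc a b, ∀ x, ‖G (s, x)‖ ≤ M := by
  have hK : IsCompact (Icc a b ×ˢ Metric.closedBall (0 : Vec d) (Real.sqrt d)) :=
    isCompact_Icc.prod (isCompact_closedBall _ _)
  obtain ⟨M, hM⟩ := hK.exists_bound_of_continuousOn (hG.mono (prod_mono le_rfl (subset_univ _)))
  refine ⟨M, fun s hs x => ?_⟩
  obtain ⟨n, hn⟩ := exists_lat_add_mem x
  rw [← hper s hs x n]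
  exact hM _ ⟨hs, hn⟩

namespace PerSmooth

variable {g h : Vec d → ℝ}

lemma differentiable (hg : PerSmooth g) : Differentiable ℝ g := hg.smooth.differentiable (by simp)

lemma continuous (hg : PerSmooth g) : Continuous g := hg.smooth.continuous

lemma bounded (hg : PerSmooth g) : ∃ M, ∀ x, |g x| ≤ M := by
  obtain ⟨M, hM⟩ := exists_bound_of_periodic (G := fun q : ℝ × Vec d => g q.2) (a := 0) (b := 0)
    (hg.continuous.comp continuous_snd).continuousOn (fun s _ x n => hg.periodic x n)
  exact ⟨M, fun x => hM 0 (by simp) x⟩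

lemma pd (hg : PerSmooth g) (i : Fin d) : PerSmooth (pd i g) where
  smooth := (hg.smooth.fderiv_right (m := ∞) (by simp)).clm_apply contDiff_const
  periodic x n := by
    unfold _root_.pd
    rw [← fderiv_comp_add_right]
    simp_rw [hg.periodic]

lemma add (hg : PerSmooth g) (hh : PerSmooth h) : PerSmooth (fun x => g x + h x) :=
  ⟨hg.smooth.add hh.smooth, fun x n => by rw [hg.periodic, hh.periodic]⟩

lemma sub (hg : PerSmooth g) (hh : PerSmooth h) : PerSmooth (fun x => g x - h x) :=
  ⟨hg.smooth.sub hh.smooth, fun x n => by rw [hg.periodic, hh.periodic]⟩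

lemma mul (hg : PerSmooth g) (hh : PerSmooth h) : PerSmooth (fun x => g x * h x) :=
  ⟨hg.smooth.mul hh.smooth, fun x n => by rw [hg.periodic, hh.periodic]⟩

lemma const (c : ℝ) : PerSmooth (fun _ : Vec d => c) := ⟨contDiff_const, fun _ _ => rfl⟩

lemma sum {ι : Type*} {s : Finset ι} {g : ι → Vec d → ℝ} (hg : ∀ a ∈ s, PerSmooth (g a)) :
    PerSmooth (fun x => ∑ a ∈ s, g a x) :=
  ⟨ContDiff.sum fun a ha => (hg a ha).smooth,
    fun x n => Finset.sum_congr rfl fun a ha => (hg a ha).periodic x n⟩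

lemma lap (hg : PerSmooth g) : PerSmooth (lap g) :=
  sum fun j _ => (hg.pd j).pd j

lemma pd_comm (hg : PerSmooth g) (i j : Fin d) : _root_.pd i (_root_.pd j g) = _root_.pd j (_root_.pd i g) := by
  funext x
  have h2 : DifferentiableAt ℝ (fderiv ℝ g) x :=
    (hg.smooth.fderiv_right (m := ∞) (by simp)).differentiable (by simp) x
  have key : ∀ a b : Fin d, _root_.pd a (_root_.pd b g) x
      = fderiv ℝ (fderiv ℝ g) x (EuclideanSpace.single a 1) (EuclideanSpace.single b 1) := by
    intro a b
    have := (h2.hasFDerivAt.clm_apply (hasFDerivAt_const (EuclideanSpace.single b (1 : ℝ) : Vec d) x)).fderiv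
    change fderiv ℝ (fun y => fderiv ℝ g y (EuclideanSpace.single b 1)) x _ = _
    rw [this]
    simp
  rw [key, key]
  exact (hg.smooth.contDiffAt.isSymmSndFDerivAt (by simpa using ENat.LEInfty.out)) _ _

end PerSmooth

end Periodic

/-- Average of the dilation of `g` by `r` against the kernel `κ`. -/
noncomputable def avg {d : ℕ} (κ : Vec d → ℝ) (r : ℝ) (g : Vec d → ℝ) : ℝ :=
  ∫ z, κ z * g (r • z)

section Average

variable {d : ℕ} {κ g h : Vec d → ℝ} {r : ℝ}

lemma integrable_avg (hκ : GaussPoly κ) (hg : PerSmooth g) (r : ℝ) :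
    Integrable (fun z => κ z * g (r • z)) := by
  obtain ⟨M, hM⟩ := hg.bounded
  exact hκ.integrable_mul_bdd (hg.continuous.comp (continuous_const_smul r)) (fun z => hM _)

lemma avg_add (hκ : GaussPoly κ) (hg : PerSmooth g) (hh : PerSmooth h) :
    avg κ r (fun x => g x + h x) = avg κ r g + avg κ r h := by
  unfold avg
  rw [← integral_add (integrable_avg hκ hg r) (integrable_avg hκ hh r)]
  simp_rw [mul_add]

lemma avg_sub (hκ : GaussPoly κ) (hg : PerSmooth g) (hh : PerSmooth h) :
    avg κ r (fun x => g x - h x) = avg κ r g - avg κ r h := by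
  unfold avg
  rw [← integral_sub (integrable_avg hκ hg r) (integrable_avg hκ hh r)]
  simp_rw [mul_sub]

lemma avg_const_mul (c : ℝ) : avg κ r (fun x => c * g x) = c * avg κ r g := by
  unfold avg
  rw [← integral_const_mul]
  simp_rw [mul_left_comm]

lemma avg_sum (hκ : GaussPoly κ) {ι : Type*} {s : Finset ι} {g : ι → Vec d → ℝ}
    (hg : ∀ a ∈ s, PerSmooth (g a)) :
    avg κ r (fun x => ∑ a ∈ s, g a x) = ∑ a ∈ s, avg κ r (g a) := by
  unfold avg
  rw [← integral_finsetSum _ fun a ha => integrable_avg hκ (hg a ha) r]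
  simp_rw [Finset.mul_sum]

lemma mul_avg_pd (hκ : GaussPoly κ) (hg : PerSmooth g) (r : ℝ) (i : Fin d) :
    r * avg κ r (pd i g) = -avg (pd i κ) r g := by
  have hfd : ∀ z, fderiv ℝ (fun z => g (r • z)) z (EuclideanSpace.single i 1) = r * pd i g (r • z) := by
    intro z
    rw [fderiv_comp_smul]
    rfl
  have hd : Differentiable ℝ (fun z => g (r • z)) := hg.differentiable.comp (by fun_prop)
  have := integral_mul_fderiv_eq_neg_fderiv_mul_of_integrable (μ := volume) (f := κ)
    (g := fun z => g (r • z)) (v := EuclideanSpace.single i 1)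
    (integrable_avg (hκ.pd i) hg r)
    (by
      simp_rw [hfd, mul_left_comm]
      exact (integrable_avg hκ (hg.pd i) r).const_mul r)
    (integrable_avg hκ hg r) (fun x _ => hκ.differentiable x) (fun x _ => hd x)
  simp_rw [hfd, mul_left_comm] at this
  rw [integral_const_mul] at this
  exact this

lemma avg_pd (hκ : GaussPoly κ) (hg : PerSmooth g) (hr : r ≠ 0) (i : Fin d) :
    avg κ r (pd i g) = -r⁻¹ * avg (pd i κ) r g := by
  have := mul_avg_pd hκ hg r i
  field_simp
  linarith

lemma abs_avg_le (hκ : GaussPoly κ) {β A : ℝ} (hβ : 0 ≤ β) (hβ1 : β ≤ 1) (hr : 0 ≤ r)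
    (hg : ∀ y, |g y| ≤ A * ‖y‖ ^ β) :
    |avg κ r g| ≤ (∫ z, |κ z| * ‖z‖ ^ β) * (A * r ^ β) := by
  rw [← integral_mul_const, ← Real.norm_eq_abs]
  refine norm_integral_le_of_norm_le ((hκ.integrable_moment hβ hβ1).mul_const _)
    (Filter.Eventually.of_forall fun z => ?_)
  rw [norm_mul, Real.norm_eq_abs, Real.norm_eq_abs, mul_assoc]
  refine mul_le_mul_of_nonneg_left ((hg _).trans_eq ?_) (abs_nonneg _)
  rw [norm_smul, Real.norm_of_nonneg hr, Real.mul_rpow hr (norm_nonneg _)]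
  ring

/-- Integrating the radial derivative by parts against the Gaussian produces the Laplacian. -/
lemma integral_gauss_radial (hg : PerSmooth g) (r : ℝ) :
    ∑ j, ∫ z, gauss z * (z j * pd j g (r • z)) = 2 * r * avg gauss r (lap g) := by
  have h : avg gauss r (lap g) = ∑ j, avg gauss r (pd j (pd j g)) :=
    avg_sum .base (fun j _ => (hg.pd j).pd j)
  rw [h, Finset.mul_sum]
  refine Finset.sum_congr rfl fun j _ => ?_
  rw [mul_assoc, mul_avg_pd .base (hg.pd j), pd_gauss]
  unfold avg
  rw [← integral_neg, ← integral_const_mul]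
  congr 1
  funext z
  ring

end Average

section Paths

variable {d : ℕ} {V : ℝ × Vec d → ℝ} {T : ℝ}

/-- Space-time functions on the open slab that are smooth, and periodic in space. -/
structure PerSmoothSlab {d : ℕ} (T : ℝ) (V : ℝ × Vec d → ℝ) : Prop where
  smooth : ContDiffOn ℝ ∞ V (Ioo 0 T ×ˢ univ)
  periodic : ∀ s x n, V (s, x + lat n) = V (s, x)

namespace PerSmoothSlab

lemma isOpen_slab : IsOpen (Ioo 0 T ×ˢ (univ : Set (Vec d))) := isOpen_Ioo.prod isOpen_univ

lemma contDiffAt (hV : PerSmoothSlab T V) {s : ℝ} (hs : s ∈ Ioo 0 T) (y : Vec d) :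
    ContDiffAt ℝ ∞ V (s, y) :=
  hV.smooth.contDiffAt (isOpen_slab.mem_nhds ⟨hs, mem_univ y⟩)

lemma hasFDerivAt (hV : PerSmoothSlab T V) {s : ℝ} (hs : s ∈ Ioo 0 T) (y : Vec d) :
    HasFDerivAt V (fderiv ℝ V (s, y)) (s, y) :=
  ((hV.contDiffAt hs y).differentiableAt (by simp)).hasFDerivAt

lemma fderiv_periodic (hV : PerSmoothSlab T V) (s : ℝ) (x : Vec d) (n : Fin d → ℤ) :
    fderiv ℝ V (s, x + lat n) = fderiv ℝ V (s, x) := by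
  have h := fderiv_comp_add_right (𝕜 := ℝ) (f := V) (x := (s, x)) ((0, lat n) : ℝ × Vec d)
  have h2 : (fun q : ℝ × Vec d => V (q + (0, lat n))) = V := by
    funext ⟨a, b⟩
    simp [hV.periodic]
  rw [h2] at h
  simpa using h.symm

lemma slice (hV : PerSmoothSlab T V) {s : ℝ} (hs : s ∈ Ioo 0 T) :
    PerSmooth (fun y => V (s, y)) where
  smooth := contDiff_iff_contDiffAt.2 fun y =>
    (hV.contDiffAt hs y).comp y (contDiff_prodMk_right s).contDiffAt
  periodic := hV.periodic s

lemma fderiv_apply (hV : PerSmoothSlab T V) (w : ℝ × Vec d) :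
    PerSmoothSlab T (fun q => fderiv ℝ V q w) where
  smooth := (hV.smooth.fderiv_of_isOpen isOpen_slab (m := ∞) (by simp)).clm_apply contDiffOn_const
  periodic s x n := by rw [hV.fderiv_periodic]

lemma fderiv_space (hV : PerSmoothSlab T V) {s : ℝ} (hs : s ∈ Ioo 0 T) (y w : Vec d) :
    fderiv ℝ V (s, y) (0, w) = fderiv ℝ (fun y => V (s, y)) y w := by
  have h := (hV.hasFDerivAt hs y).comp y (hasFDerivAt_prodMk_right s y)
  have h2 : HasFDerivAt (fun y => V (s, y)) _ y := h
  rw [h2.fderiv]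
  simp

lemma fderiv_time (hV : PerSmoothSlab T V) {s : ℝ} (hs : s ∈ Ioo 0 T) (y : Vec d) :
    HasDerivAt (fun t => V (t, y)) (fderiv ℝ V (s, y) (1, 0)) s :=
  (hV.hasFDerivAt hs y).comp_hasDerivAt s ((hasDerivAt_id s).prodMk (hasDerivAt_const s y))

/-- Space and time derivatives commute. -/
lemma pd_time (hV : PerSmoothSlab T V) {s : ℝ} (hs : s ∈ Ioo 0 T) (y : Vec d) (i : Fin d) :
    pd i (fun y => fderiv ℝ V (s, y) (1, 0)) y
      = deriv (fun t => pd i (fun y => V (t, y)) y) s := by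
  set e : Vec d := EuclideanSpace.single i 1
  have h2 : HasFDerivAt (fderiv ℝ V) (fderiv ℝ (fderiv ℝ V) (s, y)) (s, y) :=
    (((hV.contDiffAt hs y).fderiv_right (m := ∞) (by simp)).differentiableAt (by simp)).hasFDerivAt
  have hev : ∀ w, fderiv ℝ (fun q => fderiv ℝ V q w) (s, y)
      = (ContinuousLinearMap.apply ℝ ℝ w).comp (fderiv ℝ (fderiv ℝ V) (s, y)) := by
    intro w
    exact ((ContinuousLinearMap.apply ℝ ℝ w).hasFDerivAt.comp _ h2).fderiv
  have hl : pd i (fun y => fderiv ℝ V (s, y) (1, 0)) y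
      = fderiv ℝ (fderiv ℝ V) (s, y) (0, e) (1, 0) := by
    unfold pd
    rw [← (hV.fderiv_apply (1, 0)).fderiv_space hs, hev]
    rfl
  have hr : deriv (fun t => pd i (fun y => V (t, y)) y) s
      = fderiv ℝ (fderiv ℝ V) (s, y) (1, 0) (0, e) := by
    have : (fun t => pd i (fun y => V (t, y)) y) =ᶠ[nhds s] fun t => fderiv ℝ V (t, y) (0, e) := by
      filter_upwards [isOpen_Ioo.mem_nhds hs] with t ht
      rw [hV.fderiv_space ht]
      rfl
    rw [this.deriv_eq, ((hV.fderiv_apply (0, e)).fderiv_time hs y).deriv, hev]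
    rfl
  rw [hl, hr]
  exact ((hV.contDiffAt hs y).isSymmSndFDerivAt (by simpa using ENat.LEInfty.out)) _ _

lemma hasDerivAt_avg (hV : PerSmoothSlab T V) {r : ℝ → ℝ} {s : ℝ} (hs : s ∈ Ioo 0 T)
    (hr : ContDiffAt ℝ 1 r s) :
    HasDerivAt (fun t => avg gauss (r t) (fun y => V (t, y)))
      (avg gauss (r s) (fun y => fderiv ℝ V (s, y) (1, 0))
        + 2 * r s * deriv r s * avg gauss (r s) (lap (fun y => V (s, y)))) s := by
  obtain ⟨a, b, hsab, hab⟩ : ∃ a b, s ∈ Ioo a b ∧ Icc a b ⊆ Ioo 0 T :=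
    ⟨s / 2, (s + T) / 2, ⟨by linarith [hs.1], by linarith [hs.2]⟩,
      fun t ht => ⟨by linarith [hs.1, ht.1], by linarith [hs.2, ht.2]⟩⟩
  obtain ⟨M, hM⟩ := exists_bound_of_periodic (G := fderiv ℝ V) (a := a) (b := b)
    ((hV.smooth.continuousOn_fderiv_of_isOpen isOpen_slab (by simp)).mono
      (prod_mono hab le_rfl)) (fun s _ => hV.fderiv_periodic s)
  have hev1 : ∀ᶠ t in nhds s, HasDerivAt r (deriv r t) t :=
    (hr.eventually (by simp)).mono fun t ht => (ht.differentiableAt (by simp)).hasDerivAt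
  have hcont : ContinuousAt (deriv r) s := by
    have h1 : ContDiffAt ℝ 0 (fderiv ℝ r) s := hr.fderiv_right (by simp)
    have h2 : deriv r = fun t => fderiv ℝ r t 1 := by
      funext t
      exact fderiv_apply_one_eq_deriv.symm
    rw [h2]
    exact h1.continuousAt.clm_apply continuousAt_const
  have hev2 : ∀ᶠ t in nhds s, |deriv r t| < |deriv r s| + 1 :=
    hcont.abs.eventually_lt continuousAt_const (by linarith)
  set R := |deriv r s| + 1
  have hR : 0 ≤ R := by positivity
  have hN : {t | t ∈ Ioo a b ∧ HasDerivAt r (deriv r t) t ∧ |deriv r t| < R} ∈ nhds s :=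
    (isOpen_Ioo.eventually_mem hsab).and (hev1.and hev2)
  have hmeas : ∀ t ∈ Ioo a b, AEStronglyMeasurable (fun z => gauss z * V (t, r t • z)) := fun t ht =>
    (integrable_avg .base (hV.slice (hab (Ioo_subset_Icc_self ht))) (r t)).aestronglyMeasurable
  have hM0 : 0 ≤ M := (norm_nonneg _).trans (hM s (Ioo_subset_Icc_self hsab) 0)
  have hbd : ∀ t ∈ Ioo a b, |deriv r t| < R → ∀ z : Vec d, ∀ y,
      ‖fderiv ℝ V (t, y) (1, deriv r t • z)‖ ≤ M * (1 + R) * (1 + ‖z‖) := by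
    intro t ht hrt z y
    have h3 : ‖((1 : ℝ), deriv r t • z)‖ ≤ (1 + R) * (1 + ‖z‖) := by
      rw [Prod.norm_def]
      refine max_le ?_ ?_
      · rw [norm_one]
        nlinarith [norm_nonneg z]
      · rw [norm_smul, Real.norm_eq_abs]
        have := mul_le_mul_of_nonneg_right hrt.le (norm_nonneg z)
        nlinarith [norm_nonneg z]
    calc _ ≤ ‖fderiv ℝ V (t, y)‖ * ‖((1 : ℝ), deriv r t • z)‖ := ContinuousLinearMap.le_opNorm _ _
      _ ≤ M * ((1 + R) * (1 + ‖z‖)) := by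
        gcongr
        exact hM t (Ioo_subset_Icc_self ht) y
      _ = _ := by ring
  have hsplit : ∀ z : Vec d, fderiv ℝ V (s, r s • z) (1, deriv r s • z)
      = fderiv ℝ V (s, r s • z) (1, 0)
        + deriv r s * ∑ j, z j * pd j (fun y => V (s, y)) (r s • z) := by
    intro z
    have h4 : ((1 : ℝ), deriv r s • z) = (1, 0) + deriv r s • ((0 : ℝ), z) := by simp
    rw [h4, map_add, map_smul, hV.fderiv_space hs]
    congr 2
    have h5 : z = ∑ j, z j • (EuclideanSpace.single j (1 : ℝ) : Vec d) := by
      ext k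
      simp [Finset.sum_apply, Pi.single_apply]
    conv_lhs => rw [h5]
    rw [map_sum]
    simp only [map_smul, smul_eq_mul]
    congr 1
    funext j
    unfold pd
    rw [← h5]
  have hI1 := integrable_avg .base ((hV.fderiv_apply (1, 0)).slice hs) (r s)
  have hI2 : ∀ j, Integrable fun z : Vec d =>
      gauss z * (z j * pd j (fun y => V (s, y)) (r s • z)) := fun j => by
    refine (integrable_avg (.coord j _ .base) ((hV.slice hs).pd j) (r s)).congr
      (Filter.Eventually.of_forall fun z => ?_)
    simp only
    ring
  have hform : (fun z : Vec d => gauss z * fderiv ℝ V (s, r s • z) (1, deriv r s • z))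
      = fun z => gauss z * fderiv ℝ V (s, r s • z) (1, 0)
        + deriv r s * ∑ j, gauss z * (z j * pd j (fun y => V (s, y)) (r s • z)) := by
    funext z
    rw [hsplit, mul_add, Finset.mul_sum, Finset.mul_sum, Finset.mul_sum]
    congr 1
    refine Finset.sum_congr rfl fun j _ => ?_
    ring
  have hI3 : Integrable (fun z : Vec d =>
      deriv r s * ∑ j, gauss z * (z j * pd j (fun y => V (s, y)) (r s • z))) :=
    (integrable_finsetSum _ fun j _ => hI2 j).const_mul _
  have key := hasDerivAt_integral_of_dominated_loc_of_deriv_le (μ := volume)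
    (F := fun t z => gauss z * V (t, r t • z))
    (F' := fun t z => gauss z * fderiv ℝ V (t, r t • z) (1, deriv r t • z))
    (bound := fun z => |gauss z * (M * (1 + R) * (1 + ‖z‖))|) hN
    (by filter_upwards [hN] with t ht using hmeas t ht.1)
    (integrable_avg .base (hV.slice hs) (r s))
    (by
      change AEStronglyMeasurable (fun z => gauss z * fderiv ℝ V (s, r s • z) (1, deriv r s • z)) _
      rw [hform]
      exact (hI1.add hI3).aestronglyMeasurable)
    (Filter.Eventually.of_forall fun z t ht => by
      rw [norm_mul, Real.norm_eq_abs, abs_mul]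
      refine mul_le_mul_of_nonneg_left ?_ (abs_nonneg _)
      exact (hbd t ht.1 ht.2.2 z _).trans (le_abs_self _))
    ((GaussPoly.base.integrable_mul (g := fun z => M * (1 + R) * (1 + ‖z‖)) (M := M * (1 + R))
      (by fun_prop) 1 (fun z => by rw [abs_of_nonneg (by positivity), pow_one])).abs)
    (Filter.Eventually.of_forall fun z t ht => by
      have h6 : HasDerivAt (fun t => (t, r t • z)) (1, deriv r t • z) t :=
        (hasDerivAt_id t).prodMk (ht.2.1.smul_const z)
      exact ((hV.hasFDerivAt (hab (Ioo_subset_Icc_self ht.1)) _).comp_hasDerivAt t h6).const_mul _)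
  refine key.2.congr_deriv ?_
  rw [hform, integral_add hI1 hI3, integral_const_mul, integral_finsetSum _ fun j _ => hI2 j,
    integral_gauss_radial (hV.slice hs)]
  unfold avg
  ring

lemma continuousOn_avg (hV : PerSmoothSlab T V) {r : ℝ → ℝ} {a b : ℝ} (hab : Icc a b ⊆ Ioo 0 T)
    (hr : ContinuousOn r (Icc a b)) :
    ContinuousOn (fun t => avg gauss (r t) (fun y => V (t, y))) (Icc a b) := by
  have hc : ContinuousOn V (Icc a b ×ˢ univ) := hV.smooth.continuousOn.mono (prod_mono hab le_rfl)
  obtain ⟨M, hM⟩ := exists_bound_of_periodic hc (fun s _ => hV.periodic s)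
  refine continuousOn_of_dominated (bound := fun z : Vec d => |gauss z * M|)
    (fun t ht => (integrable_avg .base (hV.slice (hab ht)) (r t)).aestronglyMeasurable)
    (fun t ht => Filter.Eventually.of_forall fun z => ?_)
    ((GaussPoly.base.integrable_mul_bdd continuous_const (fun _ => le_rfl)).abs)
    (Filter.Eventually.of_forall fun z => ?_)
  · rw [norm_mul, Real.norm_eq_abs, abs_mul]
    exact mul_le_mul_of_nonneg_left ((hM t ht _).trans (le_abs_self _)) (abs_nonneg _)
  · exact continuousOn_const.mul (hc.comp (continuousOn_id.prodMk (hr.smul continuousOn_const))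
      (fun t ht => ⟨ht, mem_univ _⟩))

end PerSmoothSlab

end Paths

section Slices

variable {d : ℕ}

lemma lap_add {g h : Vec d → ℝ} (hg : PerSmooth g) (hh : PerSmooth h) :
    lap (fun x => g x + h x) = fun x => lap g x + lap h x := by
  funext x
  unfold lap
  rw [← Finset.sum_add_distrib]
  refine Finset.sum_congr rfl fun j _ => ?_
  rw [pd_add hg.differentiable hh.differentiable, pd_add (hg.pd j).differentiable (hh.pd j).differentiable]

lemma lap_sum {ι : Type*} (s : Finset ι) {g : ι → Vec d → ℝ} (hg : ∀ a ∈ s, PerSmooth (g a)) :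
    lap (fun x => ∑ a ∈ s, g a x) = fun x => ∑ a ∈ s, lap (g a) x := by
  funext x
  unfold lap
  rw [Finset.sum_comm]
  refine Finset.sum_congr rfl fun j _ => ?_
  rw [pd_sum s (fun a ha => (hg a ha).differentiable),
    pd_sum s (fun a ha => ((hg a ha).pd j).differentiable)]

lemma lap_pd {g : Vec d → ℝ} (hg : PerSmooth g) (i : Fin d) : lap (pd i g) = pd i (lap g) := by
  have h : pd i (lap g) = fun x => ∑ j, pd i (pd j (pd j g)) x :=
    pd_sum _ (fun j _ => ((hg.pd j).pd j).differentiable) i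
  rw [h]
  funext x
  refine Finset.sum_congr rfl fun j _ => ?_
  rw [hg.pd_comm j i, (hg.pd j).pd_comm j i]

lemma hasDerivAt_avg_radius {g : Vec d → ℝ} (hg : PerSmooth g) {r : ℝ} (hr : 0 < r) :
    HasDerivAt (fun t => avg gauss t g) (2 * r * avg gauss r (lap g)) r := by
  have hV : PerSmoothSlab (r + 1) (fun q : ℝ × Vec d => g q.2) :=
    ⟨(hg.smooth.comp contDiff_snd).contDiffOn, fun _ x n => hg.periodic x n⟩
  have h := hV.hasDerivAt_avg (r := id) (s := r) ⟨hr, by linarith⟩ contDiffAt_id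
  refine h.congr_deriv ?_
  have h0 : ∀ y, fderiv ℝ (fun q : ℝ × Vec d => g q.2) (r, y) (1, 0) = 0 := by
    intro y
    have := (hV.fderiv_time (s := r) ⟨hr, by linarith⟩ y).deriv
    rw [← this]
    simp
  simp_rw [h0]
  simp [avg]

/-- The absolute moment of order `β` of a kernel. -/
noncomputable def moment {d : ℕ} (κ : Vec d → ℝ) (β : ℝ) : ℝ := ∫ z, |κ z| * ‖z‖ ^ β

lemma moment_nonneg (κ : Vec d → ℝ) (β : ℝ) : 0 ≤ moment κ β :=
  integral_nonneg fun z => by positivity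

/-- Bounds the moments of all third derivatives of the Gaussian. -/
noncomputable def momentThree (d : ℕ) (β : ℝ) : ℝ :=
  ∑ a : Fin d, ∑ b : Fin d, ∑ c : Fin d, moment (pd c (pd b (pd a gauss))) β

/-- Bounds the moment of the Laplacian of the Gaussian. -/
noncomputable def momentLap (d : ℕ) (β : ℝ) : ℝ :=
  ∑ a : Fin d, moment (pd a (pd a (gauss (d := d)))) β

lemma momentThree_nonneg (β : ℝ) : 0 ≤ momentThree d β :=
  Finset.sum_nonneg fun _ _ => Finset.sum_nonneg fun _ _ => Finset.sum_nonneg fun _ _ =>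
    moment_nonneg _ _

lemma momentLap_nonneg (β : ℝ) : 0 ≤ momentLap d β :=
  Finset.sum_nonneg fun _ _ => moment_nonneg _ _

lemma moment_le_momentThree (a b c : Fin d) (β : ℝ) :
    moment (pd c (pd b (pd a gauss))) β ≤ momentThree d β := by
  have h1 := Finset.single_le_sum (f := fun c : Fin d => moment (pd c (pd b (pd a gauss))) β)
    (fun _ _ => moment_nonneg _ _) (Finset.mem_univ c)
  have h2 := Finset.single_le_sum
    (f := fun b : Fin d => ∑ c : Fin d, moment (pd c (pd b (pd a gauss))) β)
    (fun _ _ => Finset.sum_nonneg fun _ _ => moment_nonneg _ _) (Finset.mem_univ b)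
  have h3 := Finset.single_le_sum
    (f := fun a : Fin d => ∑ b : Fin d, ∑ c : Fin d, moment (pd c (pd b (pd a gauss))) β)
    (fun _ _ => Finset.sum_nonneg fun _ _ => Finset.sum_nonneg fun _ _ => moment_nonneg _ _)
    (Finset.mem_univ a)
  exact h1.trans (h2.trans h3)

variable {g : Vec d → ℝ} {β A r : ℝ}

lemma abs_avg_pd_three_le (hg : PerSmooth g) (hβ : 0 ≤ β) (hβ1 : β ≤ 1) (hr : 0 < r) (hA : 0 ≤ A)
    (hgA : ∀ y, |g y| ≤ A * ‖y‖ ^ β) (a b c : Fin d) :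
    |avg gauss r (pd a (pd b (pd c g)))| ≤ momentThree d β * A * r ^ (β - 3) := by
  have hk : GaussPoly (gauss (d := d)) := .base
  rw [avg_pd hk ((hg.pd c).pd b) hr.ne', avg_pd (hk.pd a) (hg.pd c) hr.ne',
    avg_pd ((hk.pd a).pd b) hg hr.ne']
  have h1 := abs_avg_le (((hk.pd a).pd b).pd c) hβ hβ1 hr.le hgA
  have h2 := moment_le_momentThree a b c β
  rw [Real.rpow_sub hr, abs_mul, abs_mul, abs_mul, abs_neg, abs_of_pos (inv_pos.2 hr)]
  calc _ ≤ r⁻¹ * (r⁻¹ * (r⁻¹ * (momentThree d β * (A * r ^ β)))) := by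
        gcongr
        exact h1.trans (mul_le_mul_of_nonneg_right h2 (by positivity))
    _ = _ := by
        rw [show (3 : ℝ) = ((3 : ℕ) : ℝ) by norm_num, Real.rpow_natCast]
        field_simp

lemma abs_avg_lap_le (hg : PerSmooth g) (hβ : 0 ≤ β) (hβ1 : β ≤ 1) (hr : 0 < r)
    (hgA : ∀ y, |g y - g 0| ≤ A * ‖y‖ ^ β) :
    |avg gauss r (lap g)| ≤ momentLap d β * A * r ^ (β - 2) := by
  have hk : GaussPoly (gauss (d := d)) := .base
  have hg' : PerSmooth (fun y => g y - g 0) := hg.sub (PerSmooth.const _)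
  have h0 : lap g = lap (fun y => g y - g 0) := by
    funext y
    simp only [lap, pd_sub_const]
  have h : avg gauss r (lap g) = ∑ j, avg gauss r (pd j (pd j (fun y => g y - g 0))) := by
    rw [h0]
    exact avg_sum hk (fun j _ => (hg'.pd j).pd j)
  rw [h]
  unfold momentLap
  rw [Finset.sum_mul, Finset.sum_mul]
  refine (Finset.abs_sum_le_sum_abs _ _).trans (Finset.sum_le_sum fun j _ => ?_)
  rw [avg_pd hk (hg'.pd j) hr.ne', avg_pd (hk.pd j) hg' hr.ne']
  have h1 := abs_avg_le ((hk.pd j).pd j) hβ hβ1 hr.le hgA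
  rw [Real.rpow_sub hr, abs_mul, abs_mul, abs_neg, abs_of_pos (inv_pos.2 hr)]
  calc _ ≤ r⁻¹ * (r⁻¹ * (moment (pd j (pd j (gauss (d := d)))) β * (A * r ^ β))) := by
        gcongr
        exact h1
    _ = _ := by
        rw [show (2 : ℝ) = ((2 : ℕ) : ℝ) by norm_num, Real.rpow_natCast]
        field_simp

lemma abs_avg_sub_le (hg : PerSmooth g) (hβ : 0 ≤ β) (hβ1 : β ≤ 1) (hr : 0 ≤ r)
    (hgA : ∀ y, |g y - g 0| ≤ A * ‖y‖ ^ β) :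
    |avg gauss r g - (∫ z : Vec d, gauss z) * g 0| ≤ moment (gauss (d := d)) β * A * r ^ β := by
  have h1 := abs_avg_le GaussPoly.base hβ hβ1 hr hgA
  rw [avg_sub .base hg (PerSmooth.const _)] at h1
  have h2 : avg gauss r (fun _ : Vec d => g 0) = (∫ z : Vec d, gauss z) * g 0 := by
    unfold avg
    rw [integral_mul_const]
  rw [h2] at h1
  rw [mul_assoc]
  exact h1

lemma abs_avg_radius_sub_le (hg : PerSmooth g) (hβ : 0 ≤ β) (hβ1 : β ≤ 1) {r' : ℝ} (hr : 0 < r)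
    (hrr' : r ≤ r') (hA : 0 ≤ A) (hgA : ∀ y, |g y - g 0| ≤ A * ‖y‖ ^ β) :
    |avg gauss r' g - avg gauss r g| ≤ 2 * momentLap d β * A * r ^ (β - 1) * (r' - r) := by
  have := Convex.norm_image_sub_le_of_norm_hasDerivWithin_le (𝕜 := ℝ) (f := fun t => avg gauss t g)
    (f' := fun t => 2 * t * avg gauss t (lap g)) (s := Icc r r') (x := r) (y := r')
    (C := 2 * momentLap d β * A * r ^ (β - 1))
    (fun t ht => (hasDerivAt_avg_radius hg (hr.trans_le ht.1)).hasDerivWithinAt)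
    (fun t ht => by
      have ht0 := hr.trans_le ht.1
      have h1 := abs_avg_lap_le hg hβ hβ1 ht0 hgA
      have h2 : t ^ (β - 1) ≤ r ^ (β - 1) := Real.rpow_le_rpow_of_nonpos hr ht.1 (by linarith)
      have h3 : t ^ (β - 1) = t * t ^ (β - 2) := by
        rw [show β - 1 = 1 + (β - 2) by ring, Real.rpow_add ht0, Real.rpow_one]
      rw [Real.norm_eq_abs, abs_mul, abs_of_pos (by linarith)]
      have hm := momentLap_nonneg (d := d) β
      calc 2 * t * |avg gauss t (lap g)| ≤ 2 * t * (momentLap d β * A * t ^ (β - 2)) := by gcongr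
        _ = 2 * momentLap d β * A * t ^ (β - 1) := by rw [h3]; ring
        _ ≤ _ := by gcongr)
    (convex_Icc r r') ⟨le_rfl, hrr'⟩ ⟨hrr', le_rfl⟩
  rwa [Real.norm_eq_abs, Real.norm_of_nonneg (by linarith)] at this

lemma tendsto_avg_pd (hg : PerSmooth g) (i : Fin d) :
    Filter.Tendsto (fun r => avg gauss r (pd i g)) Filter.atTop (nhds 0) := by
  obtain ⟨M, hM⟩ := hg.bounded
  have hk : GaussPoly (pd i (gauss (d := d))) := GaussPoly.base.pd i
  have h1 : ∀ r : ℝ, 0 < r → |avg gauss r (pd i g)| ≤ moment (pd i (gauss (d := d))) 0 * M * r⁻¹ := by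
    intro r hr
    rw [avg_pd .base hg hr.ne', abs_mul, abs_neg, abs_of_pos (inv_pos.2 hr), mul_comm]
    have := abs_avg_le hk le_rfl zero_le_one hr.le (A := M) (g := g) (by simpa using hM)
    rw [Real.rpow_zero, mul_one] at this
    gcongr
    exact this
  refine squeeze_zero_norm' (a := fun r => moment (pd i (gauss (d := d))) 0 * M * r⁻¹) ?_ ?_
  · filter_upwards [Filter.eventually_gt_atTop 0] with r hr using h1 r hr
  · simpa using tendsto_inv_atTop_zero.const_mul (moment (pd i (gauss (d := d))) 0 * M)

end Slices

section PowerBounds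

lemma abs_sub_le_of_abs_deriv_le_rpow {φ φ' : ℝ → ℝ} {K γ : ℝ} (hγ : γ < 0)
    (hφ : ∀ r, 0 < r → HasDerivAt φ (φ' r) r) (hb : ∀ r, 0 < r → |φ' r| ≤ K * r ^ (γ - 1))
    {r r' : ℝ} (hr : 0 < r) (hrr' : r ≤ r') :
    |φ r' - φ r| ≤ K / (-γ) * (r ^ γ - r' ^ γ) := by
  have hB : ∀ t, 0 < t → HasDerivAt (fun t => K / (-γ) * (r ^ γ - t ^ γ)) (K * t ^ (γ - 1)) t := by
    intro t ht
    have h1 := (((Real.hasDerivAt_rpow_const (p := γ) (Or.inl ht.ne')).const_sub (r ^ γ)).const_mul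
      (K / (-γ)))
    refine h1.congr_deriv ?_
    have := hγ.ne
    field_simp
  exact image_norm_le_of_norm_deriv_right_le_deriv_boundary' (f := fun t => φ t - φ r) (f' := φ')
    (a := r) (b := r')
    (fun t ht => ((hφ t (hr.trans_le ht.1)).sub_const _).continuousAt.continuousWithinAt)
    (fun t ht => ((hφ t (hr.trans_le ht.1)).sub_const _).hasDerivWithinAt)
    (by simp) (fun t ht => (hB t (hr.trans_le ht.1)).continuousAt.continuousWithinAt)
    (fun t ht => (hB t (hr.trans_le ht.1)).hasDerivWithinAt)
    (fun t ht => hb t (hr.trans_le ht.1)) ⟨hrr', le_rfl⟩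

lemma abs_le_of_abs_deriv_le_rpow {φ φ' : ℝ → ℝ} {K γ : ℝ} (hγ : γ < 0)
    (hφ : ∀ r, 0 < r → HasDerivAt φ (φ' r) r) (hb : ∀ r, 0 < r → |φ' r| ≤ K * r ^ (γ - 1))
    (hlim : Filter.Tendsto φ Filter.atTop (nhds 0)) {r : ℝ} (hr : 0 < r) :
    |φ r| ≤ K / (-γ) * r ^ γ := by
  have hK : 0 ≤ K := by simpa using (abs_nonneg _).trans (hb 1 one_pos)
  have h1 : Filter.Tendsto (fun r' => |φ r' - φ r|) Filter.atTop (nhds |φ r|) := by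
    simpa using (hlim.sub_const (φ r)).abs
  refine le_of_tendsto h1 ?_
  filter_upwards [Filter.eventually_ge_atTop r] with r' hr'
  refine (abs_sub_le_of_abs_deriv_le_rpow hγ hφ hb hr hr').trans ?_
  have : 0 ≤ r' ^ γ := Real.rpow_nonneg (hr.le.trans hr') _
  have h2 : 0 ≤ K / (-γ) := div_nonneg hK (by linarith)
  gcongr
  linarith

end PowerBounds

/-- Advection in the frame moving with the velocity at the origin, plus the pressure gradient. -/
noncomputable def force {d : ℕ} (V : Fin d → Vec d → ℝ) (P : Vec d → ℝ) (i : Fin d) (y : Vec d) : ℝ :=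
  ∑ j, (V j y - V j 0) * pd j (V i) y + pd i P y

section Force

variable {d : ℕ} {V : Fin d → Vec d → ℝ} {P : Vec d → ℝ}

lemma perSmooth_quad (hV : ∀ i, PerSmooth (V i)) (i j : Fin d) :
    PerSmooth (fun y => (V j y - V j 0) * (V i y - V i 0)) :=
  ((hV j).sub (.const _)).mul ((hV i).sub (.const _))

lemma perSmooth_force (hV : ∀ i, PerSmooth (V i)) (hP : PerSmooth P) (i : Fin d) :
    PerSmooth (force V P i) :=
  PerSmooth.add (PerSmooth.sum fun j _ => ((hV j).sub (.const _)).mul ((hV i).pd j)) (hP.pd i)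

lemma force_eq_div (hV : ∀ i, PerSmooth (V i)) (hdiv : ∀ y, ∑ i, pd i (V i) y = 0) (i : Fin d) :
    force V P i = fun y => ∑ j, pd j (fun y => (V j y - V j 0) * (V i y - V i 0)) y + pd i P y := by
  funext y
  unfold force
  congr 1
  have h : ∀ j, pd j (fun y => (V j y - V j 0) * (V i y - V i 0)) y
      = (V j y - V j 0) * pd j (V i) y + (V i y - V i 0) * pd j (V j) y := by
    intro j
    rw [pd_mul ((hV j).differentiable.sub_const _) ((hV i).differentiable.sub_const _),
      pd_sub_const, pd_sub_const]
  simp_rw [h, Finset.sum_add_distrib, ← Finset.mul_sum, hdiv y]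
  ring

/-- The pressure equation, when the force is divergence free. -/
lemma lap_pressure (hV : ∀ i, PerSmooth (V i)) (hP : PerSmooth P)
    (hdiv : ∀ y, ∑ i, pd i (V i) y = 0) (hf : ∀ y, ∑ i, pd i (force V P i) y = 0) :
    lap P = fun y => (-1) * ∑ i, ∑ j, pd i (pd j (fun y => (V j y - V j 0) * (V i y - V i 0))) y := by
  funext y
  have h := hf y
  have h1 : ∀ i, pd i (force V P i) y
      = ∑ j, pd i (pd j (fun y => (V j y - V j 0) * (V i y - V i 0))) y + pd i (pd i P) y := by
    intro i
    rw [force_eq_div hV hdiv, pd_add (PerSmooth.sum fun j _ => (perSmooth_quad hV i j).pd j).differentiable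
      (hP.pd i).differentiable, pd_sum _ fun j _ => ((perSmooth_quad hV i j).pd j).differentiable]
  simp_rw [h1, Finset.sum_add_distrib] at h
  unfold lap
  linarith

lemma lap_force (hV : ∀ i, PerSmooth (V i)) (hP : PerSmooth P)
    (hdiv : ∀ y, ∑ i, pd i (V i) y = 0) (hf : ∀ y, ∑ i, pd i (force V P i) y = 0) (i : Fin d) :
    lap (force V P i) = fun y =>
      ∑ j, ∑ l, pd l (pd l (pd j (fun y => (V j y - V j 0) * (V i y - V i 0)))) y
      + (-1) * ∑ l, ∑ j, pd i (pd l (pd j (fun y => (V j y - V j 0) * (V l y - V l 0)))) y := by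
  have hQ := fun i j => perSmooth_quad hV i j
  rw [force_eq_div hV hdiv, lap_add (PerSmooth.sum fun j _ => (hQ i j).pd j) (hP.pd i),
    lap_sum _ (fun j _ => (hQ i j).pd j), lap_pd hP, lap_pressure hV hP hdiv hf,
    pd_const_mul _ (PerSmooth.sum fun l _ => PerSmooth.sum fun j _ => ((hQ l j).pd j).pd l).differentiable,
    pd_sum _ (fun l _ => (PerSmooth.sum fun j _ => ((hQ l j).pd j).pd l).differentiable)]
  simp only [lap, pd_sum Finset.univ (fun j _ => (((hQ _ j).pd j).pd _).differentiable)]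

variable {α M r : ℝ}

lemma abs_quad_le (hM : ∀ i y, |V i y - V i 0| ≤ M * ‖y‖ ^ α) (i j : Fin d) (y : Vec d) :
    |(V j y - V j 0) * (V i y - V i 0)| ≤ M ^ 2 * ‖y‖ ^ (2 * α) := by
  rw [abs_mul]
  calc _ ≤ (M * ‖y‖ ^ α) * (M * ‖y‖ ^ α) :=
        mul_le_mul (hM j y) (hM i y) (abs_nonneg _) ((abs_nonneg _).trans (hM j y))
    _ = M ^ 2 * (‖y‖ ^ α) ^ (2 : ℝ) := by rw [Real.rpow_two]; ring
    _ = _ := by rw [← Real.rpow_mul (norm_nonneg y), mul_comm α]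

lemma abs_avg_lap_force_le (hV : ∀ i, PerSmooth (V i)) (hP : PerSmooth P)
    (hdiv : ∀ y, ∑ i, pd i (V i) y = 0) (hf : ∀ y, ∑ i, pd i (force V P i) y = 0)
    (hα : 0 ≤ α) (hα1 : 2 * α ≤ 1) (hM : ∀ i y, |V i y - V i 0| ≤ M * ‖y‖ ^ α) (hr : 0 < r)
    (i : Fin d) :
    |avg gauss r (lap (force V P i))|
      ≤ 2 * d ^ 2 * momentThree d (2 * α) * M ^ 2 * r ^ (2 * α - 3) := by
  have hQ := fun i j => perSmooth_quad hV i j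
  have hk : GaussPoly (gauss (d := d)) := .base
  have hb := fun i j a b c => abs_avg_pd_three_le (hQ i j) (by linarith) hα1 hr (sq_nonneg M)
    (abs_quad_le hM i j) a b c
  rw [lap_force hV hP hdiv hf, avg_add hk
    (PerSmooth.sum fun j _ => PerSmooth.sum fun l _ => (((hQ i j).pd j).pd l).pd l)
    ((PerSmooth.const (-1)).mul
      (PerSmooth.sum fun l _ => PerSmooth.sum fun j _ => (((hQ l j).pd j).pd l).pd i)),
    avg_const_mul, avg_sum hk (fun j _ => PerSmooth.sum fun l _ => (((hQ i j).pd j).pd l).pd l),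
    avg_sum hk (fun l _ => PerSmooth.sum fun j _ => (((hQ l j).pd j).pd l).pd i)]
  have h1 : ∀ G : Fin d → Fin d → ℝ, (∀ a b, |G a b| ≤ momentThree d (2 * α) * M ^ 2 * r ^ (2 * α - 3)) →
      |∑ a, ∑ b, G a b| ≤ d ^ 2 * (momentThree d (2 * α) * M ^ 2 * r ^ (2 * α - 3)) := by
    intro G hG
    calc _ ≤ ∑ a, ∑ b, |G a b| := (Finset.abs_sum_le_sum_abs _ _).trans
            (Finset.sum_le_sum fun a _ => Finset.abs_sum_le_sum_abs _ _)
      _ ≤ ∑ _a : Fin d, ∑ _b : Fin d, momentThree d (2 * α) * M ^ 2 * r ^ (2 * α - 3) :=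
          Finset.sum_le_sum fun a _ => Finset.sum_le_sum fun b _ => hG a b
      _ = _ := by simp; ring
  have e1 : ∀ j, avg gauss r (fun y => ∑ l, pd l (pd l (pd j (fun y => (V j y - V j 0) * (V i y - V i 0)))) y)
      = ∑ l, avg gauss r (pd l (pd l (pd j (fun y => (V j y - V j 0) * (V i y - V i 0))))) :=
    fun j => avg_sum hk (fun l _ => (((hQ i j).pd j).pd l).pd l)
  have e2 : ∀ l, avg gauss r (fun y => ∑ j, pd i (pd l (pd j (fun y => (V j y - V j 0) * (V l y - V l 0)))) y)
      = ∑ j, avg gauss r (pd i (pd l (pd j (fun y => (V j y - V j 0) * (V l y - V l 0))))) :=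
    fun l => avg_sum hk (fun j _ => (((hQ l j).pd j).pd l).pd i)
  simp_rw [e1, e2]
  refine (abs_add_le _ _).trans ?_
  rw [abs_mul, abs_neg, abs_one, one_mul]
  refine (add_le_add (h1 _ fun j l => hb i j l l j) (h1 _ fun l j => hb l j i l j)).trans_eq ?_
  ring

lemma tendsto_avg_force (hV : ∀ i, PerSmooth (V i)) (hP : PerSmooth P)
    (hdiv : ∀ y, ∑ i, pd i (V i) y = 0) (i : Fin d) :
    Filter.Tendsto (fun r => avg gauss r (force V P i)) Filter.atTop (nhds 0) := by
  have hQ := fun i j => perSmooth_quad hV i j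
  have hk : GaussPoly (gauss (d := d)) := .base
  have h : (fun r => avg gauss r (force V P i)) = fun r =>
      ∑ j, avg gauss r (pd j (fun y => (V j y - V j 0) * (V i y - V i 0))) + avg gauss r (pd i P) := by
    funext r
    rw [force_eq_div hV hdiv, avg_add hk (PerSmooth.sum fun j _ => (hQ i j).pd j) (hP.pd i),
      avg_sum hk (fun j _ => (hQ i j).pd j)]
  rw [h]
  simpa using (tendsto_finsetSum Finset.univ fun j _ => tendsto_avg_pd (hQ i j) j).add
    (tendsto_avg_pd hP i)

/-- The constant in the decay estimate for the averaged force. -/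
noncomputable def forceConst (d : ℕ) (α : ℝ) : ℝ :=
  4 * d ^ 2 * momentThree d (2 * α) / (1 - 2 * α)

lemma forceConst_nonneg (hα1 : 2 * α < 1) : 0 ≤ forceConst d α :=
  div_nonneg (mul_nonneg (by positivity) (momentThree_nonneg _)) (by linarith)

lemma hasDerivAt_avg_force_bound (hV : ∀ i, PerSmooth (V i)) (hP : PerSmooth P)
    (hdiv : ∀ y, ∑ i, pd i (V i) y = 0) (hf : ∀ y, ∑ i, pd i (force V P i) y = 0)
    (hα : 0 ≤ α) (hα1 : 2 * α < 1) (hM : ∀ i y, |V i y - V i 0| ≤ M * ‖y‖ ^ α) (i : Fin d)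
    (hr : 0 < r) :
    |2 * r * avg gauss r (lap (force V P i))|
      ≤ (4 * d ^ 2 * momentThree d (2 * α) * M ^ 2) * r ^ ((2 * α - 1) - 1) := by
  rw [abs_mul, abs_of_pos (by linarith)]
  have h := abs_avg_lap_force_le hV hP hdiv hf hα hα1.le hM hr i
  have h2 : r ^ ((2 * α - 1) - 1) = r * r ^ (2 * α - 3) := by
    rw [show (2 * α - 1) - 1 = 1 + (2 * α - 3) by ring, Real.rpow_add hr, Real.rpow_one]
  rw [h2]
  calc _ ≤ 2 * r * (2 * d ^ 2 * momentThree d (2 * α) * M ^ 2 * r ^ (2 * α - 3)) := by gcongr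
    _ = _ := by ring

lemma abs_avg_force_sub_le (hV : ∀ i, PerSmooth (V i)) (hP : PerSmooth P)
    (hdiv : ∀ y, ∑ i, pd i (V i) y = 0) (hf : ∀ y, ∑ i, pd i (force V P i) y = 0)
    (hα : 0 ≤ α) (hα1 : 2 * α < 1) (hM : ∀ i y, |V i y - V i 0| ≤ M * ‖y‖ ^ α) {r' : ℝ}
    (hr : 0 < r) (hrr' : r ≤ r') (i : Fin d) :
    |avg gauss r' (force V P i) - avg gauss r (force V P i)|
      ≤ forceConst d α * M ^ 2 * (r ^ (2 * α - 1) - r' ^ (2 * α - 1)) := by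
  refine (abs_sub_le_of_abs_deriv_le_rpow (by linarith)
    (fun t ht => hasDerivAt_avg_radius (perSmooth_force hV hP i) ht)
    (fun t ht => hasDerivAt_avg_force_bound hV hP hdiv hf hα hα1 hM i ht) hr hrr').trans_eq ?_
  unfold forceConst
  rw [neg_sub]
  ring

lemma abs_avg_force_le (hV : ∀ i, PerSmooth (V i)) (hP : PerSmooth P)
    (hdiv : ∀ y, ∑ i, pd i (V i) y = 0) (hf : ∀ y, ∑ i, pd i (force V P i) y = 0)
    (hα : 0 ≤ α) (hα1 : 2 * α < 1) (hM : ∀ i y, |V i y - V i 0| ≤ M * ‖y‖ ^ α)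
    (hr : 0 < r) (i : Fin d) :
    |avg gauss r (force V P i)| ≤ forceConst d α * M ^ 2 * r ^ (2 * α - 1) := by
  refine (abs_le_of_abs_deriv_le_rpow (by linarith)
    (fun t ht => hasDerivAt_avg_radius (perSmooth_force hV hP i) ht)
    (fun t ht => hasDerivAt_avg_force_bound hV hP hdiv hf hα hα1 hM i ht)
    (tendsto_avg_force hV hP hdiv i) hr).trans_eq ?_
  unfold forceConst
  rw [neg_sub]
  ring

end Force

section Comoving

variable {d : ℕ} {T ν M α : ℝ} {V : Fin d → ℝ × Vec d → ℝ} {P : ℝ × Vec d → ℝ}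

/-- A Navier-Stokes flow with `α`-Hölder velocity, in the frame of one of its trajectories:
`V s 0` is the velocity of the frame. -/
structure Comoving {d : ℕ} (T ν M α : ℝ) (V : Fin d → ℝ × Vec d → ℝ) (P : ℝ × Vec d → ℝ) : Prop where
  velocity : ∀ i, PerSmoothSlab T (V i)
  pressure : PerSmoothSlab T P
  momentum : ∀ s ∈ Ioo 0 T, ∀ y i, fderiv ℝ (V i) (s, y) (1, 0)
    = ν * lap (fun y => V i (s, y)) y - force (fun i y => V i (s, y)) (fun y => P (s, y)) i y
  incompressible : ∀ s ∈ Ioo 0 T, ∀ y, ∑ i, pd i (fun y => V i (s, y)) y = 0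
  holder : ∀ s ∈ Ioo 0 T, ∀ i y, |V i (s, y) - V i (s, 0)| ≤ M * ‖y‖ ^ α

namespace Comoving

lemma div_force (h : Comoving T ν M α V P) {s : ℝ} (hs : s ∈ Ioo 0 T) (y : Vec d) :
    ∑ i, pd i (force (fun i y => V i (s, y)) (fun y => P (s, y)) i) y = 0 := by
  have hV := fun i => (h.velocity i).slice hs
  have h1 : ∀ i, pd i (force (fun i y => V i (s, y)) (fun y => P (s, y)) i) y
      = ν * lap (pd i (fun y => V i (s, y))) y
        - deriv (fun t => pd i (fun y => V i (t, y)) y) s := by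
    intro i
    have h2 : force (fun i y => V i (s, y)) (fun y => P (s, y)) i
        = fun y => ν * lap (fun y => V i (s, y)) y - fderiv ℝ (V i) (s, y) (1, 0) := by
      funext y
      rw [h.momentum s hs]
      ring
    rw [h2, pd_sub (((PerSmooth.const ν).mul (hV i).lap).differentiable)
      (((h.velocity i).fderiv_apply (1, 0)).slice hs).differentiable, lap_pd (hV i),
      pd_const_mul _ (hV i).lap.differentiable]
    exact congrArg _ ((h.velocity i).pd_time hs y i)
  have h3 : ∑ i, deriv (fun t => pd i (fun y => V i (t, y)) y) s = 0 := by
    have hd : ∀ i, DifferentiableAt ℝ (fun t => pd i (fun y => V i (t, y)) y) s := by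
      intro i
      have he : (fun t => pd i (fun y => V i (t, y)) y)
          =ᶠ[nhds s] fun t => fderiv ℝ (V i) (t, y) (0, EuclideanSpace.single i 1) := by
        filter_upwards [isOpen_Ioo.mem_nhds hs] with t ht
        exact ((h.velocity i).fderiv_space ht _ _).symm
      exact ((((h.velocity i).fderiv_apply (0, EuclideanSpace.single i 1)).fderiv_time hs
        y).differentiableAt).congr_of_eventuallyEq he
    rw [← deriv_fun_sum fun i _ => hd i]
    have he : (fun t => ∑ i, pd i (fun y => V i (t, y)) y) =ᶠ[nhds s] fun _ => 0 := by
      filter_upwards [isOpen_Ioo.mem_nhds hs] with t ht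
      exact h.incompressible t ht y
    rw [he.deriv_eq, deriv_const]
  have h4 : ∑ i, lap (pd i (fun y => V i (s, y))) y = 0 := by
    have := congrFun (lap_sum Finset.univ fun i _ => (hV i).pd i) y
    rw [← this]
    have h0 : (fun y => ∑ i, pd i (fun y => V i (s, y)) y) = fun _ => 0 :=
      funext (h.incompressible s hs)
    rw [h0]
    simp [lap, pd_const]
  simp_rw [h1, Finset.sum_sub_distrib, ← Finset.mul_sum, h3, h4]
  simp

/-- Gaussian averages of the velocity, over a ball of variable radius. -/
lemma hasDerivAt_avg (h : Comoving T ν M α V P) {r : ℝ → ℝ} {s : ℝ} (hs : s ∈ Ioo 0 T)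
    (hr : ContDiffAt ℝ 1 r s) (i : Fin d) :
    HasDerivAt (fun t => avg gauss (r t) (fun y => V i (t, y)))
      ((ν + 2 * r s * deriv r s) * avg gauss (r s) (lap (fun y => V i (s, y)))
        - avg gauss (r s) (force (fun i y => V i (s, y)) (fun y => P (s, y)) i)) s := by
  have hV := fun i => (h.velocity i).slice hs
  refine ((h.velocity i).hasDerivAt_avg hs hr).congr_deriv ?_
  rw [funext fun y => h.momentum s hs y i, avg_sub .base ((PerSmooth.const ν).mul (hV i).lap)
    (perSmooth_force hV (h.pressure.slice hs) i), avg_const_mul]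
  ring

/-- The case `r = √(ν (b - s))`, where the viscous term disappears. -/
lemma hasDerivAt_avg_sqrt (h : Comoving T ν M α V P) {s b : ℝ} (hs : s ∈ Ioo 0 T)
    (hb : 0 < ν * (b - s)) (i : Fin d) :
    HasDerivAt (fun t => avg gauss (√(ν * (b - t))) (fun y => V i (t, y)))
      (- avg gauss (√(ν * (b - s))) (force (fun i y => V i (s, y)) (fun y => P (s, y)) i)) s := by
  have h1 : HasDerivAt (fun t => ν * (b - t)) (-ν) s :=
    (((hasDerivAt_id s).const_sub b).const_mul ν).congr_deriv (by ring)
  refine (h.hasDerivAt_avg (r := fun t => √(ν * (b - t))) hs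
    (ContDiffAt.sqrt (by fun_prop) hb.ne') i).congr_deriv ?_
  rw [(h1.sqrt hb.ne').deriv]
  have := Real.sqrt_pos.2 hb
  field_simp
  ring

end Comoving

lemma fderiv_eq_sum_pd (g : Vec d → ℝ) (y w : Vec d) : fderiv ℝ g y w = ∑ j, w j * pd j g y := by
  have hw : w = ∑ j, w j • EuclideanSpace.single j (1 : ℝ) := by
    ext i
    simp [Pi.single_apply]
  conv_lhs => rw [hw]
  simp [pd]

lemma pd_comp_add_left (g : Vec d → ℝ) (a : Vec d) (i : Fin d) :
    pd i (fun y => g (a + y)) = fun y => pd i g (a + y) := by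
  funext y
  unfold pd
  rw [fderiv_comp_add_left]

lemma comoving_of_navierStokes {u : ℝ → Vec d → Vec d} {p : ℝ → Vec d → ℝ} {x : ℝ → Vec d}
    (hu : ContDiffOn ℝ ∞ (fun q : ℝ × Vec d => u q.1 q.2) (Ioo 0 T ×ˢ univ))
    (hp : ContDiffOn ℝ ∞ (fun q : ℝ × Vec d => p q.1 q.2) (Ioo 0 T ×ˢ univ))
    (hup : ∀ t x n, u t (x + lat n) = u t x) (hpp : ∀ t x n, p t (x + lat n) = p t x)
    (hns : ∀ t ∈ Ioo 0 T, ∀ (x : Vec d) (i : Fin d),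
      deriv (fun s => u s x i) t + ∑ j, u t x j * pd j (fun y => u t y i) x + pd i (p t) x
        = ν * lap (fun y => u t y i) x)
    (hdiv : ∀ t ∈ Ioo 0 T, ∀ x, ∑ i, pd i (fun y => u t y i) x = 0)
    (hM : ∀ t ∈ Ioo 0 T, ∀ x y, ‖u t x - u t y‖ ≤ M * ‖x - y‖ ^ α)
    (hx : ContDiffOn ℝ ∞ x (Ioo 0 T)) (hxu : ∀ t ∈ Ioo 0 T, HasDerivAt x (u t (x t)) t) :
    Comoving T ν M α (fun i q => u q.1 (x q.1 + q.2) i) (fun q => p q.1 (x q.1 + q.2)) := by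
  have hshift : ContDiffOn ℝ ∞ (fun q : ℝ × Vec d => (q.1, x q.1 + q.2)) (Ioo 0 T ×ˢ univ) :=
    contDiffOn_fst.prodMk ((hx.comp contDiffOn_fst fun q hq => hq.1).add contDiffOn_snd)
  have hmaps : MapsTo (fun q : ℝ × Vec d => (q.1, x q.1 + q.2)) (Ioo 0 T ×ˢ univ)
      (Ioo 0 T ×ˢ univ) := fun q hq => ⟨hq.1, mem_univ _⟩
  have hcoord : ∀ i, ContDiffOn ℝ ∞ (fun q : ℝ × Vec d => u q.1 q.2 i) (Ioo 0 T ×ˢ univ) :=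
    fun i => (contDiffOn_piLp 2).1 hu i
  have hU : ∀ i, PerSmoothSlab T (fun q : ℝ × Vec d => u q.1 q.2 i) :=
    fun i => ⟨hcoord i, fun s x n => by simp only [hup]⟩
  have hV : ∀ i, PerSmoothSlab T (fun q : ℝ × Vec d => u q.1 (x q.1 + q.2) i) :=
    fun i => ⟨(hcoord i).comp hshift hmaps, fun s y n => by simp only [← add_assoc, hup]⟩
  refine ⟨hV, ⟨hp.comp hshift hmaps, fun s y n => by simp only [← add_assoc, hpp]⟩, ?_, ?_, ?_⟩
  · intro s hs y i
    have h1 : HasDerivAt (fun t => u t (x t + y) i)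
        (fderiv ℝ (fun q : ℝ × Vec d => u q.1 q.2 i) (s, x s + y) (1, u s (x s))) s :=
      ((hU i).hasFDerivAt hs (x s + y)).comp_hasDerivAt_of_eq s
        ((hasDerivAt_id s).prodMk ((hxu s hs).add_const y)) rfl
    have h2 := ((hV i).fderiv_time hs y).unique h1
    have h3 : ((1, u s (x s)) : ℝ × Vec d) = (1, 0) + (0, u s (x s)) := by simp
    have h4 := (((hU i).fderiv_time hs (x s + y))).deriv
    have h5 := hns s hs (x s + y) i
    have hl : lap (fun y => u s (x s + y) i) y = lap (fun y => u s y i) (x s + y) := by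
      unfold lap
      simp_rw [pd_comp_add_left (fun y => u s y i), pd_comp_add_left (pd _ (fun y => u s y i))]
    simp only at h2 h4
    rw [h2, h3, map_add, (hU i).fderiv_space hs, fderiv_eq_sum_pd, ← h4]
    simp only [force, add_zero, hl, pd_comp_add_left (p s), pd_comp_add_left (fun y => u s y i),
      ← h5, sub_mul, Finset.sum_sub_distrib]
    ring
  · intro s hs y
    have h1 : ∀ i, pd i (fun y => u s (x s + y) i) y = pd i (fun y => u s y i) (x s + y) :=
      fun i => congrFun (pd_comp_add_left (fun y => u s y i) _ _) _
    simp only [h1]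
    exact hdiv s hs _
  · intro s hs i y
    have h1 := hM s hs (x s + y) (x s + 0)
    rw [add_sub_add_left_eq_sub, sub_zero] at h1
    refine le_trans ?_ h1
    exact PiLp.norm_apply_le (u s (x s + y) - u s (x s + 0)) i

end Comoving

section Increments

lemma abs_sub_le_sub_of_abs_deriv_le {φ φ' B B' : ℝ → ℝ} {a b : ℝ} (hab : a ≤ b)
    (hφ : ContinuousOn φ (Icc a b)) (hφ' : ∀ s ∈ Ico a b, HasDerivAt φ (φ' s) s)
    (hB : ContinuousOn B (Icc a b)) (hB' : ∀ s ∈ Ico a b, HasDerivAt B (B' s) s)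
    (h : ∀ s ∈ Ico a b, |φ' s| ≤ B' s) : |φ b - φ a| ≤ B b - B a :=
  image_norm_le_of_norm_deriv_right_le_deriv_boundary' (f := fun s => φ s - φ a) (f' := φ')
    (B := fun s => B s - B a) (B' := B') (hφ.sub continuousOn_const)
    (fun s hs => ((hφ' s hs).sub_const _).hasDerivWithinAt) (by simp) (hB.sub continuousOn_const)
    (fun s hs => ((hB' s hs).sub_const _).hasDerivWithinAt) h (right_mem_Icc.2 hab)

lemma hasDerivAt_rpow_backward {ν γ b s : ℝ} (hν : 0 < ν) (hγ : 0 < γ) (hs : s < b) :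
    HasDerivAt (fun s => -(ν * (b - s)) ^ γ / (ν * γ)) ((ν * (b - s)) ^ (γ - 1)) s := by
  have h0 : 0 < ν * (b - s) := mul_pos hν (sub_pos.2 hs)
  have h1 : HasDerivAt (fun t => ν * (b - t)) (-ν) s :=
    (((hasDerivAt_id s).const_sub b).const_mul ν).congr_deriv (by ring)
  refine ((h1.rpow_const (p := γ) (Or.inl h0.ne')).neg.div_const (ν * γ)).congr_deriv ?_
  field_simp

lemma continuous_rpow_backward {ν γ b : ℝ} (hγ : 0 < γ) :
    Continuous fun s => -(ν * (b - s)) ^ γ / (ν * γ) :=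
  ((Real.continuous_rpow_const hγ.le).comp (by fun_prop : Continuous fun s => ν * (b - s))).neg.div_const _

lemma sqrt_rpow {z : ℝ} (hz : 0 ≤ z) (β : ℝ) : √z ^ β = z ^ (β / 2) := by
  rw [Real.sqrt_eq_rpow, ← Real.rpow_mul hz]
  congr 1
  ring

namespace Comoving

variable {d : ℕ} {T ν M α : ℝ} {V : Fin d → ℝ × Vec d → ℝ} {P : ℝ × Vec d → ℝ}

lemma abs_force_le (h : Comoving T ν M α V P) (hα : 0 < α) (hα1 : 2 * α < 1) {s : ℝ}
    (hs : s ∈ Ioo 0 T) {r : ℝ} (hr : 0 < r) (i : Fin d) :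
    |avg gauss r (force (fun i y => V i (s, y)) (fun y => P (s, y)) i)|
      ≤ forceConst d α * M ^ 2 * r ^ (2 * α - 1) :=
  abs_avg_force_le (fun i => (h.velocity i).slice hs) (h.pressure.slice hs)
    (h.incompressible s hs) (h.div_force hs) hα.le hα1 (h.holder s hs) hr i

/-- Averaging at a fixed scale `r`. -/
lemma abs_sub_le_scale (h : Comoving T ν M α V P) (hα : 0 < α) (hα1 : 2 * α < 1) (hν : 0 < ν)
    {t₁ t₂ r : ℝ} (ht₁ : t₁ ∈ Ioo 0 T) (ht₂ : t₂ ∈ Ioo 0 T) (ht : t₁ ≤ t₂) (hr : 0 < r)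
    (i : Fin d) :
    (∫ z : Vec d, gauss z) * |V i (t₂, 0) - V i (t₁, 0)| ≤ 2 * moment (gauss (d := d)) α * M * r ^ α
      + (ν * (momentLap d α * M * r ^ (α - 2)) + forceConst d α * M ^ 2 * r ^ (2 * α - 1))
        * (t₂ - t₁) := by
  have hI : Icc t₁ t₂ ⊆ Ioo 0 T := Icc_subset_Ioo ht₁.1 ht₂.2
  have hV := fun {s} (hs : s ∈ Ioo 0 T) i => (h.velocity i).slice hs
  have hd := fun {s} (hs : s ∈ Ioo 0 T) =>
    h.hasDerivAt_avg (r := fun _ => r) hs contDiffAt_const i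
  have hb : ∀ s ∈ Ioo 0 T, |(ν + 2 * r * deriv (fun _ => r) s) * avg gauss r (lap (fun y => V i (s, y)))
        - avg gauss r (force (fun i y => V i (s, y)) (fun y => P (s, y)) i)|
      ≤ ν * (momentLap d α * M * r ^ (α - 2)) + forceConst d α * M ^ 2 * r ^ (2 * α - 1) := by
    intro s hs
    refine (abs_sub _ _).trans (add_le_add ?_ (h.abs_force_le hα hα1 hs hr i))
    rw [deriv_const, mul_zero, add_zero, abs_mul, abs_of_pos hν]
    exact mul_le_mul_of_nonneg_left
      (abs_avg_lap_le (hV hs i) hα.le (by linarith) hr (h.holder s hs i)) hν.le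
  have h1 := abs_sub_le_sub_of_abs_deriv_le (B := fun s =>
      (ν * (momentLap d α * M * r ^ (α - 2)) + forceConst d α * M ^ 2 * r ^ (2 * α - 1)) * s) ht
    (fun s hs => (hd (hI hs)).continuousAt.continuousWithinAt)
    (fun s hs => hd (hI (Ico_subset_Icc_self hs))) (by fun_prop)
    (fun s hs => ((hasDerivAt_id s).const_mul _).congr_deriv (mul_one _))
    (fun s hs => hb s (hI (Ico_subset_Icc_self hs)))
  have h2 := fun {s} (hs : s ∈ Ioo 0 T) =>
    abs_avg_sub_le (hV hs i) hα.le (by linarith) hr.le (h.holder s hs i)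
  have h3 := h2 ht₁
  have h4 := h2 ht₂
  rw [← abs_of_pos (integral_gauss_pos (d := d)), ← abs_mul, abs_le]
  rw [abs_le] at h1 h3 h4
  constructor <;> linarith [h1.1, h1.2, h3.1, h3.2, h4.1, h4.2]

lemma avg_gauss_zero (g : Vec d → ℝ) : avg gauss 0 g = (∫ z : Vec d, gauss z) * g 0 := by
  simp [avg, integral_mul_const]

/-- Averaging at the parabolic scale. -/
lemma abs_sub_avg_sqrt_le (h : Comoving T ν M α V P) (hα : 0 < α) (hα1 : 2 * α < 1) (hν : 0 < ν)
    {t₁ t₂ : ℝ} (ht₁ : t₁ ∈ Ioo 0 T) (ht₂ : t₂ ∈ Ioo 0 T) (ht : t₁ ≤ t₂) (i : Fin d) :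
    |(∫ z : Vec d, gauss z) * V i (t₂, 0) - avg gauss (√(ν * (t₂ - t₁))) (fun y => V i (t₁, y))|
      ≤ forceConst d α * M ^ 2 * ((ν * (t₂ - t₁)) ^ (α + 1 / 2) / (ν * (α + 1 / 2))) := by
  have hI : Icc t₁ t₂ ⊆ Ioo 0 T := Icc_subset_Ioo ht₁.1 ht₂.2
  have hγ : 0 < α + 1 / 2 := by linarith
  have h1 := abs_sub_le_sub_of_abs_deriv_le (B := fun s => forceConst d α * M ^ 2 *
      (-(ν * (t₂ - s)) ^ (α + 1 / 2) / (ν * (α + 1 / 2)))) ht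
    ((h.velocity i).continuousOn_avg (r := fun s => √(ν * (t₂ - s))) hI (by fun_prop))
    (fun s hs => h.hasDerivAt_avg_sqrt (hI (Ico_subset_Icc_self hs))
      (mul_pos hν (sub_pos.2 hs.2)) i)
    (continuous_const.mul (continuous_rpow_backward hγ)).continuousOn
    (fun s hs => (hasDerivAt_rpow_backward hν hγ hs.2).const_mul _)
    (fun s hs => by
      have h0 : 0 < ν * (t₂ - s) := mul_pos hν (sub_pos.2 hs.2)
      rw [abs_neg]
      refine (h.abs_force_le hα hα1 (hI (Ico_subset_Icc_self hs)) (Real.sqrt_pos.2 h0) i).trans_eq ?_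
      rw [sqrt_rpow h0.le]
      congr 2
      ring)
  simp only [sub_self, mul_zero, Real.sqrt_zero, avg_gauss_zero, Real.zero_rpow hγ.ne'] at h1
  refine h1.trans_eq ?_
  ring

/-- Comparison of the averages at the scales `√(ν (t₂ - s))` and `√(ν (t₁ - s))`, followed
backwards from `s = t₁` to `s = t₀`. -/
lemma abs_avg_sqrt_sub_le (h : Comoving T ν M α V P) (hα : 0 < α) (hα1 : 2 * α < 1) (hν : 0 < ν)
    (hM : 0 ≤ M) {t₀ t₁ t₂ : ℝ} (ht₀ : t₀ ∈ Ioo 0 T) (ht₁ : t₁ ∈ Ioo 0 T) (h01 : t₀ < t₁)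
    (ht : t₁ ≤ t₂) (i : Fin d) :
    |avg gauss (√(ν * (t₂ - t₁))) (fun y => V i (t₁, y)) - (∫ z : Vec d, gauss z) * V i (t₁, 0)|
      ≤ forceConst d α * M ^ 2 * ((ν * (t₂ - t₁)) ^ (α + 1 / 2) / (ν * (α + 1 / 2)))
        + momentLap d α * M * (ν * (t₂ - t₁)) * (ν * (t₁ - t₀)) ^ (α / 2 - 1) := by
  have hI : Icc t₀ t₁ ⊆ Ioo 0 T := Icc_subset_Ioo ht₀.1 ht₁.2
  have hγ : 0 < α + 1 / 2 := by linarith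
  have hF := forceConst_nonneg (d := d) hα1
  have h1 := abs_sub_le_sub_of_abs_deriv_le (B := fun s => forceConst d α * M ^ 2 *
      (-(ν * (t₁ - s)) ^ (α + 1 / 2) / (ν * (α + 1 / 2))
        - -(ν * (t₂ - s)) ^ (α + 1 / 2) / (ν * (α + 1 / 2)))) h01.le
    (((h.velocity i).continuousOn_avg (r := fun s => √(ν * (t₂ - s))) hI (by fun_prop)).sub
      ((h.velocity i).continuousOn_avg (r := fun s => √(ν * (t₁ - s))) hI (by fun_prop)))
    (fun s hs => (h.hasDerivAt_avg_sqrt (hI (Ico_subset_Icc_self hs))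
      (mul_pos hν (sub_pos.2 (hs.2.trans_le ht))) i).sub (h.hasDerivAt_avg_sqrt
        (hI (Ico_subset_Icc_self hs)) (mul_pos hν (sub_pos.2 hs.2)) i))
    (continuous_const.mul ((continuous_rpow_backward hγ).sub
      (continuous_rpow_backward hγ))).continuousOn
    (fun s hs => ((hasDerivAt_rpow_backward hν hγ hs.2).sub
      (hasDerivAt_rpow_backward hν hγ (hs.2.trans_le ht))).const_mul _)
    (fun s hs => by
      have h0 : 0 < ν * (t₁ - s) := mul_pos hν (sub_pos.2 hs.2)
      have h0' : ν * (t₁ - s) ≤ ν * (t₂ - s) := by gcongr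
      have hs' := hI (Ico_subset_Icc_self hs)
      rw [neg_sub_neg, abs_sub_comm]
      refine (abs_avg_force_sub_le (fun i => (h.velocity i).slice hs') (h.pressure.slice hs')
        (h.incompressible s hs') (h.div_force hs') hα.le hα1 (h.holder s hs')
        (Real.sqrt_pos.2 h0) (Real.sqrt_le_sqrt h0') i).trans_eq ?_
      rw [sqrt_rpow h0.le, sqrt_rpow (h0.le.trans h0'), show (2 * α - 1) / 2 = α + 1 / 2 - 1 by ring])
  have hX : 0 < ν * (t₁ - t₀) := mul_pos hν (sub_pos.2 h01)
  have hX' : ν * (t₁ - t₀) ≤ ν * (t₂ - t₀) := by gcongr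
  have h2 := abs_avg_radius_sub_le ((h.velocity i).slice ht₀) hα.le (by linarith)
    (Real.sqrt_pos.2 hX) (Real.sqrt_le_sqrt hX') hM (h.holder t₀ ht₀ i)
  have h3 : √(ν * (t₂ - t₀)) - √(ν * (t₁ - t₀)) ≤ ν * (t₂ - t₁) / (2 * √(ν * (t₁ - t₀))) := by
    rw [le_div_iff₀ (by have := Real.sqrt_pos.2 hX; positivity)]
    nlinarith [Real.sq_sqrt hX.le, Real.sq_sqrt (hX.le.trans hX'),
      sq_nonneg (√(ν * (t₂ - t₀)) - √(ν * (t₁ - t₀)))]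
  have hL := momentLap_nonneg (d := d) α
  have h4 : 2 * momentLap d α * M * √(ν * (t₁ - t₀)) ^ (α - 1)
        * (√(ν * (t₂ - t₀)) - √(ν * (t₁ - t₀)))
      ≤ momentLap d α * M * (ν * (t₂ - t₁)) * (ν * (t₁ - t₀)) ^ (α / 2 - 1) := by
    have hs := Real.sqrt_pos.2 hX
    calc _ ≤ 2 * momentLap d α * M * √(ν * (t₁ - t₀)) ^ (α - 1)
          * (ν * (t₂ - t₁) / (2 * √(ν * (t₁ - t₀)))) := by gcongr
      _ = momentLap d α * M * (ν * (t₂ - t₁)) * √(ν * (t₁ - t₀)) ^ (α - 2) := by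
          rw [show α - 2 = α - 1 - 1 by ring, Real.rpow_sub_one hs.ne' (α - 1)]
          field_simp
      _ = _ := by rw [sqrt_rpow hX.le]; congr 2; ring
  have h5 : (ν * (t₁ - t₀)) ^ (α + 1 / 2) ≤ (ν * (t₂ - t₀)) ^ (α + 1 / 2) := by gcongr
  have h6 : forceConst d α * M ^ 2 * ((ν * (t₁ - t₀)) ^ (α + 1 / 2) / (ν * (α + 1 / 2)))
      ≤ forceConst d α * M ^ 2 * ((ν * (t₂ - t₀)) ^ (α + 1 / 2) / (ν * (α + 1 / 2))) := by gcongr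
  simp only [Pi.sub_apply, sub_self, mul_zero, Real.sqrt_zero, avg_gauss_zero, Real.zero_rpow hγ.ne'] at h1
  refine (sub_le_iff_le_add'.1 ((abs_sub_abs_le_abs_sub _ _).trans h1)).trans ?_
  have h7 := h2.trans h4
  simp only [neg_div, mul_sub, mul_neg, neg_zero, zero_div, mul_zero] at h6 h7 ⊢
  linarith

/-- The increment of the velocity along the trajectory, below the viscous time scale. -/
lemma abs_sub_le_viscous (h : Comoving T ν M α V P) (hα : 0 < α) (hα1 : 2 * α < 1) (hν : 0 < ν)
    (hM : 0 ≤ M) {t₀ t₁ t₂ : ℝ} (ht₀ : t₀ ∈ Ioo 0 T) (ht₂ : t₂ ∈ Ioo 0 T) (h01 : t₀ < t₁)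
    (ht : t₁ ≤ t₂) (i : Fin d) :
    (∫ z : Vec d, gauss z) * |V i (t₂, 0) - V i (t₁, 0)|
      ≤ 4 * forceConst d α * M ^ 2 * ((ν * (t₂ - t₁)) ^ (α + 1 / 2) / ν)
        + momentLap d α * M * (ν * (t₂ - t₁)) * (ν * (t₁ - t₀)) ^ (α / 2 - 1) := by
  have ht₁ : t₁ ∈ Ioo 0 T := ⟨ht₀.1.trans h01, ht.trans_lt ht₂.2⟩
  have h1 := h.abs_sub_avg_sqrt_le hα hα1 hν ht₁ ht₂ ht i
  have h2 := h.abs_avg_sqrt_sub_le hα hα1 hν hM ht₀ ht₁ h01 ht i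
  have h3 := (abs_sub_le _ _ _).trans (add_le_add h1 h2)
  rw [← mul_sub, abs_mul, abs_of_pos (integral_gauss_pos (d := d))] at h3
  have hF := forceConst_nonneg (d := d) hα1
  have hd : 0 ≤ ν * (t₂ - t₁) := mul_nonneg hν.le (sub_nonneg.2 ht)
  have h4 : (ν * (t₂ - t₁)) ^ (α + 1 / 2) / (ν * (α + 1 / 2))
      ≤ 2 * ((ν * (t₂ - t₁)) ^ (α + 1 / 2) / ν) := by
    rw [← div_div, div_le_iff₀ (by linarith)]
    have : 0 ≤ (ν * (t₂ - t₁)) ^ (α + 1 / 2) / ν := by positivity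
    nlinarith
  have h5 := mul_le_mul_of_nonneg_left h4 (mul_nonneg hF (sq_nonneg M))
  linarith

end Comoving

end Increments

section Scaling

variable {d : ℕ} {α M : ℝ}

noncomputable def incrementConst (d : ℕ) (α : ℝ) : ℝ :=
  2 * moment (gauss (d := d)) α + 2 * momentLap d α + 4 * forceConst d α

lemma incrementConst_nonneg (hα1 : 2 * α < 1) : 0 ≤ incrementConst d α := by
  have h1 := forceConst_nonneg (d := d) hα1
  have h2 := momentLap_nonneg (d := d) α
  have h3 := moment_nonneg (gauss (d := d)) α
  unfold incrementConst
  positivity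

/-- The increment estimate in terms of length scales: `ρ` is the viscous length, and `r` is the
length associated with the time increment. -/
lemma Comoving.abs_sub_le {T ρ r a t₁ t₂ : ℝ} {V : Fin d → ℝ × Vec d → ℝ} {P : ℝ × Vec d → ℝ}
    (h : Comoving T (M * ρ ^ (1 + α)) M α V P) (hα : 0 < α) (hα1 : 2 * α < 1) (hM : 0 < M)
    (hρ : 0 < ρ) (hr : 0 < r) (ha : 0 < a) (ht₁ : a * (ρ ^ (1 - α) / M) ≤ t₁) (ht₂ : t₂ < T)
    (ht : t₂ - t₁ = r ^ (1 - α) / M) (i : Fin d) :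
    (∫ z : Vec d, gauss z) * |V i (t₂, 0) - V i (t₁, 0)|
      ≤ incrementConst d α * (a⁻¹ + 1) * (M * r ^ α) := by
  have hν : 0 < M * ρ ^ (1 + α) := by positivity
  have hτ : t₁ < t₂ := sub_pos.1 (ht ▸ by positivity)
  have ht₀ : 0 < t₁ := lt_of_lt_of_le (by positivity) ht₁
  have hI₁ : t₁ ∈ Ioo 0 T := ⟨ht₀, hτ.trans ht₂⟩
  have hI₂ : t₂ ∈ Ioo 0 T := ⟨ht₀.trans hτ, ht₂⟩
  have hF := forceConst_nonneg (d := d) hα1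
  have hL := momentLap_nonneg (d := d) α
  have hm := moment_nonneg (gauss (d := d)) α
  have ha' : 0 < a⁻¹ := inv_pos.2 ha
  have hadd : ∀ {z b c : ℝ}, 0 < z → z ^ b * z ^ c = z ^ (b + c) := fun hz => (Real.rpow_add hz _ _).symm
  have hRHS : (2 * moment (gauss (d := d)) α + 4 * forceConst d α) * (M * r ^ α)
      + 2 * momentLap d α * (a⁻¹ + 1) * (M * r ^ α) ≤ incrementConst d α * (a⁻¹ + 1) * (M * r ^ α) := by
    rw [← add_mul]
    refine mul_le_mul_of_nonneg_right ?_ (by positivity)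
    unfold incrementConst
    nlinarith
  refine le_trans ?_ hRHS
  rcases le_or_gt ρ r with hρr | hrρ
  · refine (h.abs_sub_le_scale hα hα1 hν hI₁ hI₂ hτ.le hr i).trans ?_
    rw [ht]
    have e1 : M * ρ ^ (1 + α) * (momentLap d α * M * r ^ (α - 2)) * (r ^ (1 - α) / M)
        ≤ momentLap d α * (M * r ^ α) := by
      calc _ = momentLap d α * M * ρ ^ (1 + α) * (r ^ (α - 2) * r ^ (1 - α)) := by
            field_simp
        _ ≤ momentLap d α * M * r ^ (1 + α) * (r ^ (α - 2) * r ^ (1 - α)) := by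
            gcongr
        _ = momentLap d α * M * (r ^ (1 + α) * (r ^ (α - 2) * r ^ (1 - α))) := by ring
        _ = _ := by
            rw [hadd hr, hadd hr, mul_assoc]
            congr 3
            ring
    have e2 : forceConst d α * M ^ 2 * r ^ (2 * α - 1) * (r ^ (1 - α) / M)
        = forceConst d α * (M * r ^ α) := by
      calc _ = forceConst d α * M * (r ^ (2 * α - 1) * r ^ (1 - α)) := by field_simp
        _ = _ := by
            rw [hadd hr, mul_assoc]
            congr 3
            ring
    have e3 : 0 ≤ momentLap d α * (M * r ^ α) := by positivity
    have e4 : 0 ≤ momentLap d α * (M * r ^ α) * a⁻¹ := by positivity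
    have e5 : 0 ≤ forceConst d α * (M * r ^ α) := by positivity
    linarith
  · set b := min a 1 / 2 with hb
    have hb0 : 0 < b := by positivity
    have hb1 : b ≤ 1 := by linarith [min_le_right a 1]
    have hba : b < a := by linarith [min_le_left a 1, (lt_min ha one_pos : 0 < min a 1)]
    have hbinv : b⁻¹ ≤ 2 * (a⁻¹ + 1) := by
      rw [hb, inv_div, div_eq_mul_inv]
      have : (min a 1)⁻¹ ≤ a⁻¹ + 1 := by
        rcases min_cases a 1 with ⟨h, -⟩ | ⟨h, -⟩ <;> rw [h] <;> linarith [inv_one (G := ℝ)]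
      linarith
    have hτν : 0 < ρ ^ (1 - α) / M := by positivity
    have h0 : t₁ - b * (ρ ^ (1 - α) / M) ∈ Ioo 0 T :=
      ⟨by nlinarith, by nlinarith [hI₁.2]⟩
    refine (h.abs_sub_le_viscous hα hα1 hν hM.le h0 hI₂ (by nlinarith) hτ.le i).trans ?_
    rw [ht, sub_sub_cancel]
    have e0 : M * ρ ^ (1 + α) * (r ^ (1 - α) / M) = ρ ^ (1 + α) * r ^ (1 - α) := by field_simp
    have e0' : M * ρ ^ (1 + α) * (b * (ρ ^ (1 - α) / M)) = b * ρ ^ (2 : ℝ) := by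
      calc _ = b * (ρ ^ (1 + α) * ρ ^ (1 - α)) := by field_simp
        _ = _ := by
            rw [hadd hρ]
            congr 2
            ring
    have e1 : M ^ 2 * ((ρ ^ (1 + α) * r ^ (1 - α)) ^ (α + 1 / 2) / (M * ρ ^ (1 + α))) ≤ M * r ^ α := by
      calc _ = M * ((ρ ^ ((1 + α) * (α + 1 / 2)) / ρ ^ (1 + α)) * r ^ ((1 - α) * (α + 1 / 2))) := by
            rw [Real.mul_rpow (by positivity) (by positivity), ← Real.rpow_mul hρ.le,
              ← Real.rpow_mul hr.le]
            field_simp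
        _ = M * (ρ ^ ((1 + α) * (α + 1 / 2) - (1 + α)) * r ^ ((1 - α) * (α + 1 / 2))) := by
            rw [Real.rpow_sub hρ]
        _ ≤ M * (r ^ ((1 + α) * (α + 1 / 2) - (1 + α)) * r ^ ((1 - α) * (α + 1 / 2))) := by
            have := Real.rpow_le_rpow_of_nonpos hr hrρ.le
              (show (1 + α) * (α + 1 / 2) - (1 + α) ≤ 0 by nlinarith)
            gcongr
        _ = _ := by
            rw [hadd hr]
            congr 2
            ring
    have e2 : M * (ρ ^ (1 + α) * r ^ (1 - α)) * (b * ρ ^ (2 : ℝ)) ^ (α / 2 - 1)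
        ≤ 2 * (a⁻¹ + 1) * (M * r ^ α) := by
      calc _ = M * (b ^ (α / 2 - 1) * (ρ ^ (1 + α) * ρ ^ (2 * (α / 2 - 1)) * r ^ (1 - α))) := by
            rw [Real.mul_rpow hb0.le (by positivity), ← Real.rpow_mul hρ.le]
            ring
        _ = M * (b ^ (α / 2 - 1) * (ρ ^ (2 * α - 1) * r ^ (1 - α))) := by
            rw [hadd hρ, show 1 + α + 2 * (α / 2 - 1) = 2 * α - 1 by ring]
        _ ≤ M * (b ^ (-1 : ℝ) * (r ^ (2 * α - 1) * r ^ (1 - α))) := by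
            have h1 := Real.rpow_le_rpow_of_nonpos hr hrρ.le (show 2 * α - 1 ≤ 0 by linarith)
            have h2 := Real.rpow_le_rpow_of_exponent_ge hb0 hb1 (show (-1 : ℝ) ≤ α / 2 - 1 by linarith)
            gcongr
        _ = b⁻¹ * (M * r ^ α) := by
            rw [hadd hr, Real.rpow_neg_one, show 2 * α - 1 + (1 - α) = α by ring]
            ring
        _ ≤ _ := mul_le_mul_of_nonneg_right hbinv (by positivity)
    rw [e0, e0']
    have e3 := mul_le_mul_of_nonneg_left e1 (mul_nonneg zero_le_four hF)
    have e4 := mul_le_mul_of_nonneg_left e2 hL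
    have e5 : 0 ≤ moment (gauss (d := d)) α * (M * r ^ α) := by positivity
    linarith

/-- The increment estimate in physical variables. -/
lemma Comoving.abs_sub_le_of_le {T ν a t₁ t₂ : ℝ} {V : Fin d → ℝ × Vec d → ℝ} {P : ℝ × Vec d → ℝ}
    (h : Comoving T ν M α V P) (hα : 0 < α) (hα1 : 2 * α < 1) (hM : 0 < M) (hν : 0 < ν)
    (ha : 0 < a) (ht₁ : a * M ^ (-2 / (1 + α)) * ν ^ ((1 - α) / (1 + α)) ≤ t₁) (ht₂ : t₂ < T)
    (ht : t₁ < t₂) (i : Fin d) :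
    (∫ z : Vec d, gauss z) * |V i (t₂, 0) - V i (t₁, 0)|
      ≤ incrementConst d α * (a⁻¹ + 1) * (M ^ (1 / (1 - α)) * (t₂ - t₁) ^ (α / (1 - α))) := by
  have hτ : 0 < t₂ - t₁ := sub_pos.2 ht
  have h1 : 1 + α ≠ 0 := by linarith
  have h2 : 1 - α ≠ 0 := by linarith
  have hρν : M * ((ν / M) ^ (1 / (1 + α))) ^ (1 + α) = ν := by
    rw [← Real.rpow_mul (by positivity), one_div_mul_cancel h1, Real.rpow_one]
    field_simp
  have hρ1 : ((ν / M) ^ (1 / (1 + α))) ^ (1 - α) / M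
      = M ^ (-2 / (1 + α)) * ν ^ ((1 - α) / (1 + α)) := by
    rw [← Real.rpow_mul (by positivity), Real.div_rpow hν.le hM.le, one_div_mul_eq_div,
      show -2 / (1 + α) = -((1 - α) / (1 + α)) - 1 by field_simp; ring, Real.rpow_sub_one hM.ne',
      Real.rpow_neg hM.le]
    field_simp
  have hr : ((M * (t₂ - t₁)) ^ (1 / (1 - α))) ^ (1 - α) / M = t₂ - t₁ := by
    rw [← Real.rpow_mul (by positivity), one_div_mul_cancel h2, Real.rpow_one]
    field_simp
  have hr1 : M * ((M * (t₂ - t₁)) ^ (1 / (1 - α))) ^ α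
      = M ^ (1 / (1 - α)) * (t₂ - t₁) ^ (α / (1 - α)) := by
    rw [← Real.rpow_mul (by positivity), Real.mul_rpow hM.le hτ.le, one_div_mul_eq_div,
      show 1 / (1 - α) = 1 + α / (1 - α) by field_simp; ring, Real.rpow_add hM, Real.rpow_one]
    ring
  rw [← hr1]
  refine Comoving.abs_sub_le (hρν.symm ▸ h) hα hα1 hM (ρ := (ν / M) ^ (1 / (1 + α)))
    (by positivity) (by positivity) ha ?_ ht₂ hr.symm i
  rwa [hρ1, ← mul_assoc]

end Scaling

lemma norm_le_sum_norm_coord {d : ℕ} (v : Vec d) : ‖v‖ ≤ ∑ i, ‖v i‖ := by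
  rw [EuclideanSpace.norm_eq]
  refine Real.sqrt_le_iff.2 ⟨Finset.sum_nonneg fun i _ => norm_nonneg _, ?_⟩
  exact Finset.sum_sq_le_sq_sum_of_nonneg fun i _ => norm_nonneg _

/-- Lagrangian estimate for trajectories, range `0 < α < 1/2`. -/
theorem stmt4 (d : ℕ) (hd : 2 ≤ d) (α : ℝ) (hα : 0 < α) (hα1 : α < 1 / 2) :
    ∃ C : ℝ, 0 < C ∧
      ∀ T ν : ℝ, 0 < T → 0 < ν →
      ∀ (u : ℝ → EuclideanSpace ℝ (Fin d) → EuclideanSpace ℝ (Fin d)) (p : ℝ → EuclideanSpace ℝ (Fin d) → ℝ),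
        ContinuousOn (fun q : ℝ × EuclideanSpace ℝ (Fin d) => u q.1 q.2) (Ico 0 T ×ˢ univ) →
        ContDiffOn ℝ (⊤ : ℕ∞) (fun q : ℝ × EuclideanSpace ℝ (Fin d) => u q.1 q.2) (Ioo 0 T ×ˢ univ) →
        ContDiffOn ℝ (⊤ : ℕ∞) (fun q : ℝ × EuclideanSpace ℝ (Fin d) => p q.1 q.2) (Ioo 0 T ×ˢ univ) →
        (∀ (t : ℝ) (x : EuclideanSpace ℝ (Fin d)) (n : Fin d → ℤ), u t (x + (EuclideanSpace.equiv (Fin d) ℝ).symm (fun i => (n i : ℝ))) = u t x) →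
        (∀ (t : ℝ) (x : EuclideanSpace ℝ (Fin d)) (n : Fin d → ℤ), p t (x + (EuclideanSpace.equiv (Fin d) ℝ).symm (fun i => (n i : ℝ))) = p t x) →
        (∀ t ∈ Ioo (0 : ℝ) T, ∀ (x : EuclideanSpace ℝ (Fin d)) (i : Fin d),
          deriv (fun s => u s x i) t
              + ∑ j, u t x j * fderiv ℝ (fun y => u t y i) x (EuclideanSpace.single j 1)
              + fderiv ℝ (fun y => p t y) x (EuclideanSpace.single i 1)
            = ν * ∑ j, fderiv ℝ (fun y => fderiv ℝ (fun z => u t z i) y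
                (EuclideanSpace.single j 1)) x (EuclideanSpace.single j 1)) →
        (∀ t ∈ Ioo (0 : ℝ) T, ∀ x : EuclideanSpace ℝ (Fin d),
          ∑ i, fderiv ℝ (fun y => u t y i) x (EuclideanSpace.single i 1) = 0) →
        (∃ M₀ : ℝ, ∀ t ∈ Ico (0 : ℝ) T, ∀ x, ‖u t x‖ ≤ M₀) →
        ∀ M₁ : ℝ,
          IsLUB {r : ℝ | ∃ t ∈ Ico (0 : ℝ) T, ∃ x y : EuclideanSpace ℝ (Fin d),
            x ≠ y ∧ r = ‖u t x - u t y‖ / ‖x - y‖ ^ α} M₁ →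
          0 < M₁ →
          ∀ x : ℝ → EuclideanSpace ℝ (Fin d),
            ContDiffOn ℝ (⊤ : ℕ∞) x (Ioo 0 T) →
            (∀ t ∈ Ioo (0 : ℝ) T, HasDerivAt x (u t (x t)) t) →
            ∀ a : ℝ, 0 < a →
              ∀ t₁ t₂ : ℝ,
                t₁ ∈ Ico (a * M₁ ^ (-2 / (1 + α)) * ν ^ ((1 - α) / (1 + α))) T →
                t₂ ∈ Ico (a * M₁ ^ (-2 / (1 + α)) * ν ^ ((1 - α) / (1 + α))) T →
                  ‖deriv x t₁ - deriv x t₂‖ ≤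
                    C * (a⁻¹ + 1) * M₁ ^ (1 / (1 - α)) * |t₁ - t₂| ^ (α / (1 - α)) := by
  have hZ := integral_gauss_pos (d := d)
  have hα2 : 2 * α < 1 := by linarith
  have hK := incrementConst_nonneg (d := d) hα2
  refine ⟨d * (incrementConst d α / ∫ z : Vec d, gauss z) + 1, by positivity, ?_⟩
  intro T ν _ hν u p _ hu hp hup hpp hns hdiv _ M₁ hM₁ hM x hx hxu a ha
  have hholder : ∀ t ∈ Ioo 0 T, ∀ x y, ‖u t x - u t y‖ ≤ M₁ * ‖x - y‖ ^ α := by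
    intro t ht x y
    rcases eq_or_ne x y with rfl | hxy
    · simp [Real.zero_rpow hα.ne']
    · rw [← div_le_iff₀ (Real.rpow_pos_of_pos (norm_pos_iff.2 (sub_ne_zero.2 hxy)) α)]
      exact hM₁.1 ⟨t, Ioo_subset_Ico_self ht, x, y, hxy, rfl⟩
  have h : Comoving T ν M₁ α (fun i q => u q.1 (x q.1 + q.2) i) (fun q => p q.1 (x q.1 + q.2)) :=
    comoving_of_navierStokes hu hp hup hpp hns hdiv hholder hx hxu
  have hτ : 0 < a * M₁ ^ (-2 / (1 + α)) * ν ^ ((1 - α) / (1 + α)) := by positivity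
  have key : ∀ t₁ t₂ : ℝ, a * M₁ ^ (-2 / (1 + α)) * ν ^ ((1 - α) / (1 + α)) ≤ t₁ → t₂ < T → t₁ < t₂ →
      ‖deriv x t₁ - deriv x t₂‖ ≤ (d * (incrementConst d α / ∫ z : Vec d, gauss z) + 1)
        * (a⁻¹ + 1) * M₁ ^ (1 / (1 - α)) * |t₁ - t₂| ^ (α / (1 - α)) := by
    intro t₁ t₂ ht₁ ht₂ ht
    have h0 : 0 < t₂ - t₁ := sub_pos.2 ht
    set R := (a⁻¹ + 1) * (M₁ ^ (1 / (1 - α)) * (t₂ - t₁) ^ (α / (1 - α))) with hR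
    have hR0 : 0 ≤ R := by positivity
    rw [(hxu t₁ ⟨hτ.trans_le ht₁, ht.trans ht₂⟩).deriv,
      (hxu t₂ ⟨hτ.trans_le (ht₁.trans ht.le), ht₂⟩).deriv, norm_sub_rev, abs_sub_comm, abs_of_pos h0]
    have hi : ∀ i, ‖(u t₂ (x t₂) - u t₁ (x t₁)) i‖
        ≤ incrementConst d α / (∫ z : Vec d, gauss z) * R := by
      intro i
      have := h.abs_sub_le_of_le hα hα2 hM hν ha ht₁ ht₂ ht i
      simp only [add_zero] at this
      rw [PiLp.sub_apply, Real.norm_eq_abs, div_mul_eq_mul_div, le_div_iff₀ hZ, mul_comm, hR,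
        ← mul_assoc (incrementConst d α)]
      exact this
    calc _ ≤ ∑ i, ‖(u t₂ (x t₂) - u t₁ (x t₁)) i‖ := norm_le_sum_norm_coord _
      _ ≤ ∑ _i : Fin d, incrementConst d α / (∫ z : Vec d, gauss z) * R :=
          Finset.sum_le_sum fun i _ => hi i
      _ = d * (incrementConst d α / ∫ z : Vec d, gauss z) * R := by
          rw [Finset.sum_const, Finset.card_univ, Fintype.card_fin, nsmul_eq_mul, mul_assoc]
      _ ≤ (d * (incrementConst d α / ∫ z : Vec d, gauss z) + 1) * R := by linarith
      _ = _ := by rw [hR]; ring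
  intro t₁ t₂ ht₁ ht₂
  rcases lt_trichotomy t₁ t₂ with ht | rfl | ht
  · exact key t₁ t₂ ht₁.1 ht₂.2 ht
  · rw [sub_self, norm_zero]
    positivity
  · rw [norm_sub_rev, abs_sub_comm]
    exact key t₂ t₁ ht₂.1 ht₁.2 ht
end

section
/- Assume α = 1/2. There exists a constant C depending only on d (independent of ν and a) such that for every a > 0 and all t₁, t₂ ∈ [a M₁^{−4/3} ν^{1/3}, T): |x′(t₁) − x′(t₂)| ≤ C (a^{−1} + 1) M₁² |t₁ − t₂| (1 − log⁻(M₁ |t₁ − t₂|)), where log⁻(s) = min(log s, 0). -/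
open MeasureTheory Set

namespace LagrangianRegularity

open scoped ContDiff Topology
open Filter

variable {d : ℕ}

/-! ### Gaussian kernels -/

/-- `K` is the product of a function of temperate growth and the Gaussian `exp (-|z|² / 4)`. -/
def IsGaussian (K : EuclideanSpace ℝ (Fin d) → ℝ) : Prop :=
  ∃ f : EuclideanSpace ℝ (Fin d) → ℝ, f.HasTemperateGrowth ∧
    K = fun z => f z * Real.exp (-(1 / 4) * ‖z‖ ^ 2)

/-- The partial derivative of a function on Euclidean space in a coordinate direction. -/
noncomputable def coordDeriv (a : Fin d) (K : EuclideanSpace ℝ (Fin d) → ℝ) :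
    EuclideanSpace ℝ (Fin d) → ℝ :=
  fun z => fderiv ℝ K z (EuclideanSpace.single a 1)

lemma hasTemperateGrowth_fderiv_apply {f : EuclideanSpace ℝ (Fin d) → ℝ}
    (hf : f.HasTemperateGrowth) (v : EuclideanSpace ℝ (Fin d)) :
    (fun z => fderiv ℝ f z v).HasTemperateGrowth := by
  have h : (fderiv ℝ f).HasTemperateGrowth := by
    refine ⟨hf.1.fderiv_right (by simp), fun n => ?_⟩
    obtain ⟨k, C, h⟩ := hf.2 (n + 1)
    exact ⟨k, C, fun x => by rw [norm_iteratedFDeriv_fderiv]; exact h x⟩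
  exact (ContinuousLinearMap.apply ℝ ℝ v).hasTemperateGrowth.comp h

lemma hasFDerivAt_gaussian (z : EuclideanSpace ℝ (Fin d)) :
    HasFDerivAt (fun z : EuclideanSpace ℝ (Fin d) => Real.exp (-(1 / 4) * ‖z‖ ^ 2))
      ((-(1 / 2) * Real.exp (-(1 / 4) * ‖z‖ ^ 2)) • innerSL ℝ z) z := by
  have h := (((hasStrictFDerivAt_norm_sq z).hasFDerivAt).const_mul (-(1 / 4))).exp
  refine h.congr_fderiv (ContinuousLinearMap.ext fun v => ?_)
  simp only [smul_apply, smul_eq_mul, nsmul_eq_mul]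
  push_cast
  ring

lemma IsGaussian.contDiff {K : EuclideanSpace ℝ (Fin d) → ℝ} (hK : IsGaussian K) :
    ContDiff ℝ ∞ K := by
  obtain ⟨f, hf, rfl⟩ := hK
  exact hf.1.mul ((contDiff_const.mul (contDiff_norm_sq ℝ)).exp)

lemma IsGaussian.differentiable {K : EuclideanSpace ℝ (Fin d) → ℝ} (hK : IsGaussian K) :
    Differentiable ℝ K :=
  hK.contDiff.differentiable (by simp)

lemma IsGaussian.coordDeriv {K : EuclideanSpace ℝ (Fin d) → ℝ} (hK : IsGaussian K) (a : Fin d) :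
    IsGaussian (coordDeriv a K) := by
  obtain ⟨f, hf, rfl⟩ := hK
  refine ⟨fun z => fderiv ℝ f z (EuclideanSpace.single a 1) - 1 / 2 * (z a * f z), ?_, ?_⟩
  · refine (hasTemperateGrowth_fderiv_apply hf _).sub
      ((Function.HasTemperateGrowth.const _).mul (Function.HasTemperateGrowth.mul ?_ hf))
    exact (EuclideanSpace.proj a : EuclideanSpace ℝ (Fin d) →L[ℝ] ℝ).hasTemperateGrowth
  · funext z
    have h := (((hf.1.differentiable (by simp)) z).hasFDerivAt.mul (hasFDerivAt_gaussian z)).fderiv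
    simp only [LagrangianRegularity.coordDeriv]
    erw [h]
    simp [EuclideanSpace.inner_single_right]
    ring

lemma isGaussian_exp (c : ℝ) :
    IsGaussian fun z : EuclideanSpace ℝ (Fin d) => c * Real.exp (-(1 / 4) * ‖z‖ ^ 2) :=
  ⟨fun _ => c, Function.HasTemperateGrowth.const c, rfl⟩

lemma integrable_exp_norm_sq {b : ℝ} (hb : 0 < b) :
    Integrable fun z : EuclideanSpace ℝ (Fin d) => Real.exp (-b * ‖z‖ ^ 2) := by
  by_contra h
  have h1 := GaussianFourier.integral_rexp_neg_mul_sq_norm (V := EuclideanSpace ℝ (Fin d)) hb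
  rw [integral_undef h] at h1
  have : 0 < (Real.pi / b) ^ (Module.finrank ℝ (EuclideanSpace ℝ (Fin d)) / 2 : ℝ) := by positivity
  linarith

lemma exists_one_add_pow_le_exp (k : ℕ) :
    ∃ C, ∀ t : ℝ, 0 ≤ t → (1 + t) ^ k ≤ C * Real.exp (1 / 8 * t ^ 2) := by
  refine ⟨(k.factorial : ℝ) * Real.exp 3, fun t ht => ?_⟩
  have h1 := Real.pow_div_factorial_le_exp (1 + t) (by linarith) k
  rw [div_le_iff₀ (by positivity)] at h1
  have h2 : Real.exp (1 + t) ≤ Real.exp 3 * Real.exp (1 / 8 * t ^ 2) := by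
    rw [← Real.exp_add]
    exact Real.exp_le_exp.2 (by nlinarith [sq_nonneg (t - 4)])
  nlinarith [(Nat.cast_nonneg k.factorial : (0 : ℝ) ≤ _)]

lemma IsGaussian.integrable_weight {K : EuclideanSpace ℝ (Fin d) → ℝ} (hK : IsGaussian K) :
    Integrable fun z => (1 + ‖z‖) * |K z| := by
  have hc := hK.contDiff.continuous
  obtain ⟨f, hf, rfl⟩ := hK
  obtain ⟨k, C, h⟩ := hf.2 0
  obtain ⟨C', h'⟩ := exists_one_add_pow_le_exp (k + 1)
  refine ((integrable_exp_norm_sq (d := d) (b := 1 / 8) (by norm_num)).const_mul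
    (|C| * C')).mono' (by fun_prop) (ae_of_all _ fun z => ?_)
  have hz := norm_nonneg z
  have h1 : |f z| ≤ |C| * (1 + ‖z‖) ^ k := by
    have := h z
    rw [norm_iteratedFDeriv_zero] at this
    exact this.trans (by gcongr; exact le_abs_self C)
  have h2 := h' ‖z‖ hz
  rw [Real.norm_of_nonneg (by positivity), abs_mul, Real.abs_exp]
  calc (1 + ‖z‖) * (|f z| * Real.exp (-(1 / 4) * ‖z‖ ^ 2))
      ≤ (1 + ‖z‖) * ((|C| * (1 + ‖z‖) ^ k) * Real.exp (-(1 / 4) * ‖z‖ ^ 2)) := by gcongr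
    _ = |C| * (1 + ‖z‖) ^ (k + 1) * Real.exp (-(1 / 4) * ‖z‖ ^ 2) := by ring
    _ ≤ |C| * (C' * Real.exp (1 / 8 * ‖z‖ ^ 2)) * Real.exp (-(1 / 4) * ‖z‖ ^ 2) := by gcongr
    _ = |C| * C' * Real.exp (-(1 / 8) * ‖z‖ ^ 2) := by
      rw [mul_assoc |C|, mul_assoc C', ← Real.exp_add, ← mul_assoc]; ring_nf

/-- The first absolute moment of a kernel. -/
noncomputable def moment (K : EuclideanSpace ℝ (Fin d) → ℝ) : ℝ := ∫ z, (1 + ‖z‖) * |K z|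

lemma moment_nonneg (K : EuclideanSpace ℝ (Fin d) → ℝ) : 0 ≤ moment K :=
  integral_nonneg fun z => by positivity

lemma IsGaussian.integrable_mul {K : EuclideanSpace ℝ (Fin d) → ℝ} (hK : IsGaussian K)
    {h : EuclideanSpace ℝ (Fin d) → ℝ} (hc : Continuous h) {B : ℝ}
    (hB : ∀ z, |h z| ≤ B * (1 + ‖z‖)) : Integrable fun z => K z * h z := by
  have hc' := hK.contDiff.continuous
  refine (hK.integrable_weight.const_mul B).mono' (by fun_prop) (ae_of_all _ fun z => ?_)
  rw [Real.norm_eq_abs, abs_mul]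
  nlinarith [hB z, abs_nonneg (K z)]

lemma IsGaussian.abs_integral_mul_le {K : EuclideanSpace ℝ (Fin d) → ℝ} (hK : IsGaussian K)
    {h : EuclideanSpace ℝ (Fin d) → ℝ} {B : ℝ}
    (hB : ∀ z, |h z| ≤ B * (1 + ‖z‖)) : |∫ z, K z * h z| ≤ B * moment K := by
  rw [moment, ← integral_const_mul, ← Real.norm_eq_abs]
  refine norm_integral_le_of_norm_le (hK.integrable_weight.const_mul B) (ae_of_all _ fun z => ?_)
  rw [Real.norm_eq_abs, abs_mul]
  nlinarith [hB z, abs_nonneg (K z)]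

/-- The heat kernel at time one. -/
noncomputable def unitKernel (d : ℕ) : EuclideanSpace ℝ (Fin d) → ℝ :=
  fun z => (∫ y : EuclideanSpace ℝ (Fin d), Real.exp (-(1 / 4) * ‖y‖ ^ 2))⁻¹ *
    Real.exp (-(1 / 4) * ‖z‖ ^ 2)

lemma isGaussian_unitKernel : IsGaussian (unitKernel d) := isGaussian_exp _

lemma integral_unitKernel : ∫ z, unitKernel d z = 1 := by
  simp only [unitKernel]
  rw [integral_const_mul, inv_mul_cancel₀]
  rw [GaussianFourier.integral_rexp_neg_mul_sq_norm (by norm_num)]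
  positivity

lemma coordDeriv_unitKernel (a : Fin d) (z : EuclideanSpace ℝ (Fin d)) :
    z a * unitKernel d z = -2 * coordDeriv a (unitKernel d) z := by
  have h := ((hasFDerivAt_gaussian z).const_mul
    (∫ y : EuclideanSpace ℝ (Fin d), Real.exp (-(1 / 4) * ‖y‖ ^ 2))⁻¹).fderiv
  simp only [coordDeriv, unitKernel]
  erw [h]
  simp [EuclideanSpace.inner_single_right]
  ring

/-- A common bound for the moments of the heat kernel and its derivatives up to third order. -/
structure MomentBound (d : ℕ) (A : ℝ) : Prop where
  zero : moment (unitKernel d) ≤ A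
  one : ∀ a, moment (coordDeriv a (unitKernel d)) ≤ A
  two : ∀ a b, moment (coordDeriv a (coordDeriv b (unitKernel d))) ≤ A
  three : ∀ a b c, moment (coordDeriv a (coordDeriv b (coordDeriv c (unitKernel d)))) ≤ A

lemma MomentBound.nonneg {A : ℝ} (hA : MomentBound d A) : 0 ≤ A :=
  (moment_nonneg _).trans hA.zero

lemma exists_momentBound (d : ℕ) : ∃ A, MomentBound d A := by
  obtain ⟨A₁, h₁⟩ := Finite.exists_le fun a : Fin d => moment (coordDeriv a (unitKernel d))
  obtain ⟨A₂, h₂⟩ := Finite.exists_le fun a : Fin d × Fin d =>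
    moment (coordDeriv a.1 (coordDeriv a.2 (unitKernel d)))
  obtain ⟨A₃, h₃⟩ := Finite.exists_le fun a : Fin d × Fin d × Fin d =>
    moment (coordDeriv a.1 (coordDeriv a.2.1 (coordDeriv a.2.2 (unitKernel d))))
  refine ⟨max (moment (unitKernel d)) (max A₁ (max A₂ A₃)), ?_, fun a => ?_, fun a b => ?_,
    fun a b c => ?_⟩
  · exact le_max_left _ _
  · exact (h₁ a).trans (by simp)
  · exact (h₂ (a, b)).trans (by simp)
  · exact (h₃ (a, b, c)).trans (by simp)

/-! ### Smooth spatially periodic functions on space-time -/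

/-- The vector of the integer lattice with the given coordinates. -/
noncomputable def latticeVec (n : Fin d → ℤ) : EuclideanSpace ℝ (Fin d) :=
  (EuclideanSpace.equiv (Fin d) ℝ).symm (fun i => (n i : ℝ))

lemma norm_le_sum_abs (y : EuclideanSpace ℝ (Fin d)) : ‖y‖ ≤ ∑ i, |y i| := by
  rw [EuclideanSpace.norm_eq]
  refine Real.sqrt_le_iff.2 ⟨Finset.sum_nonneg fun _ _ => abs_nonneg _, ?_⟩
  exact Finset.sum_sq_le_sq_sum_of_nonneg fun _ _ => norm_nonneg _

lemma exists_norm_add_latticeVec_le (y : EuclideanSpace ℝ (Fin d)) :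
    ∃ n : Fin d → ℤ, ‖y + latticeVec n‖ ≤ d := by
  refine ⟨fun i => -⌊y i⌋, (norm_le_sum_abs _).trans ?_⟩
  refine (Finset.sum_le_card_nsmul _ _ 1 fun i _ => ?_).trans (by simp)
  have h : (y + latticeVec (fun i => -⌊y i⌋)) i = Int.fract (y i) := by
    simp [latticeVec, Int.fract, sub_eq_add_neg]
  rw [h, abs_of_nonneg (Int.fract_nonneg _)]
  exact (Int.fract_lt_one _).le

/-- The open space-time slab `(0, T) × ℝ^d`. -/
def slab (d : ℕ) (T : ℝ) : Set (ℝ × EuclideanSpace ℝ (Fin d)) := Ioo 0 T ×ˢ univ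

lemma isOpen_slab (T : ℝ) : IsOpen (slab d T) := isOpen_Ioo.prod isOpen_univ

lemma mem_slab {T s : ℝ} (hs : s ∈ Ioo 0 T) (y : EuclideanSpace ℝ (Fin d)) : (s, y) ∈ slab d T :=
  ⟨hs, mem_univ y⟩

/-- The directional derivative of a function on space-time. -/
noncomputable def dirDeriv (v : ℝ × EuclideanSpace ℝ (Fin d))
    (F : ℝ × EuclideanSpace ℝ (Fin d) → ℝ) : ℝ × EuclideanSpace ℝ (Fin d) → ℝ :=
  fun q => fderiv ℝ F q v

/-- The time derivative. -/
noncomputable abbrev dt (F : ℝ × EuclideanSpace ℝ (Fin d) → ℝ) :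
    ℝ × EuclideanSpace ℝ (Fin d) → ℝ := dirDeriv (1, 0) F

/-- The partial derivative in a spatial coordinate. -/
noncomputable abbrev dx (a : Fin d) (F : ℝ × EuclideanSpace ℝ (Fin d) → ℝ) :
    ℝ × EuclideanSpace ℝ (Fin d) → ℝ := dirDeriv (0, EuclideanSpace.single a 1) F

/-- Smooth functions on the slab, periodic in space. -/
structure PerSmooth (T : ℝ) (F : ℝ × EuclideanSpace ℝ (Fin d) → ℝ) : Prop where
  smooth : ContDiffOn ℝ ∞ F (slab d T)
  periodic : ∀ (n : Fin d → ℤ) q, F (q + (0, latticeVec n)) = F q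

section PerSmooth

variable {T : ℝ} {F G : ℝ × EuclideanSpace ℝ (Fin d) → ℝ}

lemma PerSmooth.contDiffAt (hF : PerSmooth T F) {q} (hq : q ∈ slab d T) : ContDiffAt ℝ ∞ F q :=
  hF.smooth.contDiffAt ((isOpen_slab T).mem_nhds hq)

lemma PerSmooth.differentiableAt (hF : PerSmooth T F) {q} (hq : q ∈ slab d T) :
    DifferentiableAt ℝ F q :=
  (hF.contDiffAt hq).differentiableAt (by simp)

lemma PerSmooth.dirDeriv (hF : PerSmooth T F) (v) : PerSmooth T (dirDeriv v F) where
  smooth := (hF.smooth.fderiv_of_isOpen (isOpen_slab T) (by simp)).clm_apply contDiffOn_const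
  periodic n q := by
    simp only [LagrangianRegularity.dirDeriv]
    rw [← fderiv_comp_add_right]
    simp only [hF.periodic]

lemma PerSmooth.add (hF : PerSmooth T F) (hG : PerSmooth T G) : PerSmooth T fun q => F q + G q where
  smooth := hF.smooth.add hG.smooth
  periodic n q := by simp only [hF.periodic, hG.periodic]

lemma PerSmooth.sub (hF : PerSmooth T F) (hG : PerSmooth T G) : PerSmooth T fun q => F q - G q where
  smooth := hF.smooth.sub hG.smooth
  periodic n q := by simp only [hF.periodic, hG.periodic]

lemma PerSmooth.mul (hF : PerSmooth T F) (hG : PerSmooth T G) : PerSmooth T fun q => F q * G q where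
  smooth := hF.smooth.mul hG.smooth
  periodic n q := by simp only [hF.periodic, hG.periodic]

lemma PerSmooth.const_mul (hF : PerSmooth T F) (c : ℝ) : PerSmooth T fun q => c * F q where
  smooth := contDiffOn_const.mul hF.smooth
  periodic n q := by simp only [hF.periodic]

lemma PerSmooth.sum {ι : Type*} [Fintype ι] {F : ι → ℝ × EuclideanSpace ℝ (Fin d) → ℝ}
    (hF : ∀ i, PerSmooth T (F i)) : PerSmooth T fun q => ∑ i, F i q where
  smooth := ContDiffOn.sum fun i _ => (hF i).smooth
  periodic n q := by simp only [(hF _).periodic]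

lemma PerSmooth.comp_fst_zero (hF : PerSmooth T F) :
    PerSmooth T fun q : ℝ × EuclideanSpace ℝ (Fin d) => F (q.1, 0) where
  smooth := hF.smooth.comp (by fun_prop) fun q hq => mem_slab hq.1 0
  periodic n q := by simp

lemma PerSmooth.continuous_slice (hF : PerSmooth T F) {s : ℝ} (hs : s ∈ Ioo 0 T) :
    Continuous fun y => F (s, y) :=
  hF.smooth.continuousOn.comp_continuous (by fun_prop) fun y => mem_slab hs y

lemma PerSmooth.exists_bound (hF : PerSmooth T F) {s₁ s₂ : ℝ} (h₁ : 0 < s₁) (h₂ : s₂ < T) :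
    ∃ B, 0 ≤ B ∧ ∀ s ∈ Icc s₁ s₂, ∀ y, |F (s, y)| ≤ B := by
  have hK : IsCompact (Icc s₁ s₂ ×ˢ Metric.closedBall (0 : EuclideanSpace ℝ (Fin d)) d) :=
    isCompact_Icc.prod (isCompact_closedBall _ _)
  obtain ⟨B, hB⟩ := hK.exists_bound_of_continuousOn (f := F)
    (hF.smooth.continuousOn.mono fun q hq =>
      ⟨⟨h₁.trans_le hq.1.1, hq.1.2.trans_lt h₂⟩, mem_univ _⟩)
  refine ⟨max B 0, le_max_right _ _, fun s hs y => le_max_of_le_left ?_⟩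
  obtain ⟨n, hn⟩ := exists_norm_add_latticeVec_le y
  have := hB (s, y + latticeVec n) ⟨hs, by simpa using hn⟩
  rw [← hF.periodic n (s, y)]
  simpa using this

lemma PerSmooth.exists_bound_slice (hF : PerSmooth T F) {s : ℝ} (hs : s ∈ Ioo 0 T) :
    ∃ B, 0 ≤ B ∧ ∀ y, |F (s, y)| ≤ B := by
  obtain ⟨B, hB, h⟩ := hF.exists_bound hs.1 hs.2
  exact ⟨B, hB, h s ⟨le_rfl, le_rfl⟩⟩

lemma dirDeriv_congr (h : EqOn F G (slab d T)) (v) :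
    EqOn (dirDeriv v F) (dirDeriv v G) (slab d T) := fun q hq => by
  have : F =ᶠ[𝓝 q] G := h.eventuallyEq_of_mem ((isOpen_slab T).mem_nhds hq)
  simp only [dirDeriv, this.fderiv_eq]

lemma dirDeriv_zero (v : ℝ × EuclideanSpace ℝ (Fin d)) : dirDeriv v (fun _ => 0) = fun _ => 0 := by
  funext q
  simp [dirDeriv]

lemma PerSmooth.dirDeriv_comm (hF : PerSmooth T F) (v w) :
    EqOn (LagrangianRegularity.dirDeriv v (LagrangianRegularity.dirDeriv w F))
      (LagrangianRegularity.dirDeriv w (LagrangianRegularity.dirDeriv v F)) (slab d T) := by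
  intro q hq
  have h2 : ContDiffAt ℝ 2 F q := (hF.contDiffAt hq).of_le (by norm_cast)
  have hsymm := h2.isSymmSndFDerivAt (by simp)
  have hd : DifferentiableAt ℝ (fderiv ℝ F) q :=
    (h2.fderiv_right (m := 1) (by norm_num)).differentiableAt (by simp)
  unfold LagrangianRegularity.dirDeriv
  rw [fderiv_clm_apply hd (by fun_prop), fderiv_clm_apply hd (by fun_prop)]
  simpa using hsymm v w

lemma PerSmooth.dirDeriv_sub (hF : PerSmooth T F) (hG : PerSmooth T G) (v) :
    EqOn (LagrangianRegularity.dirDeriv v fun q => F q - G q)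
      (fun q => LagrangianRegularity.dirDeriv v F q - LagrangianRegularity.dirDeriv v G q)
      (slab d T) := fun q hq => by
  simp only [LagrangianRegularity.dirDeriv]
  rw [fderiv_fun_sub (hF.differentiableAt hq) (hG.differentiableAt hq)]
  rfl

lemma PerSmooth.dirDeriv_add (hF : PerSmooth T F) (hG : PerSmooth T G) (v) :
    EqOn (LagrangianRegularity.dirDeriv v fun q => F q + G q)
      (fun q => LagrangianRegularity.dirDeriv v F q + LagrangianRegularity.dirDeriv v G q)
      (slab d T) := fun q hq => by
  simp only [LagrangianRegularity.dirDeriv]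
  rw [fderiv_fun_add (hF.differentiableAt hq) (hG.differentiableAt hq)]
  rfl

lemma PerSmooth.dirDeriv_const_mul (hF : PerSmooth T F) (c : ℝ) (v) :
    EqOn (LagrangianRegularity.dirDeriv v fun q => c * F q)
      (fun q => c * LagrangianRegularity.dirDeriv v F q) (slab d T) := fun q hq => by
  simp only [LagrangianRegularity.dirDeriv]
  rw [fderiv_const_mul (hF.differentiableAt hq)]
  rfl

lemma PerSmooth.dirDeriv_mul (hF : PerSmooth T F) (hG : PerSmooth T G) (v) :
    EqOn (LagrangianRegularity.dirDeriv v fun q => F q * G q)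
      (fun q => F q * LagrangianRegularity.dirDeriv v G q + G q * LagrangianRegularity.dirDeriv v F q)
      (slab d T) := fun q hq => by
  simp only [LagrangianRegularity.dirDeriv]
  rw [fderiv_fun_mul (hF.differentiableAt hq) (hG.differentiableAt hq)]
  rfl

lemma PerSmooth.dirDeriv_sum {ι : Type*} [Fintype ι] {F : ι → ℝ × EuclideanSpace ℝ (Fin d) → ℝ}
    (hF : ∀ i, PerSmooth T (F i)) (v) :
    EqOn (LagrangianRegularity.dirDeriv v fun q => ∑ i, F i q)
      (fun q => ∑ i, LagrangianRegularity.dirDeriv v (F i) q) (slab d T) := fun q hq => by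
  simp only [LagrangianRegularity.dirDeriv]
  rw [fderiv_fun_sum fun i _ => (hF i).differentiableAt hq]
  simp

lemma dx_comp_fst_zero (hF : PerSmooth T F) (a : Fin d) :
    EqOn (dx a fun q : ℝ × EuclideanSpace ℝ (Fin d) => F (q.1, 0)) (fun _ => 0)
      (slab d T) := fun q hq => by
  have h0 : DifferentiableAt ℝ F (q.1, 0) := hF.differentiableAt (mem_slab hq.1 0)
  have hg : HasFDerivAt (fun q : ℝ × EuclideanSpace ℝ (Fin d) =>
      (q.1, (0 : EuclideanSpace ℝ (Fin d))))
      ((ContinuousLinearMap.fst ℝ ℝ (EuclideanSpace ℝ (Fin d))).prod 0) q :=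
    hasFDerivAt_fst.prodMk (hasFDerivAt_const _ _)
  have h := (h0.hasFDerivAt.comp q hg).fderiv
  simp only [dirDeriv]
  erw [h]
  simp only [ContinuousLinearMap.comp_apply, ContinuousLinearMap.prod_apply,
    ContinuousLinearMap.coe_fst', zero_apply]
  exact map_zero (fderiv ℝ F (q.1, 0))

end PerSmooth

/-! ### Gaussian averages -/

/-- The average of the slice `F (s, ·)` against the kernel `K` rescaled to length `√ρ`. -/
noncomputable def kernelAvg (K : EuclideanSpace ℝ (Fin d) → ℝ) (ρ s : ℝ)
    (F : ℝ × EuclideanSpace ℝ (Fin d) → ℝ) : ℝ :=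
  ∫ z, K z * F (s, √ρ • z)

/-- The heat evolution for time `ρ` of the slice `F (s, ·)`, evaluated at the origin. -/
noncomputable abbrev heatAvg (ρ s : ℝ) (F : ℝ × EuclideanSpace ℝ (Fin d) → ℝ) : ℝ :=
  kernelAvg (unitKernel d) ρ s F

/-- The spatial Laplacian. -/
noncomputable def lap (F : ℝ × EuclideanSpace ℝ (Fin d) → ℝ) :
    ℝ × EuclideanSpace ℝ (Fin d) → ℝ :=
  fun q => ∑ a, dx a (dx a F) q

section KernelAvg

variable {T ρ s : ℝ} {K : EuclideanSpace ℝ (Fin d) → ℝ} {F G : ℝ × EuclideanSpace ℝ (Fin d) → ℝ}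

lemma PerSmooth.lap (hF : PerSmooth T F) : PerSmooth T (lap F) :=
  PerSmooth.sum fun _ => (hF.dirDeriv _).dirDeriv _

lemma PerSmooth.integrable_kernelAvg (hF : PerSmooth T F) (hK : IsGaussian K)
    (hs : s ∈ Ioo 0 T) : Integrable fun z => K z * F (s, √ρ • z) := by
  obtain ⟨B, hB, h⟩ := hF.exists_bound_slice hs
  refine hK.integrable_mul (B := B) ((hF.continuous_slice hs).comp (by fun_prop)) fun z => ?_
  nlinarith [h (√ρ • z), norm_nonneg z]

lemma kernelAvg_congr (h : EqOn F G (slab d T)) (hs : s ∈ Ioo 0 T) :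
    kernelAvg K ρ s F = kernelAvg K ρ s G := by
  simp only [kernelAvg, h (mem_slab hs _)]

lemma kernelAvg_add (hF : PerSmooth T F) (hG : PerSmooth T G) (hK : IsGaussian K)
    (hs : s ∈ Ioo 0 T) :
    kernelAvg K ρ s (fun q => F q + G q) = kernelAvg K ρ s F + kernelAvg K ρ s G := by
  simp only [kernelAvg, mul_add]
  exact integral_add (hF.integrable_kernelAvg hK hs) (hG.integrable_kernelAvg hK hs)

lemma kernelAvg_sub (hF : PerSmooth T F) (hG : PerSmooth T G) (hK : IsGaussian K)
    (hs : s ∈ Ioo 0 T) :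
    kernelAvg K ρ s (fun q => F q - G q) = kernelAvg K ρ s F - kernelAvg K ρ s G := by
  simp only [kernelAvg, mul_sub]
  exact integral_sub (hF.integrable_kernelAvg hK hs) (hG.integrable_kernelAvg hK hs)

lemma kernelAvg_const_mul (c : ℝ) :
    kernelAvg K ρ s (fun q => c * F q) = c * kernelAvg K ρ s F := by
  simp only [kernelAvg, mul_left_comm _ c]
  exact integral_const_mul _ _

lemma kernelAvg_sum {ι : Type*} [Fintype ι] {F : ι → ℝ × EuclideanSpace ℝ (Fin d) → ℝ}
    (hF : ∀ i, PerSmooth T (F i)) (hK : IsGaussian K) (hs : s ∈ Ioo 0 T) :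
    kernelAvg K ρ s (fun q => ∑ i, F i q) = ∑ i, kernelAvg K ρ s (F i) := by
  simp only [kernelAvg, Finset.mul_sum]
  exact integral_finsetSum _ fun i _ => (hF i).integrable_kernelAvg hK hs

lemma kernelAvg_lap (hF : PerSmooth T F) (hK : IsGaussian K) (hs : s ∈ Ioo 0 T) :
    kernelAvg K ρ s (lap F) = ∑ a, kernelAvg K ρ s (dx a (dx a F)) :=
  kernelAvg_sum (fun _ => (hF.dirDeriv _).dirDeriv _) hK hs

lemma abs_kernelAvg_le (hK : IsGaussian K) {B : ℝ}
    (hB : ∀ z, |F (s, √ρ • z)| ≤ B * (1 + ‖z‖)) : |kernelAvg K ρ s F| ≤ B * moment K :=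
  hK.abs_integral_mul_le hB

lemma PerSmooth.hasFDerivAt_slice (hF : PerSmooth T F) (hs : s ∈ Ioo 0 T)
    (z : EuclideanSpace ℝ (Fin d)) :
    HasFDerivAt (fun z => F (s, √ρ • z))
      (√ρ • (fderiv ℝ F (s, √ρ • z) ∘L ContinuousLinearMap.inr ℝ ℝ (EuclideanSpace ℝ (Fin d)))) z := by
  have hg : HasFDerivAt (fun z : EuclideanSpace ℝ (Fin d) => (s, √ρ • z))
      ((0 : EuclideanSpace ℝ (Fin d) →L[ℝ] ℝ).prod
        (√ρ • ContinuousLinearMap.id ℝ (EuclideanSpace ℝ (Fin d)))) z :=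
    (hasFDerivAt_const s z).prodMk ((hasFDerivAt_id z).const_smul √ρ)
  refine (HasFDerivAt.comp (g := F) (f := fun z => (s, √ρ • z)) z
    (hF.differentiableAt (mem_slab hs _)).hasFDerivAt hg).congr_fderiv
    (ContinuousLinearMap.ext fun v => ?_)
  have : ((0 : ℝ), √ρ • v) = √ρ • ((0 : ℝ), v) := by simp
  simp only [ContinuousLinearMap.comp_apply, ContinuousLinearMap.prod_apply, smul_apply,
    ContinuousLinearMap.inr_apply, ContinuousLinearMap.id_apply, zero_apply, this, map_smul]

lemma kernelAvg_dx (hF : PerSmooth T F) (hK : IsGaussian K) (hs : s ∈ Ioo 0 T) (a : Fin d) :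
    √ρ * kernelAvg K ρ s (dx a F) = -kernelAvg (coordDeriv a K) ρ s F := by
  have hd z := hF.hasFDerivAt_slice (ρ := ρ) hs z
  have hv z : fderiv ℝ (fun z => F (s, √ρ • z)) z (EuclideanSpace.single a 1) =
      √ρ * dx a F (s, √ρ • z) := by
    rw [(hd z).fderiv]
    rfl
  have h := integral_mul_fderiv_eq_neg_fderiv_mul_of_integrable (μ := volume) (f := K)
    (g := fun z => F (s, √ρ • z)) (v := EuclideanSpace.single a 1)
    (hF.integrable_kernelAvg (hK.coordDeriv a) hs)
    (by
      simp only [hv, mul_left_comm _ √ρ]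
      exact ((hF.dirDeriv _).integrable_kernelAvg hK hs).const_mul _)
    (hF.integrable_kernelAvg hK hs) (fun z _ => hK.differentiable z)
    fun z _ => (hd z).differentiableAt
  simp only [hv, mul_left_comm _ √ρ] at h
  rw [integral_const_mul] at h
  exact h

lemma fderiv_pair_eq (q : ℝ × EuclideanSpace ℝ (Fin d)) (m c : ℝ) (z : EuclideanSpace ℝ (Fin d)) :
    fderiv ℝ F q (m, c • z) = m * dt F q + c * ∑ a, z a * dx a F q := by
  have h : (m, c • z) = m • ((1 : ℝ), (0 : EuclideanSpace ℝ (Fin d))) +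
      c • ∑ a, z a • ((0 : ℝ), EuclideanSpace.single a (1 : ℝ)) := by
    have hz : ∑ a, z a • EuclideanSpace.single a (1 : ℝ) = z := by
      ext i
      simp [Pi.single_apply]
    ext1
    · simp [Prod.fst_sum]
    · simp [Prod.snd_sum, hz]
  rw [h, map_add, map_smul, map_smul, map_sum]
  simp only [map_smul, smul_eq_mul, dirDeriv]

/-- Along a straight line in the `(ρ, s)` half-plane the heat average solves the heat equation. -/
lemma hasDerivAt_heatAvg (hF : PerSmooth T F) {ρ₀ s₀ k m σ : ℝ} (hρ : 0 < ρ₀ + k * σ)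
    (hs : s₀ + m * σ ∈ Ioo 0 T) :
    HasDerivAt (fun σ => heatAvg (ρ₀ + k * σ) (s₀ + m * σ) F)
      (m * heatAvg (ρ₀ + k * σ) (s₀ + m * σ) (dt F) +
        k * heatAvg (ρ₀ + k * σ) (s₀ + m * σ) (lap F)) σ := by
  set r : ℝ → ℝ := fun σ => √(ρ₀ + k * σ) with hr
  have hΓ := isGaussian_unitKernel (d := d)
  have hΓc := hΓ.contDiff.continuous
  obtain ⟨s₁, hs₁, hs₁'⟩ := exists_between hs.1
  obtain ⟨s₂, hs₂, hs₂'⟩ := exists_between hs.2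
  obtain ⟨B₀, hB₀, h₀⟩ := (hF.dirDeriv (1, 0)).exists_bound hs₁ hs₂'
  choose B hB hBd using fun a => (hF.dirDeriv (0, EuclideanSpace.single a 1)).exists_bound hs₁ hs₂'
  set r' : ℝ → ℝ := fun σ => k / (2 * r σ) with hr'
  have hcr : ContinuousAt r' σ := by
    have : 2 * √(ρ₀ + k * σ) ≠ 0 := by positivity
    exact ContinuousAt.div (by fun_prop) (by fun_prop) this
  set R := |r' σ| + 1 with hR
  have hN : {x | x ∈ {x | 0 < ρ₀ + k * x} ∧ s₀ + m * x ∈ Icc s₁ s₂ ∧ |r' x| < R} ∈ 𝓝 σ := by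
    have hρ' : ∀ᶠ x in 𝓝 σ, 0 < ρ₀ + k * x :=
      (show ContinuousAt (fun x => ρ₀ + k * x) σ by fun_prop).eventually_const_lt hρ
    refine hρ'.and (Filter.Eventually.and ?_ ?_)
    · have : ContinuousAt (fun x => s₀ + m * x) σ := by fun_prop
      exact this.preimage_mem_nhds (Icc_mem_nhds hs₁' hs₂)
    · exact hcr.abs.eventually_lt_const (by linarith)
  have hmem {x} (hx : s₀ + m * x ∈ Icc s₁ s₂) : s₀ + m * x ∈ Ioo 0 T :=
    ⟨hs₁.trans_le hx.1, hx.2.trans_lt hs₂'⟩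
  have hder (x : ℝ) (hx : 0 < ρ₀ + k * x) (hx' : s₀ + m * x ∈ Ioo 0 T)
      (z : EuclideanSpace ℝ (Fin d)) :
      HasDerivAt (fun x => unitKernel d z * F (s₀ + m * x, √(ρ₀ + k * x) • z))
        (unitKernel d z * (m * dt F (s₀ + m * x, r x • z) +
          r' x * ∑ a, z a * dx a F (s₀ + m * x, r x • z))) x := by
    have h1 : HasDerivAt (fun x => s₀ + m * x) m x := by
      simpa using ((hasDerivAt_id x).const_mul m).const_add s₀
    have h2 : HasDerivAt (fun x => ρ₀ + k * x) k x := by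
      simpa using ((hasDerivAt_id x).const_mul k).const_add ρ₀
    have h3 := h1.prodMk ((h2.sqrt hx.ne').smul_const z)
    have h4 := ((hF.differentiableAt (mem_slab hx' (r x • z))).hasFDerivAt.comp_hasDerivAt x
      h3).const_mul (unitKernel d z)
    rw [fderiv_pair_eq] at h4
    exact h4
  have key := (hasDerivAt_integral_of_dominated_loc_of_deriv_le (μ := volume) (𝕜 := ℝ) (x₀ := σ)
    (F := fun x z => unitKernel d z * F (s₀ + m * x, √(ρ₀ + k * x) • z))
    (F' := fun x z => unitKernel d z * (m * dt F (s₀ + m * x, r x • z) +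
          r' x * ∑ a, z a * dx a F (s₀ + m * x, r x • z)))
    (bound := fun z => (|m| * B₀ + R * ∑ a, B a) * ((1 + ‖z‖) * |unitKernel d z|))
    hN ?_ (hF.integrable_kernelAvg hΓ hs) ?_ ?_ (hΓ.integrable_weight.const_mul _) ?_).2
  · have e : (∫ z, unitKernel d z * (m * dt F (s₀ + m * σ, r σ • z) +
          r' σ * ∑ a, z a * dx a F (s₀ + m * σ, r σ • z))) =
        m * heatAvg (ρ₀ + k * σ) (s₀ + m * σ) (dt F) +
        k * heatAvg (ρ₀ + k * σ) (s₀ + m * σ) (lap F) := by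
      have e1 z : unitKernel d z * (m * dt F (s₀ + m * σ, r σ • z) +
          r' σ * ∑ a, z a * dx a F (s₀ + m * σ, r σ • z)) =
          m * (unitKernel d z * dt F (s₀ + m * σ, √(ρ₀ + k * σ) • z)) + ∑ a, (-2 * r' σ) *
            (coordDeriv a (unitKernel d) z * dx a F (s₀ + m * σ, √(ρ₀ + k * σ) • z)) := by
        simp only [mul_add, Finset.mul_sum]
        congr 1
        · ring
        · refine Finset.sum_congr rfl fun a _ => ?_
          linear_combination (r' σ * dx a F (s₀ + m * σ, √(ρ₀ + k * σ) • z)) *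
            coordDeriv_unitKernel a z
      have i1 := (hF.dirDeriv (1, 0)).integrable_kernelAvg (ρ := ρ₀ + k * σ) hΓ hs
      have i2 a := (hF.dirDeriv (0, EuclideanSpace.single a 1)).integrable_kernelAvg
        (ρ := ρ₀ + k * σ) (hΓ.coordDeriv a) hs
      simp only [e1]
      rw [integral_add (i1.const_mul m) (integrable_finsetSum _ fun a _ => (i2 a).const_mul _),
        integral_finsetSum _ fun a _ => (i2 a).const_mul _, integral_const_mul]
      simp only [integral_const_mul]
      congr 1
      rw [heatAvg, kernelAvg_lap hF hΓ hs, Finset.mul_sum]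
      refine Finset.sum_congr rfl fun a _ => ?_
      have h := kernelAvg_dx (ρ := ρ₀ + k * σ) (hF.dirDeriv (0, EuclideanSpace.single a 1)) hΓ hs a
      have hpos : 0 < √(ρ₀ + k * σ) := Real.sqrt_pos.2 hρ
      rw [← neg_eq_iff_eq_neg] at h
      change -2 * r' σ * kernelAvg (coordDeriv a (unitKernel d)) _ _ _ = _
      rw [← h]
      simp only [hr', hr]
      field_simp
    rw [e] at key
    exact key
  · filter_upwards [hN] with x hx
    exact (hF.integrable_kernelAvg hΓ (hmem hx.2.1)).aestronglyMeasurable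
  · have c1 := ((hF.dirDeriv (1, 0)).continuous_slice hs).comp
      (show Continuous fun z : EuclideanSpace ℝ (Fin d) => r σ • z by fun_prop)
    have c2 a := ((hF.dirDeriv (0, EuclideanSpace.single a 1)).continuous_slice hs).comp
      (show Continuous fun z : EuclideanSpace ℝ (Fin d) => r σ • z by fun_prop)
    simp only [Function.comp_def] at c1 c2
    refine Continuous.aestronglyMeasurable ?_
    fun_prop
  · refine ae_of_all _ fun z x hx => ?_
    have hz := norm_nonneg z
    have b1 : |m * dt F (s₀ + m * x, r x • z)| ≤ |m| * B₀ := by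
      rw [abs_mul]
      gcongr
      exact h₀ _ hx.2.1 _
    have b2 : |∑ a, z a * dx a F (s₀ + m * x, r x • z)| ≤ ‖z‖ * ∑ a, B a := by
      rw [Finset.mul_sum]
      refine (Finset.abs_sum_le_sum_abs _ _).trans (Finset.sum_le_sum fun a _ => ?_)
      rw [abs_mul]
      gcongr
      · exact PiLp.norm_apply_le z a
      · exact hBd a _ hx.2.1 _
    have hBs : 0 ≤ ∑ a, B a := Finset.sum_nonneg fun a _ => hB a
    have b3 : |m * dt F (s₀ + m * x, r x • z) +
        r' x * ∑ a, z a * dx a F (s₀ + m * x, r x • z)| ≤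
          |m| * B₀ + R * (‖z‖ * ∑ a, B a) := by
      refine (abs_add_le _ _).trans (add_le_add b1 ?_)
      rw [abs_mul]
      exact mul_le_mul hx.2.2.le b2 (abs_nonneg _) (by positivity)
    have hR0 : 0 ≤ R := by positivity
    have b4 : |m| * B₀ + R * (‖z‖ * ∑ a, B a) ≤ (|m| * B₀ + R * ∑ a, B a) * (1 + ‖z‖) := by
      have e1 : 0 ≤ |m| * B₀ * ‖z‖ := by positivity
      have e2 : 0 ≤ R * ∑ a, B a := by positivity
      linarith
    rw [Real.norm_eq_abs, abs_mul]
    calc _ ≤ |unitKernel d z| * ((|m| * B₀ + R * ∑ a, B a) * (1 + ‖z‖)) := by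
          gcongr; exact b3.trans b4
      _ = _ := by ring
  · exact ae_of_all _ fun z x hx => hder x hx.1 (hmem hx.2.1) z

end KernelAvg

/-! ### Spatial derivatives of Gaussian averages -/

section Estimates

variable {T ρ s A B : ℝ} {F G : ℝ × EuclideanSpace ℝ (Fin d) → ℝ}

lemma abs_heatAvg_dx_le_div_sqrt (hA : MomentBound d A) (hG : PerSmooth T G) (hs : s ∈ Ioo 0 T)
    (hρ : 0 < ρ) (hB : ∀ y, |G (s, y)| ≤ B) (a : Fin d) :
    |heatAvg ρ s (dx a G)| ≤ B * A / √ρ := by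
  have h := congrArg abs (kernelAvg_dx (ρ := ρ) hG isGaussian_unitKernel hs a)
  have hB0 : 0 ≤ B := (abs_nonneg _).trans (hB 0)
  rw [abs_mul, abs_neg, abs_of_nonneg (Real.sqrt_nonneg _)] at h
  rw [le_div_iff₀' (Real.sqrt_pos.2 hρ), h]
  refine (abs_kernelAvg_le (isGaussian_unitKernel.coordDeriv a) (B := B) fun z => ?_).trans
    (mul_le_mul_of_nonneg_left (hA.one a) hB0)
  nlinarith [hB (√ρ • z), norm_nonneg z]

lemma abs_heatAvg_dx_le (hA : MomentBound d A) (hG : PerSmooth T G) (hs : s ∈ Ioo 0 T)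
    (hρ : 0 < ρ) (hB0 : 0 ≤ B) (hB : ∀ y, |G (s, y)| ≤ B * ‖y‖) (a : Fin d) :
    |heatAvg ρ s (dx a G)| ≤ B * A := by
  have h := congrArg abs (kernelAvg_dx (ρ := ρ) hG isGaussian_unitKernel hs a)
  have hr := Real.sqrt_pos.2 hρ
  rw [abs_mul, abs_neg, abs_of_nonneg (Real.sqrt_nonneg _)] at h
  refine le_of_mul_le_mul_left ?_ hr
  rw [h]
  refine (abs_kernelAvg_le (isGaussian_unitKernel.coordDeriv a) (B := √ρ * B) fun z => ?_).trans
    ((mul_le_mul_of_nonneg_left (hA.one a) (by positivity)).trans_eq (mul_assoc _ _ _))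
  refine (hB _).trans ?_
  rw [norm_smul, Real.norm_of_nonneg hr.le]
  nlinarith [mul_nonneg hr.le hB0]

lemma abs_heatAvg_dx_dx_dx_le (hA : MomentBound d A) (hG : PerSmooth T G) (hs : s ∈ Ioo 0 T)
    (hρ : 0 < ρ) (hB : ∀ y, |G (s, y)| ≤ B) (hB' : ∀ y, |G (s, y)| ≤ B * ‖y‖) (a b c : Fin d) :
    |heatAvg ρ s (dx a (dx b (dx c G)))| ≤ 2 * B * A / (ρ * (1 + √ρ)) := by
  have hΓ := isGaussian_unitKernel (d := d)
  have hB0 : 0 ≤ B := (abs_nonneg _).trans (hB 0)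
  have hA0 := hA.nonneg
  have hr := Real.sqrt_pos.2 hρ
  have h1 := kernelAvg_dx (ρ := ρ) ((hG.dirDeriv (0, EuclideanSpace.single c 1)).dirDeriv
    (0, EuclideanSpace.single b 1)) hΓ hs a
  have h2 := kernelAvg_dx (ρ := ρ) (hG.dirDeriv (0, EuclideanSpace.single c 1))
    (hΓ.coordDeriv a) hs b
  have h3 := kernelAvg_dx (ρ := ρ) hG ((hΓ.coordDeriv a).coordDeriv b) hs c
  have h4 : √ρ ^ 3 * heatAvg ρ s (dx a (dx b (dx c G))) =
      -kernelAvg (coordDeriv c (coordDeriv b (coordDeriv a (unitKernel d)))) ρ s G := by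
    linear_combination √ρ ^ 2 * h1 - √ρ * h2 + h3
  have h5 := congrArg abs h4
  rw [abs_mul, abs_neg, abs_of_nonneg (by positivity)] at h5
  set X := |heatAvg ρ s (dx a (dx b (dx c G)))|
  have hX : 0 ≤ X := abs_nonneg _
  have k1 : √ρ ^ 3 * X ≤ B * A := by
    rw [h5]
    refine (abs_kernelAvg_le (((hΓ.coordDeriv a).coordDeriv b).coordDeriv c) (B := B)
      fun z => ?_).trans (mul_le_mul_of_nonneg_left (hA.three _ _ _) hB0)
    nlinarith [hB (√ρ • z), norm_nonneg z]
  have k2 : √ρ ^ 3 * X ≤ √ρ * B * A := by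
    rw [h5]
    refine (abs_kernelAvg_le (((hΓ.coordDeriv a).coordDeriv b).coordDeriv c) (B := √ρ * B)
      fun z => ?_).trans (mul_le_mul_of_nonneg_left (hA.three _ _ _) (by positivity))
    refine (hB' _).trans ?_
    rw [norm_smul, Real.norm_of_nonneg hr.le]
    nlinarith [mul_nonneg hr.le hB0]
  have hsq : √ρ ^ 2 = ρ := Real.sq_sqrt hρ.le
  have k3 : √ρ ^ 2 * X ≤ B * A := by
    refine le_of_mul_le_mul_left ?_ hr
    linarith
  rw [le_div_iff₀ (by positivity), ← hsq, Real.sqrt_sq hr.le]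
  linarith

lemma kernelAvg_sub_comp_fst_zero (hF : PerSmooth T F) (hs : s ∈ Ioo 0 T) (a : Fin d) :
    heatAvg ρ s (dx a (dx a F)) =
      heatAvg ρ s (dx a (dx a fun q : ℝ × EuclideanSpace ℝ (Fin d) => F q - F (q.1, 0))) := by
  refine kernelAvg_congr (dirDeriv_congr (fun q hq => ?_) _) hs
  have h := hF.dirDeriv_sub hF.comp_fst_zero (0, EuclideanSpace.single a 1) hq
  simp only at h
  have h0 := dx_comp_fst_zero hF a hq
  linarith

lemma abs_heatAvg_lap_le (hA : MomentBound d A) (hF : PerSmooth T F) (hs : s ∈ Ioo 0 T)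
    (hρ : 0 < ρ) (hB0 : 0 ≤ B) (hB : ∀ y, |F (s, y) - F (s, 0)| ≤ B * √‖y‖) :
    |heatAvg ρ s (lap F)| ≤ d * (B * A * √√ρ / ρ) := by
  have hΓ := isGaussian_unitKernel (d := d)
  have hV := hF.sub hF.comp_fst_zero
  rw [heatAvg, kernelAvg_lap hF hΓ hs]
  refine (Finset.abs_sum_le_sum_abs _ _).trans ((Finset.sum_le_card_nsmul _ _
    (B * A * √√ρ / ρ) fun a _ => ?_).trans (by simp))
  change |heatAvg ρ s (dx a (dx a F))| ≤ _
  rw [kernelAvg_sub_comp_fst_zero hF hs]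
  have h1 := kernelAvg_dx (ρ := ρ) (hV.dirDeriv (0, EuclideanSpace.single a 1)) hΓ hs a
  have h2 := kernelAvg_dx (ρ := ρ) hV (hΓ.coordDeriv a) hs a
  rw [le_div_iff₀' hρ]
  set X := heatAvg ρ s (dx a (dx a fun q : ℝ × EuclideanSpace ℝ (Fin d) => F q - F (q.1, 0)))
  have h3 : ρ * X = kernelAvg (coordDeriv a (coordDeriv a (unitKernel d))) ρ s
      fun q : ℝ × EuclideanSpace ℝ (Fin d) => F q - F (q.1, 0) := by
    have hsq := Real.mul_self_sqrt hρ.le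
    linear_combination √ρ * h1 - h2 - X * hsq
  rw [← abs_of_pos hρ, ← abs_mul, abs_of_pos hρ, h3, mul_right_comm]
  refine (abs_kernelAvg_le ((hΓ.coordDeriv a).coordDeriv a) (B := B * √√ρ) fun z => ?_).trans
    (mul_le_mul_of_nonneg_left (hA.two _ _) (by positivity))
  refine (hB _).trans ?_
  rw [norm_smul, Real.norm_of_nonneg (Real.sqrt_nonneg _), Real.sqrt_mul (Real.sqrt_nonneg _),
    ← mul_assoc]
  gcongr
  exact Real.sqrt_le_iff.2 ⟨by positivity, by nlinarith [norm_nonneg z]⟩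

lemma abs_heatAvg_sub_le (hA : MomentBound d A) (hF : PerSmooth T F) (hs : s ∈ Ioo 0 T)
    (hB0 : 0 ≤ B) (hB : ∀ y, |F (s, y) - F (s, 0)| ≤ B * √‖y‖) :
    |heatAvg ρ s F - F (s, 0)| ≤ B * √√ρ * A := by
  have hΓ := isGaussian_unitKernel (d := d)
  have h : heatAvg ρ s F - F (s, 0) =
      heatAvg ρ s fun q : ℝ × EuclideanSpace ℝ (Fin d) => F q - F (q.1, 0) := by
    rw [heatAvg, heatAvg, kernelAvg_sub hF hF.comp_fst_zero hΓ hs]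
    simp only [kernelAvg]
    rw [integral_mul_const, integral_unitKernel, one_mul]
  rw [h]
  refine (abs_kernelAvg_le hΓ (B := B * √√ρ) fun z => ?_).trans
    (mul_le_mul_of_nonneg_left hA.zero (by positivity))
  refine (hB _).trans ?_
  rw [norm_smul, Real.norm_of_nonneg (Real.sqrt_nonneg _), Real.sqrt_mul (Real.sqrt_nonneg _),
    ← mul_assoc]
  gcongr
  exact Real.sqrt_le_iff.2 ⟨by positivity, by nlinarith [norm_nonneg z]⟩

end Estimates

/-! ### Calculus of the Laplacian -/

section Laplacian

variable {T : ℝ} {F G : ℝ × EuclideanSpace ℝ (Fin d) → ℝ}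

lemma lap_congr (h : EqOn F G (slab d T)) : EqOn (lap F) (lap G) (slab d T) := fun _ hq =>
  Finset.sum_congr rfl fun _ _ => dirDeriv_congr (dirDeriv_congr h _) _ hq

lemma PerSmooth.dirDeriv_lap (hF : PerSmooth T F) (v) :
    EqOn (LagrangianRegularity.dirDeriv v (LagrangianRegularity.lap F))
      (LagrangianRegularity.lap (LagrangianRegularity.dirDeriv v F)) (slab d T) := fun _ hq => by
  unfold LagrangianRegularity.lap
  rw [dirDeriv_sum (fun a => (hF.dirDeriv _).dirDeriv _) v hq]
  refine Finset.sum_congr rfl fun _ _ => ?_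
  rw [(hF.dirDeriv _).dirDeriv_comm _ _ hq, dirDeriv_congr (hF.dirDeriv_comm _ _) _ hq]

lemma PerSmooth.lap_sub (hF : PerSmooth T F) (hG : PerSmooth T G) :
    EqOn (LagrangianRegularity.lap fun q => F q - G q)
      (fun q => LagrangianRegularity.lap F q - LagrangianRegularity.lap G q)
      (slab d T) := fun q hq => by
  simp only [LagrangianRegularity.lap, dx, ← Finset.sum_sub_distrib]
  refine Finset.sum_congr rfl fun a _ => ?_
  rw [dirDeriv_congr (hF.dirDeriv_sub hG _) _ hq, (hF.dirDeriv _).dirDeriv_sub (hG.dirDeriv _) _ hq]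

lemma PerSmooth.lap_add (hF : PerSmooth T F) (hG : PerSmooth T G) :
    EqOn (LagrangianRegularity.lap fun q => F q + G q)
      (fun q => LagrangianRegularity.lap F q + LagrangianRegularity.lap G q)
      (slab d T) := fun q hq => by
  simp only [LagrangianRegularity.lap, dx, ← Finset.sum_add_distrib]
  refine Finset.sum_congr rfl fun a _ => ?_
  rw [dirDeriv_congr (hF.dirDeriv_add hG _) _ hq, (hF.dirDeriv _).dirDeriv_add (hG.dirDeriv _) _ hq]

lemma PerSmooth.lap_const_mul (hF : PerSmooth T F) (c : ℝ) :
    EqOn (LagrangianRegularity.lap fun q => c * F q)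
      (fun q => c * LagrangianRegularity.lap F q) (slab d T) := fun q hq => by
  simp only [LagrangianRegularity.lap, dx, Finset.mul_sum]
  refine Finset.sum_congr rfl fun a _ => ?_
  rw [dirDeriv_congr (hF.dirDeriv_const_mul c _) _ hq, (hF.dirDeriv _).dirDeriv_const_mul c _ hq]

lemma PerSmooth.lap_sum {ι : Type*} [Fintype ι] {F : ι → ℝ × EuclideanSpace ℝ (Fin d) → ℝ}
    (hF : ∀ i, PerSmooth T (F i)) :
    EqOn (LagrangianRegularity.lap fun q => ∑ i, F i q)
      (fun q => ∑ i, LagrangianRegularity.lap (F i) q) (slab d T) := fun q hq => by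
  simp only [LagrangianRegularity.lap, dx]
  rw [Finset.sum_comm]
  refine Finset.sum_congr rfl fun a _ => ?_
  rw [dirDeriv_congr (dirDeriv_sum hF _) _ hq, dirDeriv_sum (fun i => (hF i).dirDeriv _) _ hq]

end Laplacian

/-! ### Comparison along straight lines -/

section Comparison

lemma abs_sub_le_of_abs_deriv_le {f f' φ φ' : ℝ → ℝ} {θ : ℝ} (hθ : 0 ≤ θ)
    (hf : ∀ σ ∈ Icc 0 θ, HasDerivAt f (f' σ) σ) (hφ : ∀ σ ∈ Icc 0 θ, HasDerivAt φ (φ' σ) σ)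
    (h : ∀ σ ∈ Icc 0 θ, |f' σ| ≤ φ' σ) : |f θ - f 0| ≤ φ θ - φ 0 := by
  refine image_norm_le_of_norm_deriv_right_le_deriv_boundary' (f := fun σ => f σ - f 0)
    (B := fun σ => φ σ - φ 0) (f' := f') (B' := φ') (a := 0) (b := θ) ?_ ?_ (by simp) ?_ ?_ ?_
    ⟨hθ, le_rfl⟩
  · exact fun σ hσ => ((hf σ hσ).sub_const _).continuousAt.continuousWithinAt
  · exact fun σ hσ => ((hf σ (Ico_subset_Icc_self hσ)).sub_const _).hasDerivWithinAt
  · exact fun σ hσ => ((hφ σ hσ).sub_const _).continuousAt.continuousWithinAt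
  · exact fun σ hσ => ((hφ σ (Ico_subset_Icc_self hσ)).sub_const _).hasDerivWithinAt
  · exact fun σ hσ => h σ (Ico_subset_Icc_self hσ)

/-- The antiderivative of `-1 / (ρ (1 + √ρ))` vanishing at infinity. -/
noncomputable def logBound (ρ : ℝ) : ℝ := 2 * Real.log (1 + (√ρ)⁻¹)

lemma logBound_nonneg (ρ : ℝ) : 0 ≤ logBound ρ := by
  have h : 0 ≤ (√ρ)⁻¹ := by positivity
  exact mul_nonneg zero_le_two (Real.log_nonneg (by linarith))

lemma hasDerivAt_logBound {ρ : ℝ} (hρ : 0 < ρ) :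
    HasDerivAt logBound (-(1 / (ρ * (1 + √ρ)))) ρ := by
  have hr := Real.sqrt_pos.2 hρ
  have h : HasDerivAt (fun ρ => 1 + (√ρ)⁻¹) (-(1 / (2 * √ρ)) / √ρ ^ 2) ρ :=
    ((Real.hasDerivAt_sqrt hρ.ne').inv hr.ne').const_add 1
  refine ((h.log (by positivity)).const_mul 2).congr_deriv ?_
  have hsq := Real.sq_sqrt hρ.le
  set r := √ρ
  rw [← hsq]
  field_simp
  ring

lemma hasDerivAt_logBound_line {ρ k σ : ℝ} (K : ℝ) (hk : k ≠ 0) (hρ : 0 < ρ + k * σ) :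
    HasDerivAt (fun σ => -(K / k * logBound (ρ + k * σ)))
      (K / ((ρ + k * σ) * (1 + √(ρ + k * σ)))) σ := by
  have h1 : HasDerivAt (fun x => ρ + k * x) k σ := by
    simpa using ((hasDerivAt_id σ).const_mul k).const_add ρ
  refine (((hasDerivAt_logBound hρ).comp σ h1).const_mul (K / k)).neg.congr_deriv ?_
  have : 0 < √(ρ + k * σ) := Real.sqrt_pos.2 hρ
  field_simp

variable {T ρ s K : ℝ} {F : ℝ × EuclideanSpace ℝ (Fin d) → ℝ}

lemma abs_heatAvg_dx_le_logBound {A : ℝ} (hA : MomentBound d A) (hF : PerSmooth T F)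
    (hs : s ∈ Ioo 0 T) (a : Fin d) (hK : 0 ≤ K)
    (h : ∀ ρ, 0 < ρ → |heatAvg ρ s (lap (dx a F))| ≤ K / (ρ * (1 + √ρ))) (hρ : 0 < ρ) :
    |heatAvg ρ s (dx a F)| ≤ K * logBound ρ := by
  obtain ⟨B, -, hB⟩ := hF.exists_bound_slice hs
  have key : ∀ᶠ R in atTop,
      |heatAvg ρ s (dx a F)| ≤ B * A * (√(ρ + R))⁻¹ + K * logBound ρ := by
    filter_upwards [eventually_ge_atTop 0] with R hR
    have hpos {σ} (hσ : σ ∈ Icc 0 R) : 0 < ρ + 1 * σ := by linarith [hσ.1]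
    have h1 := abs_sub_le_of_abs_deriv_le hR
      (fun σ hσ => hasDerivAt_heatAvg (hF.dirDeriv (0, EuclideanSpace.single a 1)) (m := 0)
        (s₀ := s) (hpos hσ) (by simpa using hs))
      (fun σ hσ => hasDerivAt_logBound_line K one_ne_zero (hpos hσ))
      (fun σ hσ => by simpa using h _ (hpos hσ))
    have h2 := abs_heatAvg_dx_le_div_sqrt hA hF hs (by linarith : 0 < ρ + R) hB a
    simp only [zero_mul, add_zero, one_mul, mul_zero, div_one] at h1
    have h3 := mul_nonneg hK (logBound_nonneg (ρ + R))
    rw [div_eq_mul_inv] at h2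
    change |heatAvg (ρ + R) s (dx a F) - heatAvg ρ s (dx a F)| ≤ _ at h1
    have h4 := abs_sub_abs_le_abs_sub (heatAvg ρ s (dx a F)) (heatAvg (ρ + R) s (dx a F))
    rw [abs_sub_comm] at h4
    linarith
  have hlim : Tendsto (fun R => B * A * (√(ρ + R))⁻¹ + K * logBound ρ) atTop
      (𝓝 (B * A * 0 + K * logBound ρ)) :=
    ((tendsto_inv_atTop_zero.comp (Real.tendsto_sqrt_atTop.comp
      (tendsto_atTop_add_const_left _ ρ tendsto_id))).const_mul _).add_const _
  simpa using ge_of_tendsto hlim key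

lemma abs_heatAvg_le_add_logBound {k θ : ℝ} (hF : PerSmooth T F) (hk : 0 < k) (hρ : 0 < ρ)
    (hK : 0 ≤ K) (hθ : 0 ≤ θ) (hs : s < T) (hθs : θ < s)
    (h : ∀ σ ∈ Icc 0 θ, |-heatAvg (ρ + k * σ) (s - σ) (dt F)
      + k * heatAvg (ρ + k * σ) (s - σ) (lap F)| ≤ K / ((ρ + k * σ) * (1 + √(ρ + k * σ)))) :
    |heatAvg ρ s F| ≤ |heatAvg (ρ + k * θ) (s - θ) F| + K / k * logBound ρ := by
  have hpos {σ} (hσ : σ ∈ Icc 0 θ) : 0 < ρ + k * σ := by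
    have := mul_nonneg hk.le hσ.1
    linarith
  have h1 := abs_sub_le_of_abs_deriv_le hθ
    (fun σ hσ => hasDerivAt_heatAvg hF (m := -1) (s₀ := s) (hpos hσ)
      ⟨by linarith [hσ.2], by linarith [hσ.1]⟩)
    (fun σ hσ => hasDerivAt_logBound_line K hk.ne' (hpos hσ))
    (fun σ hσ => by simpa [← sub_eq_add_neg] using h σ hσ)
  simp only [neg_mul, one_mul, ← sub_eq_add_neg, mul_zero, add_zero] at h1
  have h3 := mul_nonneg (div_nonneg hK hk.le) (logBound_nonneg (ρ + k * θ))
  have h4 := abs_sub_abs_le_abs_sub (heatAvg ρ s F) (heatAvg (ρ + k * θ) (s - θ) F)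
  rw [abs_sub_comm] at h4
  linarith

end Comparison

/-! ### The flow in a frame moving with a particle -/

/-- A periodic Navier–Stokes flow with velocity `W` and pressure `Q`, written in the frame moving
with the particle at the origin, whose velocity is `1/2`-Hölder at that particle. -/
structure Flow (d : ℕ) (T ν M : ℝ) (W : Fin d → ℝ × EuclideanSpace ℝ (Fin d) → ℝ)
    (Q : ℝ × EuclideanSpace ℝ (Fin d) → ℝ) : Prop where
  one_le : 1 ≤ d
  nonneg : 0 ≤ M
  velocity i : PerSmooth T (W i)
  pressure : PerSmooth T Q
  momentum i : ∀ q ∈ slab d T,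
    dt (W i) q + ∑ j, (W j q - W j (q.1, 0)) * dx j (W i) q + dx i Q q = ν * lap (W i) q
  incompressible : ∀ q ∈ slab d T, ∑ i, dx i (W i) q = 0
  holder i : ∀ s ∈ Ioo 0 T, ∀ y, |W i (s, y) - W i (s, 0)| ≤ M * √‖y‖

section Flow

variable {T ν M A ρ s : ℝ} {W : Fin d → ℝ × EuclideanSpace ℝ (Fin d) → ℝ}
  {Q : ℝ × EuclideanSpace ℝ (Fin d) → ℝ}

/-- The velocity fluctuation tensor `(W - W(·, 0)) ⊗ (W - W(·, 0))`. -/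
def stress (W : Fin d → ℝ × EuclideanSpace ℝ (Fin d) → ℝ) (i j : Fin d) :
    ℝ × EuclideanSpace ℝ (Fin d) → ℝ :=
  fun q => (W i q - W i (q.1, 0)) * (W j q - W j (q.1, 0))

namespace Flow

lemma perSmooth_stress (h : Flow d T ν M W Q) (i j : Fin d) : PerSmooth T (stress W i j) :=
  ((h.velocity i).sub (h.velocity i).comp_fst_zero).mul
    ((h.velocity j).sub (h.velocity j).comp_fst_zero)

lemma perSmooth_div (h : Flow d T ν M W Q) (i : Fin d) :
    PerSmooth T fun q => ∑ j, dx j (stress W i j) q :=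
  PerSmooth.sum fun j => (h.perSmooth_stress i j).dirDeriv _

lemma abs_stress_le_mul_norm (h : Flow d T ν M W Q) (hs : s ∈ Ioo 0 T) (i j : Fin d)
    (y : EuclideanSpace ℝ (Fin d)) : |stress W i j (s, y)| ≤ M ^ 2 * ‖y‖ := by
  have hM := h.nonneg
  simp only [stress, abs_mul]
  refine (mul_le_mul (h.holder i s hs y) (h.holder j s hs y) (abs_nonneg _)
    (by positivity)).trans_eq ?_
  rw [mul_mul_mul_comm, Real.mul_self_sqrt (norm_nonneg _), sq]

lemma abs_stress_le (h : Flow d T ν M W Q) (hs : s ∈ Ioo 0 T) (i j : Fin d)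
    (y : EuclideanSpace ℝ (Fin d)) : |stress W i j (s, y)| ≤ M ^ 2 * d := by
  obtain ⟨n, hn⟩ := exists_norm_add_latticeVec_le y
  have hp := (h.perSmooth_stress i j).periodic n (s, y)
  rw [Prod.mk_add_mk, add_zero] at hp
  rw [← hp]
  exact (h.abs_stress_le_mul_norm hs i j _).trans (by gcongr)

lemma abs_stress_le_mul_norm' (h : Flow d T ν M W Q) (hs : s ∈ Ioo 0 T) (i j : Fin d)
    (y : EuclideanSpace ℝ (Fin d)) : |stress W i j (s, y)| ≤ M ^ 2 * d * ‖y‖ := by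
  refine (h.abs_stress_le_mul_norm hs i j y).trans ?_
  have h1 : (1 : ℝ) ≤ d := by exact_mod_cast h.one_le
  have h2 : 0 ≤ M ^ 2 * ‖y‖ := by positivity
  nlinarith

lemma dx_sub_comp_fst_zero {F : ℝ × EuclideanSpace ℝ (Fin d) → ℝ} (hF : PerSmooth T F)
    (a : Fin d) {q} (hq : q ∈ slab d T) :
    dx a (fun q => F q - F (q.1, 0)) q = dx a F q := by
  have h1 := hF.dirDeriv_sub hF.comp_fst_zero (0, EuclideanSpace.single a 1) hq
  have h2 := dx_comp_fst_zero hF a hq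
  simp only at h1 h2
  linarith

lemma sum_dx_stress (h : Flow d T ν M W Q) (i : Fin d) {q} (hq : q ∈ slab d T) :
    ∑ j, dx j (stress W i j) q = ∑ j, (W j q - W j (q.1, 0)) * dx j (W i) q := by
  have h1 j : dx j (stress W i j) q =
      (W i q - W i (q.1, 0)) * dx j (W j) q + (W j q - W j (q.1, 0)) * dx j (W i) q := by
    rw [← dx_sub_comp_fst_zero (h.velocity j) j hq, ← dx_sub_comp_fst_zero (h.velocity i) j hq]
    exact ((h.velocity i).sub (h.velocity i).comp_fst_zero).dirDeriv_mul
      ((h.velocity j).sub (h.velocity j).comp_fst_zero) _ hq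
  simp only [h1, Finset.sum_add_distrib, ← Finset.mul_sum, h.incompressible q hq, mul_zero, zero_add]

lemma momentum_stress (h : Flow d T ν M W Q) (i : Fin d) :
    EqOn (fun q => ν * lap (W i) q - dt (W i) q)
      (fun q => ∑ j, dx j (stress W i j) q + dx i Q q) (slab d T) := fun q hq => by
  have := h.momentum i q hq
  simp only [h.sum_dx_stress i hq]
  linarith

lemma lap_pressure (h : Flow d T ν M W Q) :
    EqOn (lap Q) (fun q => (-1) * ∑ i, ∑ j, dx i (dx j (stress W i j)) q) (slab d T) :=
  fun q hq => by
  have hW := h.velocity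
  have e i : ν * dx i (lap (W i)) q - dx i (dt (W i)) q =
      ∑ j, dx i (dx j (stress W i j)) q + dx i (dx i Q) q := by
    have h1 := dirDeriv_congr (h.momentum_stress i) (0, EuclideanSpace.single i 1) hq
    rw [((hW i).lap.const_mul ν).dirDeriv_sub ((hW i).dirDeriv _) _ hq,
      (h.perSmooth_div i).dirDeriv_add (h.pressure.dirDeriv _) _ hq] at h1
    simp only at h1
    rw [(hW i).lap.dirDeriv_const_mul _ _ hq,
      PerSmooth.dirDeriv_sum (fun j => (h.perSmooth_stress i j).dirDeriv _) _ hq] at h1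
    exact h1
  have hdiv : EqOn (fun q => ∑ i, dx i (W i) q) (fun _ => 0) (slab d T) := h.incompressible
  have hD i : PerSmooth T (dx i (W i)) := (hW i).dirDeriv _
  have e1 : ∑ i, dx i (lap (W i)) q = 0 := by
    have h2 := lap_congr hdiv hq
    rw [PerSmooth.lap_sum hD hq] at h2
    simp only [lap, dx, dirDeriv_zero, Finset.sum_const_zero] at h2
    rw [← h2]
    exact Finset.sum_congr rfl fun i _ => (hW i).dirDeriv_lap _ hq
  have e2 : ∑ i, dx i (dt (W i)) q = 0 := by
    have h2 := dirDeriv_congr hdiv (1, 0) hq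
    rw [PerSmooth.dirDeriv_sum hD _ hq, dirDeriv_zero] at h2
    refine Eq.trans ?_ h2
    exact Finset.sum_congr rfl fun i _ => (hW i).dirDeriv_comm _ _ hq
  have e3 := Finset.sum_congr (rfl : Finset.univ = Finset.univ) fun i _ => e i
  rw [Finset.sum_sub_distrib, Finset.sum_add_distrib, ← Finset.mul_sum, e1, e2] at e3
  simp only [lap]
  linarith

lemma sqrt_sqrt_pow_four {x : ℝ} (hx : 0 ≤ x) : √√x ^ 4 = x := by
  rw [show 4 = 2 * 2 from rfl, pow_mul, Real.sq_sqrt (Real.sqrt_nonneg _), Real.sq_sqrt hx]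

lemma sqrt_sqrt_div_self {x : ℝ} (hx : 0 < x) : √√x / x = ((√√x) ^ 3)⁻¹ := by
  have hr : 0 < √√x := by positivity
  have h4 : √√x ^ 4 = x := sqrt_sqrt_pow_four hx.le
  rw [div_eq_iff hx.ne']
  nth_rw 3 [← h4]
  field_simp

lemma abs_sum_le_card_mul {f : Fin d → ℝ} {X : ℝ} (h : ∀ i, |f i| ≤ X) : |∑ i, f i| ≤ d * X :=
  (Finset.abs_sum_le_sum_abs _ _).trans
    ((Finset.sum_le_card_nsmul _ _ X fun i _ => h i).trans_eq (by simp))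

lemma abs_heatAvg_dx_dx_dx_stress_le (h : Flow d T ν M W Q) (hA : MomentBound d A)
    (hs : s ∈ Ioo 0 T) (hρ : 0 < ρ) (a b c i j : Fin d) :
    |heatAvg ρ s (dx a (dx b (dx c (stress W i j))))| ≤ 2 * (M ^ 2 * d) * A / (ρ * (1 + √ρ)) :=
  abs_heatAvg_dx_dx_dx_le hA (h.perSmooth_stress i j) hs hρ (h.abs_stress_le hs i j)
    (h.abs_stress_le_mul_norm' hs i j) a b c

lemma abs_heatAvg_lap_div_le (h : Flow d T ν M W Q) (hA : MomentBound d A)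
    (hs : s ∈ Ioo 0 T) (hρ : 0 < ρ) (i : Fin d) :
    |heatAvg ρ s (lap fun q => ∑ j, dx j (stress W i j) q)| ≤
      2 * d ^ 3 * M ^ 2 * A / (ρ * (1 + √ρ)) := by
  have hΓ := isGaussian_unitKernel (d := d)
  have hg j : PerSmooth T (dx j (stress W i j)) := (h.perSmooth_stress i j).dirDeriv _
  have e : heatAvg ρ s (lap fun q => ∑ j, dx j (stress W i j) q) =
      ∑ j, ∑ a, heatAvg ρ s (dx a (dx a (dx j (stress W i j)))) := by
    rw [heatAvg, kernelAvg_congr (PerSmooth.lap_sum hg) hs,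
      kernelAvg_sum (fun j => (hg j).lap) hΓ hs]
    exact Finset.sum_congr rfl fun j _ => kernelAvg_lap (hg j) hΓ hs
  rw [e]
  refine (abs_sum_le_card_mul fun j => abs_sum_le_card_mul fun a =>
    h.abs_heatAvg_dx_dx_dx_stress_le hA hs hρ a a j i j).trans_eq ?_
  ring

lemma abs_heatAvg_lap_dx_pressure_le (h : Flow d T ν M W Q) (hA : MomentBound d A)
    (hs : s ∈ Ioo 0 T) (hρ : 0 < ρ) (a : Fin d) :
    |heatAvg ρ s (lap (dx a Q))| ≤ 2 * d ^ 3 * M ^ 2 * A / (ρ * (1 + √ρ)) := by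
  have hΓ := isGaussian_unitKernel (d := d)
  have hg i j : PerSmooth T (dx i (dx j (stress W i j))) :=
    ((h.perSmooth_stress i j).dirDeriv _).dirDeriv _
  have hS i : PerSmooth T fun q => ∑ j, dx i (dx j (stress W i j)) q := PerSmooth.sum (hg i)
  have e1 : EqOn (lap (dx a Q))
      (fun q => (-1) * ∑ i, ∑ j, dx a (dx i (dx j (stress W i j))) q) (slab d T) := fun q hq => by
    have h1 := dirDeriv_congr h.lap_pressure (0, EuclideanSpace.single a 1) hq
    rw [h.pressure.dirDeriv_lap _ hq, (PerSmooth.sum hS).dirDeriv_const_mul _ _ hq] at h1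
    simp only at h1
    rw [PerSmooth.dirDeriv_sum hS _ hq] at h1
    refine h1.trans (congrArg _ (Finset.sum_congr rfl fun i _ => ?_))
    exact PerSmooth.dirDeriv_sum (hg i) _ hq
  have hg' i j : PerSmooth T (dx a (dx i (dx j (stress W i j)))) := (hg i j).dirDeriv _
  have e : heatAvg ρ s (lap (dx a Q)) =
      -∑ i, ∑ j, heatAvg ρ s (dx a (dx i (dx j (stress W i j)))) := by
    rw [heatAvg, kernelAvg_congr e1 hs, kernelAvg_const_mul,
      kernelAvg_sum (fun i => PerSmooth.sum (hg' i)) hΓ hs, neg_one_mul]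
    exact congrArg _ (Finset.sum_congr rfl fun i _ => kernelAvg_sum (hg' i) hΓ hs)
  rw [e, abs_neg]
  refine (abs_sum_le_card_mul fun i => abs_sum_le_card_mul fun j =>
    h.abs_heatAvg_dx_dx_dx_stress_le hA hs hρ a i j i j).trans_eq ?_
  ring

lemma abs_heatAvg_dx_pressure_le (h : Flow d T ν M W Q) (hA : MomentBound d A)
    (hs : s ∈ Ioo 0 T) (hρ : 0 < ρ) (a : Fin d) :
    |heatAvg ρ s (dx a Q)| ≤ 2 * d ^ 3 * M ^ 2 * A * logBound ρ :=
  abs_heatAvg_dx_le_logBound hA h.pressure hs a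
    (mul_nonneg (by positivity) hA.nonneg)
    (fun _ hρ => h.abs_heatAvg_lap_dx_pressure_le hA hs hρ a) hρ

lemma abs_heatAvg_div_le (h : Flow d T ν M W Q) (hA : MomentBound d A)
    (hs : s ∈ Ioo 0 T) (hρ : 0 < ρ) (i : Fin d) :
    |heatAvg ρ s (fun q => ∑ j, dx j (stress W i j) q)| ≤ d * (M ^ 2 * A) := by
  rw [heatAvg, kernelAvg_sum (fun j => (h.perSmooth_stress i j).dirDeriv _)
    isGaussian_unitKernel hs]
  exact abs_sum_le_card_mul fun j => abs_heatAvg_dx_le hA (h.perSmooth_stress i j) hs hρ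
    (by positivity) (h.abs_stress_le_mul_norm hs i j) j

lemma abs_heatAvg_lap_velocity_le (h : Flow d T ν M W Q) (hν : 0 < ν) (hA : MomentBound d A)
    (hρ : 0 < ρ) {θ : ℝ} (hθ : 0 < θ) (hθs : θ < s) (hs : s < T) (i : Fin d) :
    ν * |heatAvg ρ s (lap (W i))| ≤
      d * M * A * (ν * ((√√(ν * θ)) ^ 3)⁻¹) + 4 * d ^ 3 * M ^ 2 * A * logBound ρ := by
  have hΓ := isGaussian_unitKernel (d := d)
  have hA0 := hA.nonneg
  have hM := h.nonneg
  have hW := h.velocity i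
  have e : EqOn (fun q => ν * lap (lap (W i)) q - dt (lap (W i)) q)
      (fun q => lap (fun q => ∑ j, dx j (stress W i j) q) q + lap (dx i Q) q) (slab d T) :=
    fun q hq => by
      have h1 := lap_congr (h.momentum_stress i) hq
      rw [(hW.lap.const_mul ν).lap_sub (hW.dirDeriv _) hq,
        (h.perSmooth_div i).lap_add (h.pressure.dirDeriv _) hq] at h1
      simp only at h1 ⊢
      rw [hW.lap.lap_const_mul _ hq, ← hW.dirDeriv_lap _ hq] at h1
      exact h1
  have h1 := abs_heatAvg_le_add_logBound (K := 4 * d ^ 3 * M ^ 2 * A) hW.lap hν hρ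
    (by positivity) hθ.le hs hθs fun σ hσ => by
      have hs' : s - σ ∈ Ioo 0 T := ⟨by linarith [hσ.2], by linarith [hσ.1]⟩
      have hρ' : 0 < ρ + ν * σ := by
        have := mul_nonneg hν.le hσ.1
        linarith
      have h2 := kernelAvg_congr (K := unitKernel d) (ρ := ρ + ν * σ) e hs'
      rw [kernelAvg_sub (hW.lap.lap.const_mul ν) (hW.lap.dirDeriv _) hΓ hs', kernelAvg_const_mul,
        kernelAvg_add (h.perSmooth_div i).lap (h.pressure.dirDeriv _).lap hΓ hs'] at h2
      rw [neg_add_eq_sub, heatAvg, heatAvg, h2]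
      refine (abs_add_le _ _).trans ((add_le_add (h.abs_heatAvg_lap_div_le hA hs' hρ' i)
        (h.abs_heatAvg_lap_dx_pressure_le hA hs' hρ' i)).trans_eq ?_)
      ring
  have hpos : 0 < ν * θ := by positivity
  have h3 := abs_heatAvg_lap_le hA hW ⟨by linarith, by linarith⟩
    (by positivity : 0 < ρ + ν * θ) hM (h.holder i (s - θ) ⟨by linarith, by linarith⟩)
  have h4 : √√(ρ + ν * θ) / (ρ + ν * θ) ≤ √√(ν * θ) / (ν * θ) := by
    rw [sqrt_sqrt_div_self hpos, sqrt_sqrt_div_self (by positivity)]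
    gcongr
    linarith
  calc _ ≤ ν * (d * (M * A * √√(ρ + ν * θ) / (ρ + ν * θ)) +
        4 * d ^ 3 * M ^ 2 * A / ν * logBound ρ) := by gcongr; linarith
    _ = d * M * A * (ν * (√√(ρ + ν * θ) / (ρ + ν * θ))) + 4 * d ^ 3 * M ^ 2 * A * logBound ρ := by
      field_simp
    _ ≤ _ := by
      rw [← sqrt_sqrt_div_self hpos]
      gcongr

lemma pow_three_mul_inv_le {a κ x : ℝ} (ha : 0 < a) (hκ : 0 < κ) (hx : a * κ ^ 4 / 2 ≤ x) :
    κ ^ 3 * ((√√x) ^ 3)⁻¹ ≤ 2 * (a⁻¹ + 1) := by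
  have hx0 : 0 < x := lt_of_lt_of_le (by positivity) hx
  have hr : 0 < √√x := by positivity
  have h4 : √√x ^ 4 = x := sqrt_sqrt_pow_four hx0.le
  set r := √√x
  have hw : 0 ≤ κ / r := by positivity
  have h1 : (κ / r) ^ 4 ≤ 2 * a⁻¹ := by
    rw [div_pow, h4, div_le_iff₀ hx0]
    calc κ ^ 4 = 2 * a⁻¹ * (a * κ ^ 4 / 2) := by field_simp
      _ ≤ _ := by gcongr
  have h2 : (κ / r) ^ 3 ≤ 1 + (κ / r) ^ 4 := by
    set w := κ / r
    rcases le_total w 1 with h | h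
    · have := pow_le_one₀ (n := 3) hw h
      have : 0 ≤ w ^ 4 := by positivity
      linarith
    · have := pow_le_pow_right₀ h (show 3 ≤ 4 by norm_num)
      linarith
  rw [← div_eq_mul_inv, ← div_pow]
  linarith

lemma abs_heatAvg_dt_velocity_le (h : Flow d T ν M W Q) (hν : 0 < ν) (hA : MomentBound d A)
    (hρ : 0 < ρ) (hs : s ∈ Ioo 0 T) {a κ : ℝ} (ha : 0 < a) (hκ : 0 < κ) (hκν : κ ^ 3 * M = ν)
    (hsa : a * κ ^ 4 ≤ ν * s) (i : Fin d) :
    |heatAvg ρ s (dt (W i))| ≤ 6 * d ^ 3 * A * (a⁻¹ + 1) * M ^ 2 * (1 + logBound ρ) := by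
  have hΓ := isGaussian_unitKernel (d := d)
  have hA0 := hA.nonneg
  have hM := h.nonneg
  have hW := h.velocity i
  have hb := logBound_nonneg ρ
  have hd : (1 : ℝ) ≤ d := by exact_mod_cast h.one_le
  have e := kernelAvg_congr (K := unitKernel d) (ρ := ρ) (h.momentum_stress i) hs
  rw [kernelAvg_sub (hW.lap.const_mul ν) (hW.dirDeriv _) hΓ hs, kernelAvg_const_mul,
    kernelAvg_add (h.perSmooth_div i) (h.pressure.dirDeriv _) hΓ hs] at e
  have e' : heatAvg ρ s (dt (W i)) = ν * heatAvg ρ s (lap (W i)) -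
      heatAvg ρ s (fun q => ∑ j, dx j (stress W i j) q) - heatAvg ρ s (dx i Q) := by
    simp only [heatAvg]
    linarith
  have h1 := h.abs_heatAvg_lap_velocity_le hν hA hρ (half_pos hs.1) (half_lt_self hs.1) hs.2 i
  have h2 := h.abs_heatAvg_div_le hA hs hρ i
  have h3 := h.abs_heatAvg_dx_pressure_le hA hs hρ i
  have h4 : ν * ((√√(ν * (s / 2))) ^ 3)⁻¹ ≤ M * (2 * (a⁻¹ + 1)) := by
    have := pow_three_mul_inv_le ha hκ (x := ν * (s / 2)) (by linarith)
    calc _ = M * (κ ^ 3 * ((√√(ν * (s / 2))) ^ 3)⁻¹) := by rw [← hκν]; ring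
      _ ≤ _ := by gcongr
  have h5 : d * M * A * (ν * ((√√(ν * (s / 2))) ^ 3)⁻¹) ≤ d * M * A * (M * (2 * (a⁻¹ + 1))) := by
    gcongr
  have h6 : |heatAvg ρ s (dt (W i))| ≤ ν * |heatAvg ρ s (lap (W i))| +
      |heatAvg ρ s (fun q => ∑ j, dx j (stress W i j) q)| + |heatAvg ρ s (dx i Q)| := by
    rw [e', ← abs_of_pos hν, ← abs_mul, abs_of_pos hν]
    exact (abs_sub _ _).trans (add_le_add_left (abs_sub _ _) _)
  have hd3 : (d : ℝ) ≤ d ^ 3 := le_self_pow₀ hd (by norm_num)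
  have hai : 0 < a⁻¹ := by positivity
  calc _ ≤ 2 * d * (A * M ^ 2 * (a⁻¹ + 1)) + d * (A * M ^ 2) * 1
        + 6 * d ^ 3 * (A * M ^ 2) * 1 * logBound ρ := by linarith
    _ ≤ 2 * d ^ 3 * (A * M ^ 2 * (a⁻¹ + 1)) + d ^ 3 * (A * M ^ 2) * (a⁻¹ + 1)
        + 6 * d ^ 3 * (A * M ^ 2) * (a⁻¹ + 1) * logBound ρ := by
      gcongr <;> linarith
    _ ≤ _ := by
      have : 0 ≤ d ^ 3 * (A * M ^ 2) * (a⁻¹ + 1) := by positivity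
      linarith

lemma one_add_logBound_pow_four_le {x : ℝ} (hx : 0 < x) :
    1 + logBound (x ^ 4) ≤ 4 * (1 - min (Real.log x) 0) := by
  have h2 : Real.log 2 ≤ 1 := by
    have := Real.log_two_lt_d9
    linarith
  have hs : √(x ^ 4) = x ^ 2 := by
    rw [show x ^ 4 = (x ^ 2) ^ 2 by ring]
    exact Real.sqrt_sq (by positivity)
  rw [logBound, hs]
  rcases le_total 1 x with h | h
  · rw [min_eq_right (Real.log_nonneg h)]
    have h1 : (x ^ 2)⁻¹ ≤ 1 := inv_le_one_of_one_le₀ (one_le_pow₀ h)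
    have := Real.log_le_log (by positivity) (by linarith : 1 + (x ^ 2)⁻¹ ≤ 2)
    linarith
  · rw [min_eq_left (Real.log_nonpos hx.le h)]
    have h1 : 1 ≤ (x ^ 2)⁻¹ := (one_le_inv₀ (by positivity)).2 (pow_le_one₀ hx.le h)
    have h3 := Real.log_le_log (by positivity) (by linarith : 1 + (x ^ 2)⁻¹ ≤ 2 * (x ^ 2)⁻¹)
    rw [Real.log_mul two_ne_zero (by positivity), Real.log_inv, Real.log_pow] at h3
    push_cast at h3
    linarith

/-- The velocity of the tracked particle is log-Lipschitz in time. -/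
lemma abs_velocity_sub_le (h : Flow d T ν M W Q) (hν : 0 < ν) (hM : 0 < M)
    (hA : MomentBound d A) {a κ : ℝ} (ha : 0 < a) (hκ : 0 < κ) (hκν : κ ^ 3 * M = ν)
    {t₁ t₂ : ℝ} (ht₁ : 0 < t₁) (hlt : t₁ < t₂) (ht₂ : t₂ < T) (hsa : a * κ ^ 4 ≤ ν * t₁)
    (i : Fin d) :
    |W i (t₁, 0) - W i (t₂, 0)| ≤ 32 * d ^ 3 * A * (a⁻¹ + 1) * M ^ 2 * (t₂ - t₁) *
      (1 - min (Real.log (M * (t₂ - t₁))) 0) := by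
  have hA0 := hA.nonneg
  have hd : (1 : ℝ) ≤ d := by exact_mod_cast h.one_le
  have hai : 0 < a⁻¹ := by positivity
  obtain ⟨τ, hτ⟩ : ∃ τ, τ = t₂ - t₁ := ⟨_, rfl⟩
  have hτ0 : 0 < τ := by linarith
  rw [← hτ]
  have hx : 0 < M * τ := by positivity
  set ρ := (M * τ) ^ 4 with hρdef
  have hρ : 0 < ρ := by positivity
  have hsq : √√ρ = M * τ := by
    rw [hρdef, show (M * τ) ^ 4 = ((M * τ) ^ 2) ^ 2 by ring, Real.sqrt_sq (by positivity),
      Real.sqrt_sq hx.le]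
  set X := 6 * d ^ 3 * A * (a⁻¹ + 1) * M ^ 2 * (1 + logBound ρ) with hX
  have hmem {σ : ℝ} (hσ : σ ∈ Icc 0 τ) : t₁ + 1 * σ ∈ Ioo 0 T :=
    ⟨by linarith [hσ.1], by linarith [hσ.2]⟩
  have h1 := abs_sub_le_of_abs_deriv_le hτ0.le
    (fun σ hσ => hasDerivAt_heatAvg (h.velocity i) (ρ₀ := ρ) (k := 0) (by simpa using hρ) (hmem hσ))
    (fun σ _ => hasDerivAt_mul_const (x := σ) X)
    (fun σ hσ => by
      have hs : a * κ ^ 4 ≤ ν * (t₁ + 1 * σ) := by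
        have := mul_nonneg hν.le hσ.1
        linarith
      simpa using h.abs_heatAvg_dt_velocity_le hν hA hρ (hmem hσ) ha hκ hκν hs i)
  simp only [zero_mul, add_zero, one_mul, mul_zero, sub_zero] at h1
  rw [show t₁ + τ = t₂ by linarith] at h1
  have hm₁ : t₁ ∈ Ioo 0 T := ⟨ht₁, hlt.trans ht₂⟩
  have hm₂ : t₂ ∈ Ioo 0 T := ⟨ht₁.trans hlt, ht₂⟩
  have h2 := abs_heatAvg_sub_le (ρ := ρ) hA (h.velocity i) hm₁ hM.le (h.holder i t₁ hm₁)
  have h3 := abs_heatAvg_sub_le (ρ := ρ) hA (h.velocity i) hm₂ hM.le (h.holder i t₂ hm₂)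
  rw [hsq] at h2 h3
  have h4 : |W i (t₁, 0) - W i (t₂, 0)| ≤ 2 * (A * M ^ 2 * τ) + τ * X := by
    rw [abs_le] at h1 h2 h3 ⊢
    constructor <;> linarith
  have h5 := one_add_logBound_pow_four_le hx
  have hb := logBound_nonneg ρ
  have hd3 : (1 : ℝ) ≤ d ^ 3 := one_le_pow₀ hd
  have hY : 0 ≤ A * M ^ 2 * τ := by positivity
  have h6 : 1 ≤ d ^ 3 * (a⁻¹ + 1) * (1 + logBound ρ) :=
    one_le_mul_of_one_le_of_one_le (one_le_mul_of_one_le_of_one_le hd3 (by linarith)) (by linarith)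
  calc _ ≤ 2 * (A * M ^ 2 * τ) * 1 + τ * X := by linarith
    _ ≤ 2 * (A * M ^ 2 * τ) * (d ^ 3 * (a⁻¹ + 1) * (1 + logBound ρ)) + τ * X := by gcongr
    _ = 8 * d ^ 3 * A * (a⁻¹ + 1) * M ^ 2 * τ * (1 + logBound ρ) := by rw [hX]; ring
    _ ≤ 8 * d ^ 3 * A * (a⁻¹ + 1) * M ^ 2 * τ * (4 * (1 - min (Real.log (M * τ)) 0)) := by gcongr
    _ = _ := by ring

end Flow

end Flow

/-! ### The moving frame -/

section MovingFrame

variable {T : ℝ} {F : ℝ × EuclideanSpace ℝ (Fin d) → ℝ} {x v : ℝ → EuclideanSpace ℝ (Fin d)}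
  {q : ℝ × EuclideanSpace ℝ (Fin d)}

/-- The passage from the frame moving along the curve `x` to the laboratory frame. -/
def frame (x : ℝ → EuclideanSpace ℝ (Fin d)) (q : ℝ × EuclideanSpace ℝ (Fin d)) :
    ℝ × EuclideanSpace ℝ (Fin d) := (q.1, x q.1 + q.2)

lemma frame_mem (hq : q ∈ slab d T) : frame x q ∈ slab d T := mem_slab hq.1 _

lemma PerSmooth.comp_frame (hF : PerSmooth T F) (hx : ContDiffOn ℝ ∞ x (Ioo 0 T)) :
    PerSmooth T fun q => F (frame x q) where
  smooth := hF.smooth.comp (contDiffOn_fst.prodMk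
    ((hx.comp contDiffOn_fst fun _ hq => hq.1).add contDiffOn_snd)) fun _ hq => frame_mem hq
  periodic n q := by
    rw [← hF.periodic n (frame x q)]
    simp [frame, add_assoc]

lemma dirDeriv_comp_frame (hF : PerSmooth T F) (hx : ∀ t ∈ Ioo 0 T, HasDerivAt x (v t) t)
    (hq : q ∈ slab d T) (m : ℝ) (w : EuclideanSpace ℝ (Fin d)) :
    dirDeriv (m, w) (fun q => F (frame x q)) q = fderiv ℝ F (frame x q) (m, m • v q.1 + w) := by
  have h1 : HasFDerivAt (frame x) ((ContinuousLinearMap.fst ℝ ℝ (EuclideanSpace ℝ (Fin d))).prod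
      ((ContinuousLinearMap.fst ℝ ℝ (EuclideanSpace ℝ (Fin d))).smulRight (v q.1) +
        ContinuousLinearMap.snd ℝ ℝ (EuclideanSpace ℝ (Fin d)))) q := by
    refine hasFDerivAt_fst.prodMk (HasFDerivAt.add ?_ hasFDerivAt_snd)
    refine ((hx q.1 hq.1).hasFDerivAt.comp q hasFDerivAt_fst).congr_fderiv ?_
    ext <;> simp
  have h2 := ((hF.differentiableAt (frame_mem (x := x) hq)).hasFDerivAt.comp q h1).fderiv
  simp only [dirDeriv]
  erw [h2]
  simp

lemma dx_comp_frame (hF : PerSmooth T F) (hx : ∀ t ∈ Ioo 0 T, HasDerivAt x (v t) t) (a : Fin d) :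
    EqOn (dx a fun q => F (frame x q)) (fun q => dx a F (frame x q)) (slab d T) := fun q hq => by
  simp only [dx]
  rw [dirDeriv_comp_frame hF hx hq]
  simp [dirDeriv]

lemma lap_comp_frame (hF : PerSmooth T F) (hx : ∀ t ∈ Ioo 0 T, HasDerivAt x (v t) t)
    (hq : q ∈ slab d T) : lap (fun q => F (frame x q)) q = lap F (frame x q) :=
  Finset.sum_congr rfl fun a _ => (dirDeriv_congr (dx_comp_frame hF hx a) _ hq).trans
    (dx_comp_frame (hF.dirDeriv _) hx a hq)

lemma dt_comp_frame (hF : PerSmooth T F) (hx : ∀ t ∈ Ioo 0 T, HasDerivAt x (v t) t)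
    (hq : q ∈ slab d T) :
    dt (fun q => F (frame x q)) q = dt F (frame x q) + ∑ j, v q.1 j * dx j F (frame x q) := by
  rw [dt, dirDeriv_comp_frame hF hx hq, add_zero, fderiv_pair_eq, one_mul, one_mul]

lemma dx_eq_fderiv (hF : PerSmooth T F) {t : ℝ} (ht : t ∈ Ioo 0 T)
    (y : EuclideanSpace ℝ (Fin d)) (a : Fin d) :
    fderiv ℝ (fun y => F (t, y)) y (EuclideanSpace.single a 1) = dx a F (t, y) := by
  have h := ((hF.differentiableAt (mem_slab ht y)).hasFDerivAt.comp y
    (hasFDerivAt_prodMk_right t y)).fderiv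
  erw [h]
  rfl

lemma dt_eq_deriv (hF : PerSmooth T F) {t : ℝ} (ht : t ∈ Ioo 0 T)
    (y : EuclideanSpace ℝ (Fin d)) : deriv (fun s => F (s, y)) t = dt F (t, y) :=
  ((hF.differentiableAt (mem_slab ht y)).hasFDerivAt.comp_hasDerivAt t
    ((hasDerivAt_id t).prodMk (hasDerivAt_const t y))).deriv

lemma lap_eq_sum_fderiv (hF : PerSmooth T F) {t : ℝ} (ht : t ∈ Ioo 0 T)
    (y : EuclideanSpace ℝ (Fin d)) :
    ∑ a, fderiv ℝ (fun y => fderiv ℝ (fun z => F (t, z)) y (EuclideanSpace.single a 1)) y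
      (EuclideanSpace.single a 1) = lap F (t, y) := by
  refine Finset.sum_congr rfl fun a _ => ?_
  simp only [dx_eq_fderiv hF ht]
  exact dx_eq_fderiv (hF.dirDeriv _) ht y a

end MovingFrame

/-- A solution of the Navier–Stokes equations in the frame of one of its particles. -/
lemma flow_comp_frame {T ν M : ℝ} (hd : 1 ≤ d) (hM : 0 ≤ M)
    {u : ℝ → EuclideanSpace ℝ (Fin d) → EuclideanSpace ℝ (Fin d)}
    {p : ℝ → EuclideanSpace ℝ (Fin d) → ℝ}
    (hu : ContDiffOn ℝ ∞ (fun q : ℝ × EuclideanSpace ℝ (Fin d) => u q.1 q.2) (Ioo 0 T ×ˢ univ))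
    (hp : ContDiffOn ℝ ∞ (fun q : ℝ × EuclideanSpace ℝ (Fin d) => p q.1 q.2) (Ioo 0 T ×ˢ univ))
    (hup : ∀ t x n, u t (x + latticeVec n) = u t x) (hpp : ∀ t x n, p t (x + latticeVec n) = p t x)
    (hmom : ∀ t ∈ Ioo (0 : ℝ) T, ∀ (x : EuclideanSpace ℝ (Fin d)) (i : Fin d),
      deriv (fun s => u s x i) t
        + ∑ j, u t x j * fderiv ℝ (fun y => u t y i) x (EuclideanSpace.single j 1)
        + fderiv ℝ (fun y => p t y) x (EuclideanSpace.single i 1)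
      = ν * ∑ j, fderiv ℝ (fun y => fderiv ℝ (fun z => u t z i) y
          (EuclideanSpace.single j 1)) x (EuclideanSpace.single j 1))
    (hdiv : ∀ t ∈ Ioo (0 : ℝ) T, ∀ x : EuclideanSpace ℝ (Fin d),
      ∑ i, fderiv ℝ (fun y => u t y i) x (EuclideanSpace.single i 1) = 0)
    (hol : ∀ t ∈ Ioo 0 T, ∀ x y, ‖u t x - u t y‖ ≤ M * √‖x - y‖)
    {x : ℝ → EuclideanSpace ℝ (Fin d)} (hx : ContDiffOn ℝ ∞ x (Ioo 0 T))
    (hx' : ∀ t ∈ Ioo (0 : ℝ) T, HasDerivAt x (u t (x t)) t) :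
    Flow d T ν M (fun i q => u q.1 (x q.1 + q.2) i) (fun q => p q.1 (x q.1 + q.2)) := by
  set U : Fin d → ℝ × EuclideanSpace ℝ (Fin d) → ℝ := fun i q => u q.1 q.2 i
  set P : ℝ × EuclideanSpace ℝ (Fin d) → ℝ := fun q => p q.1 q.2
  have hU i : PerSmooth T (U i) :=
    ⟨(EuclideanSpace.proj (𝕜 := ℝ) i).contDiff.comp_contDiffOn hu, fun n q => by simp [U, hup]⟩
  have hP : PerSmooth T P := ⟨hp, fun n q => by simp [P, hpp]⟩
  have hmomU i t (ht : t ∈ Ioo 0 T) y :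
      dt (U i) (t, y) + ∑ j, u t y j * dx j (U i) (t, y) + dx i P (t, y) =
        ν * lap (U i) (t, y) := by
    have h := hmom t ht y i
    rw [← lap_eq_sum_fderiv (hU i) ht, ← dx_eq_fderiv hP ht, ← dt_eq_deriv (hU i) ht]
    simp only [← dx_eq_fderiv (hU i) ht]
    exact h
  change Flow d T ν M (fun i q => U i (frame x q)) (fun q => P (frame x q))
  refine ⟨hd, hM, fun i => (hU i).comp_frame hx, hP.comp_frame hx, fun i q hq => ?_,
    fun q hq => ?_, fun i s hs y => ?_⟩
  · have h := hmomU i q.1 hq.1 (x q.1 + q.2)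
    rw [dt_comp_frame (hU i) hx' hq, lap_comp_frame (hU i) hx' hq, dx_comp_frame hP hx' i hq]
    have e : ∑ j, (U j (frame x q) - U j (frame x (q.1, 0))) * dx j (fun q => U i (frame x q)) q =
        ∑ j, u q.1 (x q.1 + q.2) j * dx j (U i) (frame x q) -
          ∑ j, u q.1 (x q.1) j * dx j (U i) (frame x q) := by
      rw [← Finset.sum_sub_distrib]
      refine Finset.sum_congr rfl fun j _ => ?_
      rw [dx_comp_frame (hU i) hx' j hq, ← sub_mul]
      simp [U, frame]
    rw [e]
    change dt (U i) (frame x q) + ∑ j, u q.1 (x q.1 + q.2) j * dx j (U i) (frame x q) +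
      dx i P (frame x q) = ν * lap (U i) (frame x q) at h
    linarith
  · have h := hdiv q.1 hq.1 (x q.1 + q.2)
    rw [← h]
    refine Finset.sum_congr rfl fun i _ => ?_
    rw [dx_comp_frame (hU i) hx' i hq]
    exact (dx_eq_fderiv (hU i) hq.1 _ i).symm
  · have h := hol s hs (x s + y) (x s)
    rw [add_sub_cancel_left] at h
    refine le_trans ?_ h
    simpa [U, frame] using PiLp.norm_apply_le (u s (x s + y) - u s (x s)) i

lemma exists_rpow_scale {a ν M t : ℝ} (hν : 0 < ν) (hM : 0 < M)
    (ht : a * M ^ (-(4 : ℝ) / 3) * ν ^ ((1 : ℝ) / 3) ≤ t) :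
    ∃ κ, 0 < κ ∧ κ ^ 3 * M = ν ∧ a * κ ^ 4 ≤ ν * t := by
  have h3 : ((ν / M) ^ ((1 : ℝ) / 3)) ^ 3 = ν / M := by
    rw [← Real.rpow_natCast, ← Real.rpow_mul (by positivity)]
    norm_num
  have h4 : ((ν / M) ^ ((1 : ℝ) / 3)) ^ 4 = ν * (M ^ (-(4 : ℝ) / 3) * ν ^ ((1 : ℝ) / 3)) := by
    rw [← Real.rpow_natCast, ← Real.rpow_mul (by positivity), Real.div_rpow hν.le hM.le,
      neg_div, Real.rpow_neg hM.le, mul_left_comm]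
    nth_rw 2 [← Real.rpow_one ν]
    rw [← Real.rpow_add hν]
    norm_num [div_eq_mul_inv, mul_comm]
  refine ⟨(ν / M) ^ ((1 : ℝ) / 3), by positivity, ?_, ?_⟩
  · rw [h3]
    field_simp
  · rw [h4]
    have := mul_le_mul_of_nonneg_left ht hν.le
    linarith

end LagrangianRegularity

/-- Lagrangian estimate for trajectories, critical case `α = 1/2`. -/
theorem stmt5 (d : ℕ) (hd : 2 ≤ d) (α : ℝ) (hα : α = 1 / 2) :
    ∃ C : ℝ, 0 < C ∧
      ∀ T ν : ℝ, 0 < T → 0 < ν →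
      ∀ (u : ℝ → EuclideanSpace ℝ (Fin d) → EuclideanSpace ℝ (Fin d)) (p : ℝ → EuclideanSpace ℝ (Fin d) → ℝ),
        ContinuousOn (fun q : ℝ × EuclideanSpace ℝ (Fin d) => u q.1 q.2) (Ico 0 T ×ˢ univ) →
        ContDiffOn ℝ (⊤ : ℕ∞) (fun q : ℝ × EuclideanSpace ℝ (Fin d) => u q.1 q.2) (Ioo 0 T ×ˢ univ) →
        ContDiffOn ℝ (⊤ : ℕ∞) (fun q : ℝ × EuclideanSpace ℝ (Fin d) => p q.1 q.2) (Ioo 0 T ×ˢ univ) →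
        (∀ (t : ℝ) (x : EuclideanSpace ℝ (Fin d)) (n : Fin d → ℤ), u t (x + (EuclideanSpace.equiv (Fin d) ℝ).symm (fun i => (n i : ℝ))) = u t x) →
        (∀ (t : ℝ) (x : EuclideanSpace ℝ (Fin d)) (n : Fin d → ℤ), p t (x + (EuclideanSpace.equiv (Fin d) ℝ).symm (fun i => (n i : ℝ))) = p t x) →
        (∀ t ∈ Ioo (0 : ℝ) T, ∀ (x : EuclideanSpace ℝ (Fin d)) (i : Fin d),
          deriv (fun s => u s x i) t
              + ∑ j, u t x j * fderiv ℝ (fun y => u t y i) x (EuclideanSpace.single j 1)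
              + fderiv ℝ (fun y => p t y) x (EuclideanSpace.single i 1)
            = ν * ∑ j, fderiv ℝ (fun y => fderiv ℝ (fun z => u t z i) y
                (EuclideanSpace.single j 1)) x (EuclideanSpace.single j 1)) →
        (∀ t ∈ Ioo (0 : ℝ) T, ∀ x : EuclideanSpace ℝ (Fin d),
          ∑ i, fderiv ℝ (fun y => u t y i) x (EuclideanSpace.single i 1) = 0) →
        (∃ M₀ : ℝ, ∀ t ∈ Ico (0 : ℝ) T, ∀ x, ‖u t x‖ ≤ M₀) →
        ∀ M₁ : ℝ,
          IsLUB {r : ℝ | ∃ t ∈ Ico (0 : ℝ) T, ∃ x y : EuclideanSpace ℝ (Fin d),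
            x ≠ y ∧ r = ‖u t x - u t y‖ / ‖x - y‖ ^ α} M₁ →
          0 < M₁ →
          ∀ x : ℝ → EuclideanSpace ℝ (Fin d),
            ContDiffOn ℝ (⊤ : ℕ∞) x (Ioo 0 T) →
            (∀ t ∈ Ioo (0 : ℝ) T, HasDerivAt x (u t (x t)) t) →
            ∀ a : ℝ, 0 < a →
              ∀ t₁ t₂ : ℝ,
                t₁ ∈ Ico (a * M₁ ^ (-(4 : ℝ) / 3) * ν ^ ((1 : ℝ) / 3)) T →
                t₂ ∈ Ico (a * M₁ ^ (-(4 : ℝ) / 3) * ν ^ ((1 : ℝ) / 3)) T →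
                  ‖deriv x t₁ - deriv x t₂‖ ≤
                    C * (a⁻¹ + 1) * M₁ ^ 2 * |t₁ - t₂| *
                      (1 - min (Real.log (M₁ * |t₁ - t₂|)) 0) := by
  obtain ⟨A, hA⟩ := LagrangianRegularity.exists_momentBound d
  have hA0 := hA.nonneg
  refine ⟨32 * d ^ 4 * A + 1, by positivity, ?_⟩
  intro T ν _ hν u p _ hu hp hup hpp hmom hdiv _ M hM hM0 x hx hx' a ha
  have hol : ∀ t ∈ Ioo 0 T, ∀ y z, ‖u t y - u t z‖ ≤ M * √‖y - z‖ := by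
    intro t ht y z
    rcases eq_or_ne y z with rfl | hyz
    · simp
    have hpos : 0 < ‖y - z‖ := norm_pos_iff.2 (sub_ne_zero.2 hyz)
    have h := hM.1 ⟨t, Ioo_subset_Ico_self ht, y, z, hyz, rfl⟩
    rw [hα, ← Real.sqrt_eq_rpow] at h
    exact (div_le_iff₀ (Real.sqrt_pos.2 hpos)).1 h
  have hflow := LagrangianRegularity.flow_comp_frame (by lia) hM0.le hu hp hup hpp hmom hdiv hol
    hx hx'
  have key : ∀ t₁ t₂ : ℝ, a * M ^ (-(4 : ℝ) / 3) * ν ^ ((1 : ℝ) / 3) ≤ t₁ → t₁ < t₂ → t₂ < T →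
      ‖deriv x t₁ - deriv x t₂‖ ≤ (32 * d ^ 4 * A + 1) * (a⁻¹ + 1) * M ^ 2 * (t₂ - t₁) *
        (1 - min (Real.log (M * (t₂ - t₁))) 0) := by
    intro t₁ t₂ h₁ hlt h₂
    have ht₁ : 0 < t₁ := lt_of_lt_of_le (by positivity) h₁
    obtain ⟨κ, hκ, hκν, hκt⟩ := LagrangianRegularity.exists_rpow_scale hν hM0 h₁
    rw [(hx' t₁ ⟨ht₁, hlt.trans h₂⟩).deriv, (hx' t₂ ⟨ht₁.trans hlt, h₂⟩).deriv]
    refine (LagrangianRegularity.norm_le_sum_abs _).trans ?_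
    have hi i := hflow.abs_velocity_sub_le hν hM0 hA ha hκ hκν ht₁ hlt h₂ hκt i
    simp only [add_zero] at hi
    have hmin : min (Real.log (M * (t₂ - t₁))) 0 ≤ 0 := min_le_right _ _
    have hτ : 0 < t₂ - t₁ := sub_pos.2 hlt
    have hpos : 0 ≤ (a⁻¹ + 1) * M ^ 2 * (t₂ - t₁) *
        (1 - min (Real.log (M * (t₂ - t₁))) 0) := by
      have : 0 ≤ 1 - min (Real.log (M * (t₂ - t₁))) 0 := by linarith
      positivity
    have hsum := Finset.sum_le_card_nsmul Finset.univ _ _ fun i _ => hi i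
    simp only [Finset.card_univ, Fintype.card_fin, nsmul_eq_mul] at hsum
    exact hsum.trans (by linarith)
  intro t₁ t₂ h₁ h₂
  rcases lt_trichotomy t₁ t₂ with hlt | rfl | hlt
  · rw [abs_sub_comm, abs_of_pos (sub_pos.2 hlt)]
    exact key t₁ t₂ h₁.1 hlt h₂.2
  · simp
  · rw [norm_sub_rev, abs_of_pos (sub_pos.2 hlt)]
    exact key t₂ t₁ h₂.1 hlt h₁.2
end
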